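/- Let m ≥ 1 be an integer and let q be a power of 2. The maximum order of an element of the automorphism group Aut(Sp_{2m}(q)) is 6 if (m,q) = (1,4), 10 if (m,q) = (2,2), 20 if (m,q) = (2,4), and M_m(q) otherwise. -/

import Mathlib

/-- `Mm m q` is the function `M_m(q)` from Definition 1.2 of the paper. -/
def Mm (m q : ℕ) : ℕ :=
  if q = 2 then
    -- `L` is the largest positive integer `ℓ` with `2^ℓ - 1 ≤ m`
    let L := Nat.findGreatest (fun l => 0 < l ∧ 2 ^ l - 1 ≤ m) m
    let m0 := m - (2 ^ L - 1)
    if m0 ≤ 3 then q ^ m0 * (q ^ 2 ^ L - 1)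
    else if m0 < 2 ^ (L - 1) then
      if Odd m0 then (q ^ (2 ^ (L - 1) + m0) - 1) * (q ^ 2 ^ (L - 1) - 1)
      else q * (q ^ (2 ^ (L - 1) + m0 - 1) - 1) * (q ^ 2 ^ (L - 1) - 1)
    else if m0 = 2 ^ (L - 1) then (q ^ 2 ^ L + 1) * (q ^ 2 ^ (L - 1) - 1)
    else if Odd m0 then (q ^ m0 - 1) * (q ^ 2 ^ L - 1)
    else q * (q ^ (m0 - 1) - 1) * (q ^ 2 ^ L - 1)
  else if Odd m then
    -- the product of `q^(2^i) + 1` over the summands `2^i` of the 2-adic expansion of `m`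
    ∏ i ∈ Finset.range (m + 1), if m.testBit i then q ^ 2 ^ i + 1 else 1
  else if m = 2 then q ^ 2 + 1
  else
    -- `L` is the largest positive integer `ℓ` with `2^ℓ + 2^(ℓ-1) ≤ m`
    let L := Nat.findGreatest (fun l => 0 < l ∧ 2 ^ l + 2 ^ (l - 1) ≤ m) m
    (q ^ (m - 2 ^ L + 1) - 1) * (q ^ 2 ^ L - 1) / (q - 1)

section PartA
open Matrix
set_option linter.unusedSectionVars false
namespace SpAut

/-- The natural module. -/
abbrev VV (m : ℕ) (F : Type) := Fin m ⊕ Fin m → F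
/-- The symplectic group. -/
abbrev GG (m : ℕ) (F : Type) [Field F] := ↥(Matrix.symplecticGroup (Fin m) F)

section basics
variable {m : ℕ} {F : Type} [Field F]

/-- The symplectic form. -/
def bb (v w : VV m F) : F := v ⬝ᵥ (J (Fin m) F *ᵥ w)

theorem bb_add_left (u v w : VV m F) : bb (u + v) w = bb u w + bb v w := by
  simp [bb, add_dotProduct]
theorem bb_add_right (u v w : VV m F) : bb u (v + w) = bb u v + bb u w := by
  simp [bb, mulVec_add, dotProduct_add]
theorem bb_smul_left (a : F) (v w : VV m F) : bb (a • v) w = a * bb v w := by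
  simp [bb, smul_dotProduct]
theorem bb_smul_right (a : F) (v w : VV m F) : bb v (a • w) = a * bb v w := by
  simp [bb, mulVec_smul, dotProduct_smul]
@[simp] theorem bb_zero_left (w : VV m F) : bb 0 w = 0 := by simp [bb]
@[simp] theorem bb_zero_right (w : VV m F) : bb w 0 = 0 := by simp [bb]

theorem bb_eq (v w : VV m F) :
    bb v w = ∑ i, (v (Sum.inr i) * w (Sum.inl i) - v (Sum.inl i) * w (Sum.inr i)) := by
  have : J (Fin m) F *ᵥ w = Sum.elim (fun i => - w (Sum.inr i)) (fun i => w (Sum.inl i)) := by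
    funext i
    rw [J, Matrix.fromBlocks_mulVec]
    rcases i with i | i <;> simp [Matrix.neg_mulVec]
  simp [bb, this, dotProduct, Fintype.sum_sum_type, Finset.sum_sub_distrib, Finset.sum_neg_distrib]
  ring

theorem bb_self (v : VV m F) : bb v v = 0 := by
  rw [bb_eq]; apply Finset.sum_eq_zero; intro i _; ring

theorem bb_neg_comm (v w : VV m F) : bb v w = - bb w v := by
  rw [bb_eq, bb_eq, ← Finset.sum_neg_distrib]
  apply Finset.sum_congr rfl; intro i _; ring

theorem bb_nondeg {v : VV m F} (h : ∀ w, bb v w = 0) : v = 0 := by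
  funext i
  rcases i with i | i
  · have := h (Pi.single (Sum.inr i) 1)
    rw [bb_eq] at this
    simpa [Pi.single_apply, Finset.sum_ite_eq] using this
  · have := h (Pi.single (Sum.inl i) 1)
    rw [bb_eq] at this
    simpa [Pi.single_apply, Finset.sum_ite_eq] using this

theorem bb_act (g : GG m F) (v w : VV m F) : bb (g.1 *ᵥ v) (g.1 *ᵥ w) = bb v w := by
  have h := SymplecticGroup.mem_iff'.1 g.2
  unfold bb
  rw [mulVec_mulVec, ← vecMul_transpose g.1 v,
    ← dotProduct_mulVec, mulVec_mulVec, ← Matrix.mul_assoc, h]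

theorem mem_of_bb (A : Matrix (Fin m ⊕ Fin m) (Fin m ⊕ Fin m) F)
    (h : ∀ v w, bb (A *ᵥ v) (A *ᵥ w) = bb v w) : A ∈ symplecticGroup (Fin m) F := by
  rw [SymplecticGroup.mem_iff']
  apply Matrix.ext_of_mulVec_single
  intro j
  apply dotProduct_eq
  intro v
  have := h v (Pi.single j 1)
  unfold bb at this
  rw [mulVec_mulVec, ← vecMul_transpose A v,
    ← dotProduct_mulVec, mulVec_mulVec, ← Matrix.mul_assoc] at this
  rw [dotProduct_comm, this, dotProduct_comm]

theorem gg_ext {g h : GG m F} (H : ∀ v, g.1 *ᵥ v = h.1 *ᵥ v) : g = h := by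
  apply Subtype.ext
  apply Matrix.ext_of_mulVec_single
  intro j; exact H _

theorem mul_act (g h : GG m F) (v : VV m F) : (g * h).1 *ᵥ v = g.1 *ᵥ (h.1 *ᵥ v) := by
  rw [mulVec_mulVec]; rfl
@[simp] theorem one_act (v : VV m F) : (1 : GG m F).1 *ᵥ v = v := by
  simp
@[simp] theorem inv_act (g : GG m F) (v : VV m F) : (g⁻¹).1 *ᵥ (g.1 *ᵥ v) = v := by
  rw [← mul_act]; simp
@[simp] theorem act_inv (g : GG m F) (v : VV m F) : g.1 *ᵥ ((g⁻¹).1 *ᵥ v) = v := by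
  rw [← mul_act]; simp

theorem act_inj (g : GG m F) {v w : VV m F} (h : g.1 *ᵥ v = g.1 *ᵥ w) : v = w := by
  rw [← inv_act g v, h, inv_act]

/-- make a group element from a linear isometry -/
noncomputable def mkG (f : VV m F →ₗ[F] VV m F) (h : ∀ v w, bb (f v) (f w) = bb v w) : GG m F :=
  ⟨LinearMap.toMatrix' f, mem_of_bb _ (by simpa [LinearMap.toMatrix'_mulVec] using h)⟩

@[simp] theorem mkG_act (f : VV m F →ₗ[F] VV m F) (h) (v) : (mkG f h).1 *ᵥ v = f v := by
  simp [mkG, LinearMap.toMatrix'_mulVec]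

end basics

section char2
variable {m : ℕ} {F : Type} [Field F] [CharP F 2]

theorem bb_comm (v w : VV m F) : bb v w = bb w v := by
  rw [bb_neg_comm, CharTwo.neg_eq]

theorem vadd_self (v : VV m F) : v + v = 0 := by
  funext i; exact CharTwo.add_self_eq_zero _

theorem bb_nondeg_right {v : VV m F} (h : ∀ w, bb w v = 0) : v = 0 :=
  bb_nondeg (fun w => by rw [bb_comm]; exact h w)

/-- transvection as a linear map -/
noncomputable def tvl (v : VV m F) : VV m F →ₗ[F] VV m F where
  toFun x := x + bb x v • v
  map_add' x y := by rw [bb_add_left, add_smul]; abel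
  map_smul' a x := by simp [bb_smul_left, smul_add, smul_smul]

theorem tvl_apply (v x : VV m F) : tvl v x = x + bb x v • v := rfl

/-- transvection -/
noncomputable def tv (v : VV m F) : GG m F := mkG (tvl v) (by
  intro x y
  simp only [tvl_apply, bb_add_left, bb_add_right, bb_smul_left, bb_smul_right, bb_self, mul_zero,
    add_zero]
  rw [bb_comm v y]
  have := CharTwo.add_self_eq_zero (bb y v * bb x v)
  linear_combination this)

@[simp] theorem tv_act (v x : VV m F) : (tv v).1 *ᵥ x = x + bb x v • v := by
  simp [tv, tvl_apply]

theorem tv_mul_smul (v : VV m F) (a b : F) : tv (a • v) * tv (b • v) = tv ((a + b) • v) := by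
  apply gg_ext; intro x
  rw [mul_act]
  simp only [tv_act, bb_add_left, bb_smul_left, bb_smul_right, bb_self, mul_zero, add_zero, smul_smul]
  rw [add_assoc, ← add_smul]
  congr 2
  have := CharTwo.add_self_eq_zero (a * b * bb x v)
  linear_combination -this

@[simp] theorem tv_zero : tv (0 : VV m F) = 1 := by
  apply gg_ext; intro x; simp

theorem tv_mul_self (v : VV m F) : tv v * tv v = 1 := by
  have := tv_mul_smul v 1 1
  simpa [CharTwo.add_self_eq_zero] using this

theorem tv_inv (v : VV m F) : (tv v)⁻¹ = tv v := inv_eq_of_mul_eq_one_left (tv_mul_self v)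

theorem conj_tv (g : GG m F) (v : VV m F) : g * tv v * g⁻¹ = tv (g.1 *ᵥ v) := by
  apply gg_ext; intro x
  rw [mul_act, mul_act, tv_act, tv_act, mulVec_add, mulVec_smul, act_inv]
  congr 2
  rw [← bb_act g, act_inv]

theorem exists_bb_ne {v : VV m F} (h : v ≠ 0) : ∃ w, bb v w ≠ 0 := by
  by_contra hh; push Not at hh; exact h (bb_nondeg hh)

theorem tv_inj {v w : VV m F} (h : tv v = tv w) : v = w := by
  have H : ∀ x, bb x v • v = bb x w • w := fun x => by
    have := congrArg (fun g : GG m F => g.1 *ᵥ x) h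
    simpa using this
  by_cases hv : v = 0
  · subst hv
    by_contra hw
    obtain ⟨x, hx⟩ := exists_bb_ne (Ne.symm hw)
    rw [bb_comm] at hx
    have := H x
    simp only [smul_zero] at this
    rcases smul_eq_zero.1 this.symm with h1 | h1
    · exact hx h1
    · exact hw h1.symm
  · obtain ⟨x, hx⟩ := exists_bb_ne hv
    rw [bb_comm] at hx
    -- v = c w
    have h1 : v = ((bb x v)⁻¹ * bb x w) • w := by
      rw [mul_smul, ← H x, smul_smul, inv_mul_cancel₀ hx, one_smul]
    set c := (bb x v)⁻¹ * bb x w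
    have h2 := H x
    rw [h1] at hx
    rw [bb_smul_right] at hx
    rw [h1, bb_smul_right, smul_smul] at h2
    have hw : w ≠ 0 := by rintro rfl; simp at hx
    have h3 : (c * bb x w * c - bb x w) • w = 0 := by rw [sub_smul, h2, sub_self]
    have h4 := (smul_eq_zero.1 h3).resolve_right hw
    have h5 : c * c = 1 := by
      have : bb x w * (c * c - 1) = 0 := by linear_combination h4
      have := (mul_eq_zero.1 this).resolve_left (right_ne_zero_of_mul hx)
      linear_combination this
    have h6 : c = 1 := by
      have : (c - 1) * (c - 1) = 0 := by
        have h2 : (2 : F) = 0 := CharTwo.two_eq_zero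
        linear_combination h5 - (c - 1) * h2
      have := mul_self_eq_zero.1 this
      linear_combination this
    rw [h1, h6, one_smul]

theorem tv_commute_iff {v w : VV m F} (hv : v ≠ 0) : tv v * tv w = tv w * tv v ↔ bb v w = 0 := by
  have : tv v * tv w = tv w * tv v ↔ tv v * tv w * (tv v)⁻¹ = tv w :=
    ⟨fun h => by rw [h]; group, fun h => by rw [← mul_inv_eq_iff_eq_mul]; exact h⟩
  rw [this, conj_tv]
  constructor
  · intro h
    have := tv_inj h
    rw [tv_act] at this
    have : bb w v • v = 0 := by simpa using this
    rw [bb_comm]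
    exact (smul_eq_zero.1 this).resolve_right hv
  · intro h
    rw [tv_act, bb_comm, h]; simp

/-- only the identity commutes with all transvections -/
theorem eq_of_conj_tv {g h : GG m F} (H : ∀ v, g * tv v * g⁻¹ = h * tv v * h⁻¹) : g = h := by
  apply gg_ext; intro v
  have := H v
  rw [conj_tv, conj_tv] at this
  exact tv_inj this

theorem conj_injective : Function.Injective (MulAut.conj : GG m F →* MulAut (GG m F)) := by
  intro g h H
  apply eq_of_conj_tv
  intro v
  have := congrArg (fun s : MulAut (GG m F) => s (tv v)) H
  simpa [MulAut.conj_apply] using this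

theorem mem_span_of_perp {v u : VV m F} (h : ∀ z, bb v z = 0 → bb u z = 0) : ∃ c : F, u = c • v := by
  by_cases hv : v = 0
  · subst hv
    exact ⟨0, by simpa using bb_nondeg (fun w => h w (by simp))⟩
  · obtain ⟨z0, hz0⟩ := exists_bb_ne hv
    refine ⟨bb u z0 / bb v z0, ?_⟩
    rw [← sub_eq_zero]
    apply bb_nondeg
    intro z
    have h1 := h (z + (-(bb v z / bb v z0)) • z0) (by
      rw [bb_add_right, bb_smul_right]; field_simp; ring)
    rw [bb_add_right, bb_smul_right] at h1
    rw [sub_eq_add_neg, ← neg_smul, bb_add_left, bb_smul_left]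
    field_simp at h1 ⊢
    linear_combination h1

theorem exists_sqrt [Finite F] (a : F) : ∃ c : F, c * c = a := by
  obtain ⟨c, hc⟩ := FiniteField.isSquare_of_char_two (ringChar.eq F 2) a
  exact ⟨c, hc.symm⟩

theorem exists_common {v u u' : VV m F} (nu : ∀ c : F, u ≠ c • v) (nu' : ∀ c : F, u' ≠ c • v) :
    ∃ z, bb v z = 0 ∧ bb u z ≠ 0 ∧ bb u' z ≠ 0 := by
  have h1 : ∃ z, bb v z = 0 ∧ bb u z ≠ 0 := by
    by_contra hh; push Not at hh
    obtain ⟨c, hc⟩ := mem_span_of_perp hh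
    exact nu c hc
  have h2 : ∃ z, bb v z = 0 ∧ bb u' z ≠ 0 := by
    by_contra hh; push Not at hh
    obtain ⟨c, hc⟩ := mem_span_of_perp hh
    exact nu' c hc
  obtain ⟨z1, h1, h1'⟩ := h1
  obtain ⟨z2, h2, h2'⟩ := h2
  by_cases h3 : bb u' z1 = 0
  · by_cases h4 : bb u z2 = 0
    · exact ⟨z1 + z2, by simp [bb_add_right, h1, h2], by simpa [bb_add_right, h4] using h1',
        by simpa [bb_add_right, h3] using h2'⟩
    · exact ⟨z2, h2, h4, h2'⟩
  · exact ⟨z1, h1, h1', h3⟩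

/-- key transitivity -/
theorem exists_trans [Finite F] (v : VV m F) {u u' : VV m F} (hu : bb v u = 0) (hu' : bb v u' = 0)
    (nu : ∀ c : F, u ≠ c • v) (nu' : ∀ c : F, u' ≠ c • v) :
    ∃ g : GG m F, g.1 *ᵥ v = v ∧ g.1 *ᵥ u = u' := by
  have key : ∀ {u u' : VV m F}, bb v u = 0 → bb v u' = 0 → bb u u' ≠ 0 →
      ∃ g : GG m F, g.1 *ᵥ v = v ∧ g.1 *ᵥ u = u' := by
    intro u u' hu hu' hb
    obtain ⟨c, hc⟩ := exists_sqrt (bb u u')⁻¹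
    refine ⟨tv (c • (u + u')), ?_, ?_⟩
    · simp [bb_smul_right, bb_add_right, hu, hu']
    · rw [tv_act, smul_smul, bb_smul_right, bb_add_right, bb_self, zero_add]
      have : c * bb u u' * c = 1 := by
        have : c * bb u u' * c = (c * c) * bb u u' := by ring
        rw [this, hc, inv_mul_cancel₀ hb]
      rw [this, one_smul, ← add_assoc, vadd_self, zero_add]
  obtain ⟨z, hz, h1, h2⟩ := exists_common nu nu'
  obtain ⟨g, hg, hg'⟩ := key hu hz h1
  obtain ⟨k, hk, hk'⟩ := key hz hu' (by rwa [bb_comm])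
  exact ⟨k * g, by rw [mul_act, hg, hk], by rw [mul_act, hg', hk']⟩

theorem exists_trans0 [Finite F] {u u' : VV m F} (nu : u ≠ 0) (nu' : u' ≠ 0) :
    ∃ g : GG m F, g.1 *ᵥ u = u' := by
  obtain ⟨g, -, hg⟩ := exists_trans (0 : VV m F) (u := u) (u' := u') (by simp) (by simp)
    (by simpa using nu) (by simpa using nu')
  exact ⟨g, hg⟩

end char2
end SpAut
end PartA

section PartA2
open Matrix
set_option linter.unusedSectionVars false
namespace SpAut

section semilin
variable {m : ℕ} {F : Type} [Field F] [CharP F 2] [Finite F]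

/-- Entrywise field automorphism. -/
def phiG (φ : F ≃+* F) : MulAut (GG m F) where
  toFun g := ⟨g.1.map φ, SymplecticGroup.map_mem g.2 φ⟩
  invFun g := ⟨g.1.map φ.symm, SymplecticGroup.map_mem g.2 φ.symm⟩
  left_inv g := by ext; simp
  right_inv g := by ext; simp
  map_mul' g h := by
    apply Subtype.ext
    exact Matrix.map_mul (f := (φ : F →+* F))

theorem phiG_coe (φ : F ≃+* F) (g : GG m F) : (phiG φ g).1 = g.1.map φ := rfl

theorem phiG_act (φ : F ≃+* F) (g : GG m F) (v : VV m F) :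
    (phiG φ g).1 *ᵥ (φ ∘ v) = φ ∘ (g.1 *ᵥ v) := by
  funext i
  simp [phiG_coe, mulVec, dotProduct, map_sum]

theorem bb_map (φ : F ≃+* F) (v w : VV m F) : bb (φ ∘ v) (φ ∘ w) = φ (bb v w) := by
  simp [bb_eq, map_sum]

theorem bb_indep {v w : VV m F} (h : bb v w ≠ 0) {a b c d : F}
    (e : a • v + b • w = c • v + d • w) : a = c ∧ b = d := by
  have h1 := congrArg (fun z => bb z w) e
  have h2 := congrArg (fun z => bb v z) e
  simp only [bb_add_left, bb_smul_left, bb_add_right, bb_smul_right, bb_self] at h1 h2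
  simp [h] at h1 h2
  exact ⟨h1, h2⟩

theorem semilinear (σ : MulAut (GG m F)) (hD : ∀ v : VV m F, v ≠ 0 → ∃ w, w ≠ 0 ∧ σ (tv v) = tv w)
    (hm : 1 ≤ m) :
    ∃ (A : GG m F) (φ : F ≃+* F), ∀ g, σ g = A * phiG φ g * A⁻¹ := by
  classical
  have hs0 : ∀ v : VV m F, ∃ w, σ (tv v) = tv w := by
    intro v
    by_cases h : v = 0
    · exact ⟨0, by simp [h]⟩
    · obtain ⟨w, -, h⟩ := hD v h; exact ⟨w, h⟩
  choose s hs using hs0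
  have s0 : s 0 = 0 := by
    apply tv_inj; rw [← hs]; simp
  have sinj : Function.Injective s := by
    intro v w h
    apply tv_inj; apply σ.injective; rw [hs, hs, h]
  have ssurj : Function.Surjective s := Finite.surjective_of_injective sinj
  have sne : ∀ v, v ≠ 0 → s v ≠ 0 := fun v hv h => hv (sinj (h.trans s0.symm))
  have F2 : ∀ v w, bb v w = 0 ↔ bb (s v) (s w) = 0 := by
    intro v w
    by_cases h : v = 0
    · simp [h, s0]
    rw [← tv_commute_iff h, ← tv_commute_iff (sne v h), ← hs, ← hs, ← map_mul, ← map_mul]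
    exact σ.injective.eq_iff.symm
  have F2' : ∀ v w, bb v w ≠ 0 ↔ bb (s v) (s w) ≠ 0 := fun v w => not_congr (F2 v w)
  have Fact : ∀ (g : GG m F) v, (σ g).1 *ᵥ s v = s (g.1 *ᵥ v) := by
    intro g v
    apply tv_inj
    rw [← conj_tv, ← hs, ← hs, ← conj_tv]; simp
  have F3 : ∀ v w, s (w + bb w v • v) = s w + bb (s w) (s v) • s v := by
    intro v w
    have := Fact (tv v) w
    rw [hs, tv_act, tv_act] at this
    exact this.symm
  have F4 : ∀ v (a : F), ∃ c : F, s (a • v) = c • s v := by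
    intro v a
    apply mem_span_of_perp
    intro z hz
    obtain ⟨y, rfl⟩ := ssurj z
    rw [← F2] at hz ⊢
    rw [bb_smul_left, hz, mul_zero]
  choose α hα using F4
  have αadd : ∀ v, v ≠ 0 → ∀ a b, α v (a + b) = α v a + α v b := by
    intro v hv a b
    have h1 := congrArg σ (tv_mul_smul v a b)
    rw [map_mul, hs, hs, hs, hα, hα, hα, tv_mul_smul] at h1
    have := tv_inj h1
    exact (smul_left_injective F (sne v hv) this).symm
  have α1 : ∀ v, v ≠ 0 → α v 1 = 1 := by
    intro v hv
    have := hα v 1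
    rw [one_smul] at this
    apply smul_left_injective F (sne v hv)
    simp only; rw [← this, one_smul]
  have ne_of : ∀ {v w : VV m F}, bb v w ≠ 0 → v ≠ 0 ∧ w ≠ 0 := by
    intro v w h
    constructor <;> rintro rfl <;> simp at h
  have F1 : ∀ v w, bb v w = 1 → bb (s v) (s w) = 1 := by
    intro v w h
    have h' : bb w v = 1 := by rw [bb_comm, h]
    have e1 := F3 v w
    have e2 := F3 w v
    rw [h', one_smul] at e1
    rw [h, one_smul] at e2
    rw [add_comm v w, e1, bb_comm (s w) (s v)] at e2
    have hne : bb (s v) (s w) ≠ 0 := (F2' _ _).1 (by simp [h])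
    have := bb_indep hne (a := bb (s v) (s w)) (b := 1) (c := 1) (d := bb (s v) (s w))
      (by rw [one_smul, one_smul, add_comm, e2])
    exact this.1
  have F5 : ∀ v w (c : F), bb w v = 1 → s (w + (c * c) • v) = s w + (α v c * α v c) • s v := by
    intro v w c h
    have := F3 (c • v) w
    rw [bb_smul_right, h, mul_one, smul_smul, hα, bb_smul_right, F1 _ _ h, mul_one, smul_smul] at this
    exact this
  have F6 : ∀ v w (c : F), bb v w = 1 → s (v + c • w) = s v + s (c • w) := by
    intro v w c h
    by_cases hc : c = 0
    · simp [hc, s0]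
    obtain ⟨d, rfl⟩ := exists_sqrt c
    have e1 := F5 w v d h
    have h2 : bb ((d * d) • w) ((d * d)⁻¹ • v) = 1 := by
      rw [bb_smul_left, bb_smul_right, bb_comm w v, h, mul_one, mul_inv_cancel₀ hc]
    have e2 := F5 ((d * d)⁻¹ • v) ((d * d) • w) d h2
    rw [smul_smul, mul_inv_cancel₀ hc, one_smul, hα, hα v, smul_smul, add_comm _ v] at e2
    have hne : bb (s v) (s w) ≠ 0 := (F2' _ _).1 (by simp [h])
    have := bb_indep hne (a := 1) (b := α w d * α w d) ((congrArg (· + (α w d * α w d) • s w) (one_smul F (s v))).trans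
      (e1.symm.trans (e2.trans (add_comm _ _))))
    rw [e1, hα, this.2]
  have F7 : ∀ v w, bb v w ≠ 0 → s (v + w) = s v + s w := by
    intro v w h
    have := F6 v ((bb v w)⁻¹ • w) (bb v w) (by rw [bb_smul_right]; field_simp)
    rwa [smul_smul, mul_inv_cancel₀ h, one_smul] at this
  have F8 : ∀ v w, bb v w ≠ 0 → α v = α w := by
    intro v w h
    funext c
    by_cases hc : c = 0
    · have e1 := αadd v (ne_of h).1 0 0
      have e2 := αadd w (ne_of h).2 0 0
      rw [add_zero, left_eq_add] at e1 e2
      rw [hc, e1, e2]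
    have e := F7 (c • v) (c • w) (by rw [bb_smul_left, bb_smul_right]; simp [hc, h])
    rw [← smul_add, hα, F7 v w h, hα, hα, smul_add] at e
    have := bb_indep ((F2' _ _).1 h) e
    rw [← this.1, ← this.2]
  have F9 : ∀ v w, v ≠ 0 → w ≠ 0 → α v = α w := by
    intro v w hv hw
    obtain ⟨z, -, h1, h2⟩ := exists_common (v := (0 : VV m F)) (u := v) (u' := w)
      (by simpa using hv) (by simpa using hw)
    exact (F8 v z h1).trans (F8 w z h2).symm
  obtain ⟨v0, hv0⟩ : ∃ v : VV m F, v ≠ 0 :=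
    ⟨fun _ => 1, fun h => one_ne_zero (congrFun h (Sum.inl ⟨0, hm⟩))⟩
  set a := α v0 with ha
  have hsm : ∀ (c : F) v, s (c • v) = a c • s v := by
    intro c v
    by_cases hv : v = 0
    · simp [hv, s0]
    · rw [hα, F9 v v0 hv hv0]
  have a0 : a 0 = 0 := by
    have e1 := αadd v0 hv0 0 0
    rwa [add_zero, left_eq_add] at e1
  have amul : ∀ b c, a (b * c) = a b * a c := by
    intro b c
    have := hsm (b * c) v0
    rw [← smul_smul, hsm, hsm, smul_smul] at this
    exact (smul_left_injective F (sne v0 hv0) this).symm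
  let φ0 : F →+* F :=
    { toFun := a, map_one' := α1 v0 hv0, map_mul' := amul, map_zero' := a0, map_add' := αadd v0 hv0 }
  let φ : F ≃+* F := RingEquiv.ofBijective φ0
    ⟨φ0.injective, Finite.surjective_of_injective φ0.injective⟩
  have hφ : ∀ c, φ c = a c := fun c => rfl
  have F10 : ∀ v w, bb (s v) (s w) = φ (bb v w) := by
    intro v w
    by_cases h : bb v w = 0
    · rw [h, (F2 _ _).1 h, map_zero]
    have := F1 v ((bb v w)⁻¹ • w) (by rw [bb_smul_right]; field_simp)
    rw [hsm, bb_smul_right, ← hφ, map_inv₀] at this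
    have hne : φ (bb v w) ≠ 0 := by simpa using h
    field_simp at this
    exact this
  have F11 : ∀ v w, s (v + w) = s v + s w := by
    intro v w
    have : s (v + w) - (s v + s w) = 0 := by
      apply bb_nondeg
      intro z
      obtain ⟨y, rfl⟩ := ssurj z
      have e : s (v + w) - (s v + s w) = s (v + w) + (-1 : F) • (s v + s w) := by
        rw [neg_smul, one_smul, sub_eq_add_neg]
      rw [e, bb_add_left, bb_smul_left, bb_add_left, F10, F10, F10, bb_add_left, map_add]
      ring
    exact sub_eq_zero.1 this
  let f : VV m F →ₗ[F] VV m F :=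
    { toFun := fun v => s (φ.symm ∘ v)
      map_add' := by
        intro v w
        rw [← F11]; congr 1; funext i; simp
      map_smul' := by
        intro c v
        have : φ.symm ∘ (c • v) = φ.symm c • (φ.symm ∘ v) := by funext i; simp
        rw [this, hsm, ← hφ]; simp }
  let A : GG m F := mkG f (by
    intro v w
    change bb (s _) (s _) = _
    rw [F10, bb_map]; simp)
  have hA : ∀ v, A.1 *ᵥ v = s (φ.symm ∘ v) := fun v => mkG_act _ _ _
  refine ⟨A, φ, fun g => ?_⟩
  rw [eq_mul_inv_iff_mul_eq]
  apply gg_ext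
  intro v
  have hv : v = φ ∘ (φ.symm ∘ v) := by funext i; simp
  rw [mul_act, mul_act, hA, Fact, hA]
  conv_rhs => rw [hv, phiG_act]
  congr 1; funext i; simp
end semilin
end SpAut
end PartA2

section PartA3
open Matrix
set_option linter.unusedSectionVars false
namespace SpAut

section counting
variable {m : ℕ} {F : Type} [Field F] [CharP F 2] [Fintype F]
open Classical in
theorem card_submod (S : Submodule F (VV m F)) :
    (Finset.univ.filter (fun w => w ∈ S)).card = Fintype.card F ^ Module.finrank F S := by
  rw [← Module.card_eq_pow_finrank (K := F) (V := S), Fintype.card_subtype]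

open Classical in
theorem card_off (S : Submodule F (VV m F)) {v : VV m F} (hv : v ∈ S) (h0 : v ≠ 0) :
    (Finset.univ.filter (fun w => w ∈ S ∧ ∀ c : F, w ≠ c • v)).card
      = Fintype.card F ^ Module.finrank F S - Fintype.card F := by
  have h : Finset.univ.filter (fun w => w ∈ S ∧ ∀ c : F, w ≠ c • v)
      = Finset.univ.filter (fun w => w ∈ S) \ Finset.univ.image (fun c : F => c • v) := by
    ext w
    simp only [Finset.mem_filter, Finset.mem_univ, true_and, Finset.mem_sdiff, Finset.mem_image,
      not_exists]
    constructor
    · rintro ⟨a, b⟩; exact ⟨a, fun c hc => b c hc.symm⟩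
    · rintro ⟨a, b⟩; exact ⟨a, fun c hc => b c hc.symm⟩
  rw [h, Finset.card_sdiff_of_subset, card_submod, Finset.card_image_of_injective _ (smul_left_injective F h0),
    Finset.card_univ]
  intro w hw
  obtain ⟨c, -, rfl⟩ := Finset.mem_image.1 hw
  simpa using S.smul_mem c hv

open Classical in
theorem card_nz (S : Submodule F (VV m F)) :
    (Finset.univ.filter (fun w => w ∈ S ∧ w ≠ 0)).card = Fintype.card F ^ Module.finrank F S - 1 := by
  have h : Finset.univ.filter (fun w => w ∈ S ∧ w ≠ 0)
      = (Finset.univ.filter (fun w => w ∈ S)).erase 0 := by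
    ext w
    simp [and_comm]
  rw [h, Finset.card_erase_of_mem (by simp), card_submod]

/-- the orthogonal complement of a vector -/
def perpv (v : VV m F) : Submodule F (VV m F) where
  carrier := {w | bb v w = 0}
  add_mem' := by intro a b ha hb; simp only [Set.mem_ofPred_eq] at *; rw [bb_add_right, ha, hb, add_zero]
  zero_mem' := by simp
  smul_mem' := by intro c a ha; simp only [Set.mem_ofPred_eq] at *; rw [bb_smul_right, ha, mul_zero]

theorem mem_perpv (v w : VV m F) : w ∈ perpv v ↔ bb v w = 0 := Iff.rfl

theorem finrank_VV : Module.finrank F (VV m F) = 2 * m := by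
  simp [two_mul]

theorem finrank_perpv {v : VV m F} (h : v ≠ 0) : Module.finrank F (perpv v) = 2 * m - 1 := by
  let f : VV m F →ₗ[F] F :=
    { toFun := fun w => bb v w, map_add' := fun a b => bb_add_right v a b,
      map_smul' := fun c a => bb_smul_right c v a }
  have e : perpv v = LinearMap.ker f := by ext w; rfl
  have h1 := LinearMap.finrank_range_add_finrank_ker f
  rw [finrank_VV] at h1
  have h2 : LinearMap.range f = ⊤ := by
    rw [LinearMap.range_eq_top]
    intro y
    obtain ⟨w, hw⟩ := exists_bb_ne h
    exact ⟨(y / bb v w) • w, by change bb v _ = _; rw [bb_smul_right]; field_simp⟩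
  rw [h2, finrank_top, Module.finrank_self] at h1
  rw [e]; omega

theorem exists_trans2 {v w v' w' : VV m F} (hv : v ≠ 0) (hv' : v' ≠ 0) (h : bb v w = 0)
    (h' : bb v' w' = 0) (hw : ∀ c : F, w ≠ c • v) (hw' : ∀ c : F, w' ≠ c • v') :
    ∃ g : GG m F, g.1 *ᵥ v = v' ∧ g.1 *ᵥ w = w' := by
  obtain ⟨g1, hg1⟩ := exists_trans0 hv hv'
  obtain ⟨g2, a, b⟩ := exists_trans v' (u := g1.1 *ᵥ w) (u' := w') (by rw [← hg1, bb_act, h]) h'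
    (by
      intro c hc
      rw [← hg1, ← mulVec_smul] at hc
      exact hw c (act_inj g1 hc)) hw'
  exact ⟨g2 * g1, by rw [mul_act, hg1, a], by rw [mul_act, b]⟩

open Classical in
theorem count_dvd (hm : 1 ≤ m) (σ : MulAut (GG m F)) (P : GG m F → VV m F → VV m F → Prop)
    (hP : ∀ h t v w, P t v w → P (h * t * h⁻¹) (h.1 *ᵥ v) (h.1 *ᵥ w))
    (hΩ : ∀ x, x ≠ 0 → ∀ v w, P (σ (tv x)) v w → v ≠ 0 ∧ bb v w = 0 ∧ ∀ c : F, w ≠ c • v)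
    (k : ℕ) (v0 : VV m F) (hv0 : v0 ≠ 0)
    (hk : (Finset.univ.filter (fun p : (_ : VV m F) × VV m F => P (σ (tv v0)) p.1 p.2)).card = k) :
    ∃ c, k = (Fintype.card F ^ (2 * m - 1) - Fintype.card F) * c := by
  let Ω : Finset ((_ : VV m F) × VV m F) := (Finset.univ.filter (fun v => v ≠ 0)).sigma
    (fun v => Finset.univ.filter (fun w => w ∈ perpv v ∧ ∀ c : F, w ≠ c • v))
  have hmem : ∀ p : (_ : VV m F) × VV m F, p ∈ Ω ↔ p.1 ≠ 0 ∧ bb p.1 p.2 = 0 ∧ ∀ c : F, p.2 ≠ c • p.1 := by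
    intro p; simp [Ω, Finset.mem_sigma, mem_perpv]
  have hnz : (Finset.univ.filter (fun v : VV m F => v ≠ 0)).card = Fintype.card F ^ (2 * m) - 1 := by
    have := card_nz (⊤ : Submodule F (VV m F))
    rw [finrank_top, finrank_VV] at this
    simpa using this
  have hcΩ : Ω.card = (Fintype.card F ^ (2 * m) - 1) * (Fintype.card F ^ (2 * m - 1) - Fintype.card F) := by
    rw [Finset.card_sigma, Finset.sum_congr rfl (g := fun _ => Fintype.card F ^ (2 * m - 1) - Fintype.card F)]
    · rw [Finset.sum_const, hnz, smul_eq_mul]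
    · intro v hv
      have hv : v ≠ 0 := by simpa using hv
      rw [card_off _ (by rw [mem_perpv, bb_self]) hv, finrank_perpv hv]
  let D : Finset (VV m F) := Finset.univ.filter (fun v => v ≠ 0)
  let r : VV m F → (_ : VV m F) × VV m F → Prop := fun x p => P (σ (tv x)) p.1 p.2
  -- moving
  have hact : ∀ (h : GG m F) x, σ (tv ((σ.symm h).1 *ᵥ x)) = h * σ (tv x) * h⁻¹ := by
    intro h x
    rw [← conj_tv]; simp
  have key1 : ∀ x ∈ D, (Ω.bipartiteAbove r x).card = k := by
    intro x hx
    have hx : x ≠ 0 := by simpa [D] using hx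
    rw [← hk]
    obtain ⟨g, hg⟩ := exists_trans0 hx hv0
    have e0 : σ (tv v0) = σ g * σ (tv x) * (σ g)⁻¹ := by
      rw [← hg, ← conj_tv]; simp
    apply Finset.card_bij (fun p _ => ⟨(σ g).1 *ᵥ p.1, (σ g).1 *ᵥ p.2⟩)
    · intro p hp
      have hp := (Finset.mem_bipartiteAbove _).1 hp
      simp only [Finset.mem_filter, Finset.mem_univ, true_and]
      rw [e0]; exact hP _ _ _ _ hp.2
    · rintro ⟨a, b⟩ _ ⟨c, d⟩ _ h
      simp only [Sigma.mk.injEq, heq_eq_eq] at h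
      rw [act_inj _ h.1, act_inj _ h.2]
    · intro p hp
      simp only [Finset.mem_filter, Finset.mem_univ, true_and] at hp
      have h2 := hP (σ g)⁻¹ _ _ _ hp
      have e1 : (σ g)⁻¹ * σ (tv v0) * ((σ g)⁻¹)⁻¹ = σ (tv x) := by rw [e0]; group
      rw [e1] at h2
      refine ⟨⟨((σ g)⁻¹).1 *ᵥ p.1, ((σ g)⁻¹).1 *ᵥ p.2⟩, ?_, ?_⟩
      · rw [Finset.mem_bipartiteAbove]
        exact ⟨(hmem _).2 (hΩ x hx _ _ h2), h2⟩
      · simp only [act_inv]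
  by_cases hΩe : Ω.Nonempty
  swap
  · rw [Finset.not_nonempty_iff_eq_empty] at hΩe
    refine ⟨0, ?_⟩
    rw [← key1 v0 (by simpa [D] using hv0), hΩe]; simp [Finset.bipartiteAbove]
  obtain ⟨p0, hp0⟩ := hΩe
  have key2 : ∀ p ∈ Ω, (D.bipartiteBelow r p).card = (D.bipartiteBelow r p0).card := by
    intro p hp
    obtain ⟨a1, a2, a3⟩ := (hmem _).1 hp
    obtain ⟨b1, b2, b3⟩ := (hmem _).1 hp0
    obtain ⟨g, g1, g2⟩ := exists_trans2 a1 b1 a2 b2 a3 b3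
    have nz : ∀ (h : GG m F) (x : VV m F), x ≠ 0 → h.1 *ᵥ x ≠ 0 := by
      intro h x hx h0
      exact hx (act_inj h (by rw [h0, mulVec_zero]))
    apply Finset.card_bij (fun x _ => (σ.symm g).1 *ᵥ x)
    · intro x hx
      obtain ⟨x1, x2⟩ := (Finset.mem_bipartiteBelow _).1 hx
      refine (Finset.mem_bipartiteBelow _).2 ⟨?_, ?_⟩
      · simp only [D, Finset.mem_filter, Finset.mem_univ, true_and] at x1 ⊢
        exact nz _ _ x1
      · change P _ _ _
        rw [hact, ← g1, ← g2]; exact hP _ _ _ _ x2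
    · intro x _ y _ h
      exact act_inj _ h
    · intro x hx
      obtain ⟨x1, x2⟩ := (Finset.mem_bipartiteBelow _).1 hx
      refine ⟨((σ.symm g)⁻¹).1 *ᵥ x, (Finset.mem_bipartiteBelow _).2 ⟨?_, ?_⟩, act_inv _ _⟩
      · simp only [D, Finset.mem_filter, Finset.mem_univ, true_and] at x1 ⊢
        exact nz _ _ x1
      · change P _ _ _
        have := hP g⁻¹ _ _ _ x2
        rw [← g1, ← g2, inv_act, inv_act] at this
        rw [← map_inv, hact]; exact this
  have := Finset.card_mul_eq_card_mul r key1 key2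
  rw [hcΩ, hnz, mul_assoc] at this
  refine ⟨_, Nat.eq_of_mul_eq_mul_left ?_ this⟩
  have : 1 < Fintype.card F ^ (2 * m) := Nat.one_lt_pow (by omega) Fintype.one_lt_card
  omega

/-- `t - 1` as a linear map -/
noncomputable def TT (t : GG m F) : VV m F →ₗ[F] VV m F := Matrix.mulVecLin t.1 + LinearMap.id

theorem TT_apply (t : GG m F) (x : VV m F) : TT t x = t.1 *ᵥ x + x := rfl

theorem TT_conj (h t : GG m F) (x : VV m F) : TT (h * t * h⁻¹) (h.1 *ᵥ x) = h.1 *ᵥ TT t x := by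
  rw [TT_apply, TT_apply, mul_act, mul_act, inv_act, mulVec_add]

theorem invol_bb {t : GG m F} (ht : t * t = 1) (x y : VV m F) : bb x (t.1 *ᵥ y) = bb (t.1 *ᵥ x) y := by
  rw [← bb_act t, ← mul_act, ht, one_act]

theorem invol_TT {t : GG m F} (ht : t * t = 1) (x : VV m F) : TT t (TT t x) = 0 := by
  rw [TT_apply, TT_apply, mulVec_add, ← mul_act, ht, one_act, add_comm x, vadd_self]

theorem invol_iso {t : GG m F} (ht : t * t = 1) (x y : VV m F) : bb (TT t x) (TT t y) = 0 := by
  rw [TT_apply, TT_apply, bb_add_left, bb_add_right, bb_add_right, bb_act, invol_bb ht]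
  have : (2 : F) = 0 := CharTwo.two_eq_zero
  linear_combination (bb x y + bb (t.1 *ᵥ x) y) * this

theorem finrank_range_TT {t : GG m F} (ht : t * t = 1) :
    Module.finrank F (LinearMap.range (TT t)) ≤ m ∧ 
    Module.finrank F (LinearMap.range (TT t)) + Module.finrank F (LinearMap.ker (TT t)) = 2 * m := by
  have h1 := LinearMap.finrank_range_add_finrank_ker (TT t)
  rw [finrank_VV] at h1
  have h2 : LinearMap.range (TT t) ≤ LinearMap.ker (TT t) := by
    rintro _ ⟨x, rfl⟩
    exact invol_TT ht x
  have h3 := Submodule.finrank_mono h2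
  omega

theorem eq_one_of_TT {t : GG m F} (h : ∀ x, TT t x = 0) : t = 1 := by
  apply gg_ext; intro x
  have := h x
  rw [TT_apply] at this
  rw [one_act, ← sub_eq_zero, ← this, sub_eq_add_neg]
  congr 1
  rw [neg_eq_iff_add_eq_zero, vadd_self]

/-- rank one involutions are transvections -/
theorem tv_of_rank_one {t : GG m F} (ht : t * t = 1) (h1 : t ≠ 1)
    (hr : Module.finrank F (LinearMap.range (TT t)) ≤ 1) : ∃ w, w ≠ 0 ∧ t = tv w := by
  obtain ⟨v, hv⟩ := (finrank_le_one_iff).1 hr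
  have hv2 : ∀ x, ∃ c : F, TT t x = c • v.1 := by
    intro x
    obtain ⟨c, hc⟩ := hv ⟨TT t x, x, rfl⟩
    exact ⟨c, by rw [← Submodule.coe_smul, hc]⟩
  choose f hf using hv2
  have hv0 : v.1 ≠ 0 := by
    intro h0
    apply h1; apply eq_one_of_TT; intro x; rw [hf, h0, smul_zero]
  obtain ⟨z, hz⟩ := exists_bb_ne hv0
  have sym : ∀ x y, bb x (TT t y) = bb (TT t x) y := by
    intro x y; rw [TT_apply, TT_apply, bb_add_left, bb_add_right, invol_bb ht]
  have hfy : ∀ y, f y = f z / bb v.1 z * bb y v.1 := by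
    intro y
    have := sym z y
    rw [hf, hf, bb_smul_right, bb_smul_left, bb_comm z, bb_comm v.1 y] at this
    field_simp; linear_combination this
  obtain ⟨c, hc⟩ := exists_sqrt (f z / bb v.1 z)
  have e : t = tv (c • v.1) := by
    apply gg_ext; intro x
    rw [tv_act]
    have h2 := hf x
    rw [TT_apply, hfy, ← hc] at h2
    have h3 : t.1 *ᵥ x = (t.1 *ᵥ x + x) + x := by rw [add_assoc, vadd_self, add_zero]
    rw [h3, h2, bb_smul_right, smul_smul, add_comm]
    congr 2; ring
  refine ⟨_, ?_, e⟩
  intro h0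
  rw [h0, tv_zero] at e
  exact h1 e

open Classical in
theorem rank_cases (hm : 1 ≤ m) (σ : MulAut (GG m F)) (v0 : VV m F) (hv0 : v0 ≠ 0) (hm2 : m ≠ 2) :
    Module.finrank F (LinearMap.range (TT (σ (tv v0)))) ≤ 1 := by
  have hinv : ∀ x, σ (tv x) * σ (tv x) = 1 := by
    intro x; rw [← map_mul, tv_mul_self, map_one]
  obtain ⟨hr, -⟩ := finrank_range_TT (hinv v0)
  set r := Module.finrank F (LinearMap.range (TT (σ (tv v0)))) with hrdef
  by_contra hlt
  push Not at hlt
  obtain ⟨c, hc⟩ := count_dvd hm σ (fun t v w => v ∈ LinearMap.range (TT t) ∧ v ≠ 0 ∧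
      w ∈ LinearMap.range (TT t) ∧ ∀ c : F, w ≠ c • v) (by
        rintro h t v w ⟨⟨x, rfl⟩, b, ⟨y, rfl⟩, d⟩
        refine ⟨⟨h.1 *ᵥ x, TT_conj _ _ _⟩, fun h0 => b (act_inj h (by rw [h0, mulVec_zero])),
          ⟨h.1 *ᵥ y, TT_conj _ _ _⟩, fun c hc => d c ?_⟩
        rw [← mulVec_smul] at hc
        exact act_inj h hc) (by
        rintro x hx v w ⟨⟨y, rfl⟩, b, ⟨z, rfl⟩, d⟩
        exact ⟨b, invol_iso (hinv x) _ _, d⟩)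
      ((Fintype.card F ^ r - 1) * (Fintype.card F ^ r - Fintype.card F)) v0 hv0 (by
        have : Finset.univ.filter (fun p : (_ : VV m F) × VV m F =>
            p.1 ∈ LinearMap.range (TT (σ (tv v0))) ∧ p.1 ≠ 0 ∧
            p.2 ∈ LinearMap.range (TT (σ (tv v0))) ∧ ∀ c : F, p.2 ≠ c • p.1)
          = (Finset.univ.filter (fun v => v ∈ LinearMap.range (TT (σ (tv v0))) ∧ v ≠ 0)).sigma
            (fun v => Finset.univ.filter (fun w => w ∈ LinearMap.range (TT (σ (tv v0))) ∧ ∀ c : F, w ≠ c • v)) := by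
          ext p; simp only [Finset.mem_filter, Finset.mem_sigma, Finset.mem_univ, true_and]; tauto
        refine Eq.trans (Eq.trans (by congr!) (congrArg Finset.card this)) ?_
        rw [Finset.card_sigma, Finset.sum_congr rfl (g := fun _ => Fintype.card F ^ r - Fintype.card F)]
        · rw [Finset.sum_const, card_nz, smul_eq_mul]
        · intro v hv
          simp only [Finset.mem_filter, Finset.mem_univ, true_and] at hv
          rw [card_off _ hv.1 hv.2])
  have hq : 2 ≤ Fintype.card F := Fintype.one_lt_card
  generalize Fintype.card F = q at hc hq
  clear_value r
  -- cancel q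
  obtain ⟨s, rfl⟩ : ∃ s, r = s + 2 := ⟨r - 2, by omega⟩
  obtain ⟨n, rfl⟩ : ∃ n, m = n + s + 2 := ⟨m - s - 2, by omega⟩
  have e1 : (q ^ (s + 2) - 1) * (q ^ (s + 1) - 1) = (q ^ (2 * (n + s + 1)) - 1) * c := by
    have a1 : q ^ (s + 2) - q = q * (q ^ (s + 1) - 1) := by
      rw [Nat.mul_sub, mul_one, pow_succ q (s + 1), mul_comm]
    have a2 : q ^ (2 * (n + s + 2) - 1) - q = q * (q ^ (2 * (n + s + 1)) - 1) := by
      rw [Nat.mul_sub, mul_one, mul_comm q, ← pow_succ]; congr 2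
    rw [a1, a2] at hc
    have : q * ((q ^ (s + 2) - 1) * (q ^ (s + 1) - 1)) = q * ((q ^ (2 * (n + s + 1)) - 1) * c) := by
      linear_combination hc
    exact Nat.eq_of_mul_eq_mul_left (by omega) this
  have hx1 : 1 < q ^ (s + 1) := Nat.one_lt_pow (by omega) hq
  rcases Nat.eq_zero_or_pos n with rfl | hn
  · -- r = m
    have b1 : q ^ (2 * (0 + s + 1)) - 1 = (q ^ (s + 1) - 1) * (q ^ (s + 1) + 1) := by
      have := Nat.sq_sub_sq (q ^ (s + 1)) 1
      rw [one_pow, ← pow_mul] at this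
      rw [mul_comm (q ^ (s + 1) - 1), ← this]; congr 2; ring
    rw [b1, mul_comm, mul_assoc] at e1
    have e2 := Nat.eq_of_mul_eq_mul_left (by omega) e1
    have e3 : q ^ (s + 1) + 1 ∣ q + 1 := by
      have d1 : q ^ (s + 1) + 1 ∣ q ^ (s + 2) - 1 := ⟨c, e2⟩
      have d2 : q ^ (s + 1) + 1 ∣ q * (q ^ (s + 1) + 1) := ⟨q, by ring⟩
      have := Nat.dvd_sub d2 d1
      have hge : 1 ≤ q ^ (s + 2) := Nat.one_le_pow _ _ (by omega)
      have e4 : q * (q ^ (s + 1) + 1) - (q ^ (s + 2) - 1) = q + 1 := by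
        have : q * (q ^ (s + 1) + 1) = q ^ (s + 2) + q := by ring
        omega
      rwa [e4] at this
    have e5 := Nat.le_of_dvd (by omega) e3
    have : s + 1 ≤ 1 := by
      by_contra hs
      have : q ^ 1 < q ^ (s + 1) := Nat.pow_lt_pow_right hq (by omega)
      rw [pow_one] at this
      omega
    omega
  · have hc0 : 0 < c := by
      rcases Nat.eq_zero_or_pos c with rfl | h
      · rw [mul_zero, mul_eq_zero] at e1
        have : 1 < q ^ (s + 2) := Nat.one_lt_pow (by omega) hq
        omega
      · exact h
    have l1 : (q ^ (s + 2) - 1) * (q ^ (s + 1) - 1) < q ^ (s + 2) * q ^ (s + 1) := by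
      have : 1 < q ^ (s + 2) := Nat.one_lt_pow (by omega) hq
      exact Nat.mul_lt_mul'' (by omega) (by omega)
    rw [← pow_add] at l1
    have l2 : q ^ (s + 2 + (s + 1)) < q ^ (2 * (n + s + 1)) := Nat.pow_lt_pow_right hq (by omega)
    have l3 : q ^ (2 * (n + s + 1)) - 1 ≤ (q ^ (2 * (n + s + 1)) - 1) * c := Nat.le_mul_of_pos_right _ hc0
    omega
end counting
end SpAut
end PartA3

section PartA4
open Matrix
set_option linter.unusedSectionVars false
namespace SpAut

section alt
variable {F : Type} [Field F] [CharP F 2] [Fintype F]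

theorem sq_inj2 {a b : F} (h : a * a = b * b) : a = b := by
  have : (a + b) * (a + b) = 0 := by
    have h2 : (2 : F) = 0 := CharTwo.two_eq_zero
    linear_combination h + (a * b + b * b) * h2
  have := mul_self_eq_zero.1 this
  rwa [CharTwo.add_eq_zero] at this

theorem exists_repr {m : ℕ} (f : VV m F →ₗ[F] F) : ∃ u, ∀ x, f x = bb x u := by
  let L : VV m F →ₗ[F] (VV m F →ₗ[F] F) :=
    LinearMap.mk₂ F (fun u x => bb x u) (fun a b c => bb_add_right c a b) (fun a b c => bb_smul_right a c b)
      (fun a b c => bb_add_left b c a) (fun a b c => bb_smul_left a c b)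
  have hL : ∀ u x, L u x = bb x u := fun _ _ => rfl
  have inj : Function.Injective L := by
    rw [← LinearMap.ker_eq_bot, LinearMap.ker_eq_bot']
    intro u hu
    apply bb_nondeg_right
    intro w
    rw [← hL, hu]; rfl
  have hd : Module.finrank F (VV m F) = Module.finrank F (VV m F →ₗ[F] F) :=
    (Subspace.dual_finrank_eq (K := F) (V := VV m F)).symm
  obtain ⟨u, hu⟩ := (LinearMap.injective_iff_surjective_of_finrank_eq_finrank hd).1 inj f
  exact ⟨u, fun x => by rw [← hu, hL]⟩

theorem exists_quad {m : ℕ} {t : GG m F} (ht : t * t = 1) : ∃ u, ∀ x, bb x (t.1 *ᵥ x) = bb x u * bb x u := by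
  choose f hf using fun x : VV m F => exists_sqrt (bb x (t.1 *ᵥ x))
  let f' : VV m F →ₗ[F] F :=
    { toFun := f
      map_add' := by
        intro x y
        apply sq_inj2
        have : (f x + f y) * (f x + f y) = f x * f x + f y * f y := by
          rw [CharTwo.add_mul_self]
        rw [this, hf, hf, hf, mulVec_add, bb_add_left, bb_add_right, bb_add_right, invol_bb ht x y,
          bb_comm y]
        have h2 : (2 : F) = 0 := CharTwo.two_eq_zero
        linear_combination (bb (t.1 *ᵥ x) y) * h2
      map_smul' := by
        intro c x
        apply sq_inj2
        have : (c * f x) * (c * f x) = c * (c * (f x * f x)) := by ring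
        simp only [RingHom.id_apply, smul_eq_mul]
        rw [this, hf, hf, mulVec_smul, bb_smul_left, bb_smul_right] }
  obtain ⟨u, hu⟩ := exists_repr f'
  exact ⟨u, fun x => by rw [← hu, ← hf]; rfl⟩

open Classical in
theorem alt_of_rank_two (σ : MulAut (GG 2 F)) (v0 : VV 2 F) (hv0 : v0 ≠ 0)
    (hr : Module.finrank F (LinearMap.range (TT (σ (tv v0)))) = 2) (x : VV 2 F) :
    bb x ((σ (tv v0)).1 *ᵥ x) = 0 := by
  have hinv : ∀ x, σ (tv x) * σ (tv x) = 1 := by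
    intro x; rw [← map_mul, tv_mul_self, map_one]
  obtain ⟨u, hu⟩ := exists_quad (hinv v0)
  by_contra hx
  have hu0 : u ≠ 0 := by
    rintro rfl
    exact hx (by rw [hu]; simp)
  have hfix : ∀ (t : GG 2 F) v, t * t = 1 → (∀ x, bb x (t.1 *ᵥ x) = bb x v * bb x v) → t.1 *ᵥ v = v := by
    intro t v ht h
    have : ∀ x, bb x (t.1 *ᵥ v) = bb x v := by
      intro x
      rw [invol_bb ht]
      apply sq_inj2
      rw [← h, ← h, bb_act]
    rw [← sub_eq_zero]
    apply bb_nondeg_right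
    intro w
    rw [sub_eq_add_neg, ← neg_one_smul F v, bb_add_right, bb_smul_right, this]; ring
  have huW : u ∈ LinearMap.range (TT (σ (tv v0))) := by
    have h1 := (finrank_range_TT (hinv v0)).2
    have h2 : LinearMap.range (TT (σ (tv v0))) ≤ LinearMap.ker (TT (σ (tv v0))) := by
      rintro _ ⟨x, rfl⟩
      exact invol_TT (hinv v0) x
    rw [Submodule.eq_of_le_of_finrank_eq h2 (by omega), LinearMap.mem_ker, TT_apply,
      hfix _ _ (hinv v0) hu, vadd_self]
  obtain ⟨c, hc⟩ := count_dvd (by norm_num) σ (fun t v w => (∀ x, bb x (t.1 *ᵥ x) = bb x v * bb x v)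
      ∧ v ≠ 0 ∧ w ∈ LinearMap.range (TT t) ∧ ∀ c : F, w ≠ c • v) (by
        rintro h t v w ⟨a, b, ⟨y, rfl⟩, d⟩
        refine ⟨fun x => ?_, fun h0 => b (act_inj h (by rw [h0, mulVec_zero])),
          ⟨h.1 *ᵥ y, TT_conj _ _ _⟩, fun c hc => d c ?_⟩
        · obtain ⟨x, rfl⟩ : ∃ x', x = h.1 *ᵥ x' := ⟨(h⁻¹).1 *ᵥ x, (act_inv _ _).symm⟩
          rw [mul_act, mul_act, inv_act, bb_act, bb_act, a]
        rw [← mulVec_smul] at hc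
        exact act_inj h hc) (by
        rintro x hx v w ⟨a, b, ⟨z, rfl⟩, d⟩
        refine ⟨b, ?_, d⟩
        rw [TT_apply, bb_add_right, invol_bb (hinv x), hfix _ _ (hinv x) a, CharTwo.add_self_eq_zero])
      (Fintype.card F ^ 2 - Fintype.card F) v0 hv0 (by
        have hco := card_off _ huW hu0
        rw [hr] at hco
        refine Eq.trans ?_ hco
        apply Finset.card_bij (fun p _ => p.2)
        · intro p hp
          simp only [Finset.mem_filter, Finset.mem_univ, true_and] at hp ⊢
          have : p.1 = u := by
            rw [← sub_eq_zero]
            apply bb_nondeg_right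
            intro w
            rw [sub_eq_add_neg, ← neg_one_smul F u, bb_add_right, bb_smul_right,
              sq_inj2 ((hp.1 w).symm.trans (hu w))]; ring
          rw [← this]
          exact hp.2.2
        · rintro ⟨a, b⟩ hp ⟨c, d⟩ hp' h
          simp only [Finset.mem_filter, Finset.mem_univ, true_and] at hp hp' h
          have : a = c := by
            rw [← sub_eq_zero]
            apply bb_nondeg_right
            intro w
            rw [sub_eq_add_neg, ← neg_one_smul F c, bb_add_right, bb_smul_right,
              sq_inj2 ((hp.1 w).symm.trans (hp'.1 w))]; ring
          rw [this, h]
        · intro w hw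
          simp only [Finset.mem_filter, Finset.mem_univ, true_and] at hw
          exact ⟨⟨u, w⟩, by simp only [Finset.mem_filter, Finset.mem_univ, true_and]; exact ⟨hu, hu0, hw⟩, rfl⟩)
  have hq : 2 ≤ Fintype.card F := Fintype.one_lt_card
  generalize Fintype.card F = q at hc hq
  have h1 : q ^ 2 < q ^ 3 := Nat.pow_lt_pow_right hq (by norm_num)
  have h2 : q ^ 1 < q ^ 2 := Nat.pow_lt_pow_right hq (by norm_num)
  rw [pow_one] at h2
  norm_num at hc
  rcases Nat.eq_zero_or_pos c with rfl | hc0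
  · omega
  · have := Nat.le_mul_of_pos_right (q ^ 3 - q) hc0
    omega

/-- Summary: image of transvections. -/
theorem image_cases {m : ℕ} (hm : 1 ≤ m) (σ : MulAut (GG m F)) :
    (∀ v : VV m F, v ≠ 0 → ∃ w, w ≠ 0 ∧ σ (tv v) = tv w) ∨
    (m = 2 ∧ ∀ v : VV m F, v ≠ 0 → Module.finrank F (LinearMap.range (TT (σ (tv v)))) = 2 ∧
      ∀ x, bb x ((σ (tv v)).1 *ᵥ x) = 0) := by
  have hinv : ∀ x, σ (tv x) * σ (tv x) = 1 := by
    intro x; rw [← map_mul, tv_mul_self, map_one]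
  have hne : ∀ v : VV m F, v ≠ 0 → σ (tv v) ≠ 1 := by
    intro v hv h
    rw [MulEquiv.map_eq_one_iff] at h
    exact hv (tv_inj (h.trans tv_zero.symm))
  by_cases hm2 : m = 2
  swap
  · left
    intro v hv
    exact tv_of_rank_one (hinv v) (hne v hv) (rank_cases hm σ v hv hm2)
  subst hm2
  by_cases h : ∀ v : VV 2 F, v ≠ 0 → Module.finrank F (LinearMap.range (TT (σ (tv v)))) ≤ 1
  · left
    intro v hv
    exact tv_of_rank_one (hinv v) (hne v hv) (h v hv)
  · right
    refine ⟨rfl, ?_⟩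
    push Not at h
    obtain ⟨v0, hv0, hr⟩ := h
    have hrk : ∀ v : VV 2 F, v ≠ 0 → Module.finrank F (LinearMap.range (TT (σ (tv v)))) = 2 := by
      intro v hv
      have h1 := (finrank_range_TT (hinv v)).1
      obtain ⟨g, hg⟩ := exists_trans0 hv hv0
      have e0 : σ (tv v0) = σ g * σ (tv v) * (σ g)⁻¹ := by
        rw [← hg, ← conj_tv]; simp
      have h2 : LinearMap.range (TT (σ (tv v0))) ≤ (LinearMap.range (TT (σ (tv v)))).map (Matrix.mulVecLin (σ g).1) := by
        rintro _ ⟨x, rfl⟩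
        refine ⟨TT (σ (tv v)) (((σ g)⁻¹).1 *ᵥ x), ⟨_, rfl⟩, ?_⟩
        rw [Matrix.mulVecLin_apply, ← TT_conj, ← e0, act_inv]
      have h3 : Module.finrank F (LinearMap.range (TT (σ (tv v0)))) ≤
          Module.finrank F (LinearMap.range (TT (σ (tv v)))) :=
        (Submodule.finrank_mono h2).trans (Submodule.finrank_map_le _ _)
      exact le_antisymm h1 (le_trans hr h3)
    exact fun v hv => ⟨hrk v hv, alt_of_rank_two σ v hv (hrk v hv)⟩
end alt
end SpAut
end PartA4

section PartD0
open Matrix Polynomial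
namespace SpAut
theorem det_fin_four {R : Type*} [CommRing R] (M : Matrix (Fin 4) (Fin 4) R) :
    M.det = M 0 0 * (M 1 1 * M 2 2 * M 3 3 - M 1 1 * M 2 3 * M 3 2 - M 1 2 * M 2 1 * M 3 3 + M 1 2 * M 2 3 * M 3 1
        + M 1 3 * M 2 1 * M 3 2 - M 1 3 * M 2 2 * M 3 1)
      - M 0 1 * (M 1 0 * M 2 2 * M 3 3 - M 1 0 * M 2 3 * M 3 2 - M 1 2 * M 2 0 * M 3 3 + M 1 2 * M 2 3 * M 3 0
        + M 1 3 * M 2 0 * M 3 2 - M 1 3 * M 2 2 * M 3 0)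
      + M 0 2 * (M 1 0 * M 2 1 * M 3 3 - M 1 0 * M 2 3 * M 3 1 - M 1 1 * M 2 0 * M 3 3 + M 1 1 * M 2 3 * M 3 0
        + M 1 3 * M 2 0 * M 3 1 - M 1 3 * M 2 1 * M 3 0)
      - M 0 3 * (M 1 0 * M 2 1 * M 3 2 - M 1 0 * M 2 2 * M 3 1 - M 1 1 * M 2 0 * M 3 2 + M 1 1 * M 2 2 * M 3 0
        + M 1 2 * M 2 0 * M 3 1 - M 1 2 * M 2 1 * M 3 0) := by
  rw [det_succ_row_zero, Fin.sum_univ_four]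
  simp only [det_fin_three, submatrix_apply]
  simp [Fin.succAbove, Fin.lt_def]
  ring

theorem charpoly_fin_four {R : Type*} [CommRing R] (M : Matrix (Fin 4) (Fin 4) R) :
    M.charpoly = X ^ 4 - C (M 0 0 + M 1 1 + M 2 2 + M 3 3) * X ^ 3 
     + C (M 0 0 * M 1 1 - M 0 1 * M 1 0 + (M 0 0 * M 2 2 - M 0 2 * M 2 0) + (M 0 0 * M 3 3 - M 0 3 * M 3 0)
       + (M 1 1 * M 2 2 - M 1 2 * M 2 1) + (M 1 1 * M 3 3 - M 1 3 * M 3 1) + (M 2 2 * M 3 3 - M 2 3 * M 3 2)) * X ^ 2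
     - C ((M 1 1 * M 2 2 * M 3 3 - M 1 1 * M 2 3 * M 3 2 - M 1 2 * M 2 1 * M 3 3 + M 1 2 * M 2 3 * M 3 1
        + M 1 3 * M 2 1 * M 3 2 - M 1 3 * M 2 2 * M 3 1)
      + (M 0 0 * M 2 2 * M 3 3 - M 0 0 * M 2 3 * M 3 2 - M 0 2 * M 2 0 * M 3 3 + M 0 2 * M 2 3 * M 3 0
        + M 0 3 * M 2 0 * M 3 2 - M 0 3 * M 2 2 * M 3 0)
      + (M 0 0 * M 1 1 * M 3 3 - M 0 0 * M 1 3 * M 3 1 - M 0 1 * M 1 0 * M 3 3 + M 0 1 * M 1 3 * M 3 0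
        + M 0 3 * M 1 0 * M 3 1 - M 0 3 * M 1 1 * M 3 0)
      + (M 0 0 * M 1 1 * M 2 2 - M 0 0 * M 1 2 * M 2 1 - M 0 1 * M 1 0 * M 2 2 + M 0 1 * M 1 2 * M 2 0
        + M 0 2 * M 1 0 * M 2 1 - M 0 2 * M 1 1 * M 2 0)) * X + C M.det := by
  rw [charpoly, det_fin_four, det_fin_four]
  simp [charmatrix_apply]
  ring
end SpAut
end PartD0

section PartD
open Matrix
set_option linter.unusedSectionVars false
namespace SpAut

section graph
variable {F : Type} [Field F] [CharP F 2] [Fintype F]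

/-- index set for `m = 2` -/
abbrev I4 := Fin 2 ⊕ Fin 2

/-- permanent minor = determinant minor in characteristic two -/
def pmin (M : Matrix I4 I4 F) (a b c d : I4) : F := M a c * M b d + M a d * M b c

/-- first index of the pair -/
def pa : I4 → I4 := Sum.elim (fun _ => Sum.inl 0) (fun _ => Sum.inr 0)
/-- second index of the pair -/
def pb : I4 → I4 := Sum.elim ![Sum.inl 1, Sum.inr 1] ![Sum.inr 1, Sum.inl 1]

/-- matrix of the graph automorphism -/
def gm (M : Matrix I4 I4 F) : Matrix I4 I4 F := Matrix.of fun I K => pmin M (pa I) (pb I) (pa K) (pb K)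

theorem gm_apply (M : Matrix I4 I4 F) (I K : I4) : gm M I K = pmin M (pa I) (pb I) (pa K) (pb K) := rfl

theorem two0 : (2 : F) = 0 := CharTwo.two_eq_zero

theorem pmin_mul (M N : Matrix I4 I4 F) (a b c d : I4) :
    pmin (M * N) a b c d = pmin M a b (.inl 0) (.inl 1) * pmin N (.inl 0) (.inl 1) c d
      + pmin M a b (.inl 0) (.inr 1) * pmin N (.inl 0) (.inr 1) c d
      + pmin M a b (.inr 0) (.inr 1) * pmin N (.inr 0) (.inr 1) c d
      + pmin M a b (.inr 0) (.inl 1) * pmin N (.inr 0) (.inl 1) c d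
      + pmin M a b (.inl 0) (.inr 0) * pmin N (.inl 0) (.inr 0) c d
      + pmin M a b (.inl 1) (.inr 1) * pmin N (.inl 1) (.inr 1) c d := by
  simp only [pmin, mul_apply, Fintype.sum_sum_type, Fin.sum_univ_two]
  have : ∀ k, M a k * N k c * M b k * N k d * 2 = 0 := fun k => by rw [two0, mul_zero]
  linear_combination this (.inl 0) + this (.inl 1) + this (.inr 0) + this (.inr 1)

theorem row_rel (g : GG 2 F) (a b : I4) :
    pmin g.1 a b (.inl 0) (.inr 0) + pmin g.1 a b (.inl 1) (.inr 1) = J (Fin 2) F a b := by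
  have h := congrFun (congrFun (SymplecticGroup.mem_iff.1 g.2) a) b
  rw [← h]
  simp only [pmin, mul_apply, Fintype.sum_sum_type, Fin.sum_univ_two, J, transpose_apply, fromBlocks_apply₁₁,
    fromBlocks_apply₁₂, fromBlocks_apply₂₁, fromBlocks_apply₂₂]
  simp
  linear_combination (g.1 a (.inl 0) * g.1 b (.inr 0) + g.1 a (.inl 1) * g.1 b (.inr 1)) * two0 (F := F)

theorem col_rel (g : GG 2 F) (a b : I4) :
    pmin g.1 (.inl 0) (.inr 0) a b + pmin g.1 (.inl 1) (.inr 1) a b = J (Fin 2) F a b := by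
  have h := congrFun (congrFun (SymplecticGroup.mem_iff'.1 g.2) a) b
  rw [← h]
  simp only [pmin, mul_apply, Fintype.sum_sum_type, Fin.sum_univ_two, J, transpose_apply, fromBlocks_apply₁₁,
    fromBlocks_apply₁₂, fromBlocks_apply₂₁, fromBlocks_apply₂₂]
  simp
  linear_combination (g.1 (.inl 0) a * g.1 (.inr 0) b + g.1 (.inl 1) a * g.1 (.inr 1) b) * two0 (F := F)

theorem J_pair (I : I4) : J (Fin 2) F (pa I) (pb I) = 0 := by
  rcases I with i | i <;> fin_cases i <;> simp [pa, pb, J]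

theorem gm_mul (g h : GG 2 F) : gm (g.1 * h.1) = gm g.1 * gm h.1 := by
  ext I K
  have h1 := row_rel g (pa I) (pb I)
  have h2 := col_rel h (pa K) (pb K)
  rw [J_pair] at h1 h2
  rw [gm_apply, pmin_mul, mul_apply, Fintype.sum_sum_type, Fin.sum_univ_two, Fin.sum_univ_two]
  simp only [gm_apply]
  have : pmin g.1 (pa I) (pb I) (.inl 0) (.inr 0) * pmin h.1 (.inl 0) (.inr 0) (pa K) (pb K) +
    pmin g.1 (pa I) (pb I) (.inl 1) (.inr 1) * pmin h.1 (.inl 1) (.inr 1) (pa K) (pb K) = 0 := by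
    linear_combination pmin h.1 (.inl 0) (.inr 0) (pa K) (pb K) * h1 + pmin g.1 (pa I) (pb I) (.inl 1) (.inr 1) * h2
      - pmin g.1 (pa I) (pb I) (.inl 1) (.inr 1) * pmin h.1 (.inl 0) (.inr 0) (pa K) (pb K) * two0 (F := F)
  simp only [pa, pb, Sum.elim_inl, Sum.elim_inr, Matrix.cons_val_zero, Matrix.cons_val_one] at this ⊢
  linear_combination this

theorem gm_J : gm (J (Fin 2) F) = J (Fin 2) F := by
  ext I K
  rcases I with i | i <;> rcases K with k | k <;> fin_cases i <;> fin_cases k <;>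
    simp [gm_apply, pmin, pa, pb, J, CharTwo.neg_eq]

theorem gm_transpose (M : Matrix I4 I4 F) : gm Mᵀ = (gm M)ᵀ := by
  ext I K
  simp only [gm_apply, pmin, transpose_apply]; ring

theorem gm_mem (g : GG 2 F) : gm g.1 ∈ symplecticGroup (Fin 2) F := by
  rw [SymplecticGroup.mem_iff, ← gm_transpose]
  let j : GG 2 F := ⟨J (Fin 2) F, SymplecticGroup.J_mem _ _⟩
  let gt : GG 2 F := ⟨g.1ᵀ, SymplecticGroup.transpose_mem g.2⟩
  have e1 := gm_mul g j
  have e2 := gm_mul (g * j) gt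
  have e3 : (g * j).1 * gt.1 = J (Fin 2) F := SymplecticGroup.mem_iff.1 g.2
  have e4 : gm j.1 = J (Fin 2) F := gm_J
  have e5 : (g * j).1 = g.1 * j.1 := rfl
  rw [e3, gm_J, e5, e1, e4] at e2
  exact e2.symm

theorem sylv_key {as as' at0 at1 bs bs' bt bt' cs cs' ct ct' : F}
    (h1 : as * bs' + as' * bs + at0 * bt' + at1 * bt = 0)
    (h2 : as * cs' + as' * cs + at0 * ct' + at1 * ct = 0)
    (h3 : bs * cs' + bs' * cs + bt * ct' + bt' * ct = 1) :
    as * (bt * ct' + bt' * ct) + at0 * (bs * ct' + bt' * cs) + at1 * (bs * ct + bt * cs) = as := by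
  linear_combination as * h3 + cs * h1 + bs * h2 - (as' * bs * cs + as * bs * cs' + as * bs' * cs) * two0 (F := F)

theorem sylv {as as' at0 at1 bs bs' bt bt' cs cs' ct ct' : F}
    (h1 : as * bs' + as' * bs + at0 * bt' + at1 * bt = 0)
    (h2 : as * cs' + as' * cs + at0 * ct' + at1 * ct = 0)
    (h3 : bs * cs' + bs' * cs + bt * ct' + bt' * ct = 1) :
    (as * bt + at0 * bs) * (as * ct' + at1 * cs) + (as * bt' + at1 * bs) * (as * ct + at0 * cs) = as * as := by
  have key := sylv_key h1 h2 h3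
  linear_combination as * key + (at0 * at1 * bs * cs) * two0 (F := F)

theorem gm_gm_aux (g : GG 2 F) (a b c : I4) (h1 : J (Fin 2) F a b = 0) (h2 : J (Fin 2) F a c = 0)
    (h3 : J (Fin 2) F b c = 1) (s s' t t' : I4)
    (hs : ∀ x y, g.1 x s * g.1 y s' + g.1 x s' * g.1 y s + g.1 x t * g.1 y t' + g.1 x t' * g.1 y t
      = pmin g.1 x y (.inl 0) (.inr 0) + pmin g.1 x y (.inl 1) (.inr 1)) :
    (g.1 a s * g.1 b t + g.1 a t * g.1 b s) * (g.1 a s * g.1 c t' + g.1 a t' * g.1 c s) +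
    (g.1 a s * g.1 b t' + g.1 a t' * g.1 b s) * (g.1 a s * g.1 c t + g.1 a t * g.1 c s) = g.1 a s * g.1 a s :=
  sylv ((hs a b).trans ((row_rel g a b).trans h1)) ((hs a c).trans ((row_rel g a c).trans h2))
    ((hs b c).trans ((row_rel g b c).trans h3))

/-- the hyperbolic partner of the other pair -/
def oth : I4 → I4 := Sum.elim ![.inl 1, .inl 0] ![.inr 1, .inr 0]

theorem gm_gm (g : GG 2 F) (I K : I4) : gm (gm g.1) I K = g.1 I K * g.1 I K := by
  have H := gm_gm_aux g I (oth I) (oth I).swap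
    (by rcases I with i | i <;> fin_cases i <;> simp [oth, J])
    (by rcases I with i | i <;> fin_cases i <;> simp [oth, J])
    (by rcases I with i | i <;> fin_cases i <;> simp [oth, J, CharTwo.neg_eq])
    K K.swap (oth K) (oth K).swap
    (by
      intro x y
      rcases K with i | i <;> fin_cases i <;> simp [oth, pmin] <;> ring)
  rw [← H]
  rcases I with i | i <;> rcases K with k | k <;> fin_cases i <;> fin_cases k <;>
    simp [gm_apply, pmin, pa, pb, oth] <;> ring

/-- the Frobenius -/
noncomputable def frob2 : F ≃+* F := RingEquiv.ofBijective (frobenius F 2)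
  ⟨frobenius_inj F 2, Finite.surjective_of_injective (frobenius_inj F 2)⟩

theorem frob2_apply (x : F) : frob2 x = x * x := by
  change frobenius F 2 x = _
  rw [frobenius_def, sq]

theorem gm_one : gm (1 : Matrix I4 I4 F) = 1 := by
  ext I K
  rcases I with i | i <;> rcases K with k | k <;> fin_cases i <;> fin_cases k <;>
    simp [gm_apply, pmin, pa, pb, Matrix.one_apply]

/-- the graph endomorphism -/
def gmH : GG 2 F →* GG 2 F where
  toFun g := ⟨gm g.1, gm_mem g⟩
  map_one' := Subtype.ext gm_one
  map_mul' g h := Subtype.ext (gm_mul g h)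

theorem gmH_gmH (g : GG 2 F) : gmH (gmH g) = phiG frob2 g := by
  apply Subtype.ext; ext I K
  rw [phiG_coe, Matrix.map_apply, frob2_apply]
  exact gm_gm g I K

theorem gmH_bij : Function.Bijective (gmH : GG 2 F → GG 2 F) := by
  have : Function.Injective (gmH : GG 2 F → GG 2 F) := by
    intro g h hh
    apply (phiG frob2).injective
    rw [← gmH_gmH, ← gmH_gmH, hh]
  exact ⟨this, Finite.surjective_of_injective this⟩

/-- the graph automorphism -/
noncomputable def gamma : MulAut (GG 2 F) := MulEquiv.ofBijective gmH gmH_bij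

theorem gamma_coe (g : GG 2 F) : (gamma g).1 = gm g.1 := rfl
theorem gamma_gamma (g : GG 2 F) : gamma (gamma g) = phiG frob2 g := gmH_gmH g

theorem gamma_phi (φ : F ≃+* F) (g : GG 2 F) : gamma (phiG φ g) = phiG φ (gamma g) := by
  apply Subtype.ext; ext I K
  simp only [gamma_coe, phiG_coe, Matrix.map_apply, gm_apply, pmin, map_add, map_mul]

/-- second coefficient of the characteristic polynomial -/
def Pc (M : Matrix I4 I4 F) : F :=
  pmin M (.inl 0) (.inl 1) (.inl 0) (.inl 1) + pmin M (.inl 0) (.inr 1) (.inl 0) (.inr 1)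
  + pmin M (.inr 0) (.inr 1) (.inr 0) (.inr 1) + pmin M (.inr 0) (.inl 1) (.inr 0) (.inl 1)
  + pmin M (.inl 0) (.inr 0) (.inl 0) (.inr 0) + pmin M (.inl 1) (.inr 1) (.inl 1) (.inr 1)

theorem trace_gamma (g : GG 2 F) : (gamma g).1.trace = Pc g.1 := by
  have h1 := row_rel g (.inl 0) (.inr 0)
  have h2 := col_rel g (.inl 1) (.inr 1)
  have h3 : J (Fin 2) F (.inl 0) (.inr 0) = 1 := by simp [J, CharTwo.neg_eq]
  have h4 : J (Fin 2) F (.inl 1) (.inr 1) = 1 := by simp [J, CharTwo.neg_eq]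
  rw [h3] at h1
  rw [h4] at h2
  rw [trace, Fintype.sum_sum_type, Fin.sum_univ_two, Fin.sum_univ_two]
  simp only [diag_apply, gamma_coe, gm_apply, Pc, pa, pb, Sum.elim_inl, Sum.elim_inr, Matrix.cons_val_zero, Matrix.cons_val_one]
  linear_combination -h1 - h2 + (pmin g.1 (.inl 0) (.inr 0) (.inl 1) (.inr 1) - 1) * two0 (F := F)

theorem minor3 (g : GG 2 F) (I : I4) : g.1 I I * (g.1 (oth I) (oth I) * g.1 (oth I).swap (oth I).swap
      + g.1 (oth I) (oth I).swap * g.1 (oth I).swap (oth I))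
    + g.1 I (oth I) * (g.1 (oth I) I * g.1 (oth I).swap (oth I).swap + g.1 (oth I) (oth I).swap * g.1 (oth I).swap I)
    + g.1 I (oth I).swap * (g.1 (oth I) I * g.1 (oth I).swap (oth I) + g.1 (oth I) (oth I) * g.1 (oth I).swap I)
    = g.1 I I := by
  have hs : ∀ x y, g.1 x I * g.1 y I.swap + g.1 x I.swap * g.1 y I + g.1 x (oth I) * g.1 y (oth I).swap
      + g.1 x (oth I).swap * g.1 y (oth I)
      = J (Fin 2) F x y := by
    intro x y
    rw [← row_rel g]
    rcases I with i | i <;> fin_cases i <;> simp [oth, pmin] <;> ring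
  apply sylv_key (as' := g.1 I I.swap) (bs' := g.1 (oth I) I.swap) (cs' := g.1 (oth I).swap I.swap)
  · rw [hs]; rcases I with i | i <;> fin_cases i <;> simp [oth, J]
  · rw [hs]; rcases I with i | i <;> fin_cases i <;> simp [oth, J]
  · rw [hs]; rcases I with i | i <;> fin_cases i <;> simp [oth, J, CharTwo.neg_eq]

open Polynomial in
theorem charpoly_gg (g : GG 2 F) : g.1.charpoly = X ^ 4 + C g.1.trace * X ^ 3
    + C (Pc g.1) * X ^ 2 + C g.1.trace * X + 1 := by
  let e : I4 ≃ Fin 4 :=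
    ⟨Sum.elim ![0, 1] ![2, 3], ![.inl 0, .inl 1, .inr 0, .inr 1], by decide, by decide⟩
  have h1 := charpoly_reindex e g.1
  have h2 : (reindex e e g.1).det = 1 := by rw [det_reindex_self, SymplecticGroup.det_eq_one g.2]
  rw [← h1, charpoly_fin_four, h2, map_one]
  have m1 := minor3 g (.inl 0)
  have m2 := minor3 g (.inl 1)
  have m3 := minor3 g (.inr 0)
  have m4 := minor3 g (.inr 1)
  have e0 : e.symm 0 = .inl 0 := rfl
  have e1 : e.symm 1 = .inl 1 := rfl
  have e2 : e.symm 2 = .inr 0 := rfl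
  have e3 : e.symm 3 = .inr 1 := rfl
  have o1 : oth (.inl 0) = .inl 1 := rfl
  have o2 : oth (.inl 1) = .inl 0 := rfl
  have o3 : oth (.inr 0) = .inr 1 := rfl
  have o4 : oth (.inr 1) = .inr 0 := rfl
  simp only [o1, o2, o3, o4, Sum.swap_inl, Sum.swap_inr] at m1 m2 m3 m4
  have ht : g.1.trace = g.1 (.inl 0) (.inl 0) + g.1 (.inl 1) (.inl 1) + g.1 (.inr 0) (.inr 0) + g.1 (.inr 1) (.inr 1) := by
    rw [trace, Fintype.sum_sum_type, Fin.sum_univ_two, Fin.sum_univ_two]; simp [diag_apply]; ring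
  have hPc : Pc g.1 = Pc (fun a b => g.1 a b) := rfl
  rw [ht, hPc]
  have key : ∀ M : I4 → I4 → F, (∀ a b, M a b = g.1 a b) → ∀ i j, reindex e e g.1 i j = M (e.symm i) (e.symm j) :=
    fun M hM i j => by rw [hM]; rfl
  obtain ⟨M, hM⟩ : ∃ M : I4 → I4 → F, ∀ a b, M a b = g.1 a b := ⟨fun a b => g.1 a b, fun _ _ => rfl⟩
  simp only [key M hM, e0, e1, e2, e3, ← hM] at m1 m2 m3 m4 ⊢
  have hn : ∀ p q : F, p - q = p + q := fun p q => by rw [sub_eq_add_neg, CharTwo.neg_eq]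
  have hp : ∀ p q : F[X], p - q = p + q := fun p q => by rw [sub_eq_add_neg, CharTwo.neg_eq]
  simp only [hp, hn]
  have key2 : ∀ a b b' c c' : F, b = b' → c = c' → (X ^ 4 + C a * X ^ 3 + C b * X ^ 2 + C c * X + 1 : F[X]) =
      X ^ 4 + C a * X ^ 3 + C b' * X ^ 2 + C c' * X + 1 := by rintro a b _ c _ rfl rfl; rfl
  apply key2
  · simp only [Pc, pmin]; ring
  · linear_combination m1 + m2 + m3 + m4

end graph
end SpAut
end PartD

section PartD2
open Matrix
set_option linter.unusedSectionVars false
namespace SpAut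

section graph2
variable {F : Type} [Field F] [CharP F 2] [Fintype F]

theorem entry_act {m : ℕ} (g : GG m F) (I K : Fin m ⊕ Fin m) : g.1 I K = (g.1 *ᵥ Pi.single K 1) I := by
  rw [mulVec_single_one]; rfl

theorem exists_gamma_tv {t : GG 2 F} (ht : t * t = 1)
    (hr : Module.finrank F (LinearMap.range (TT t)) = 2) (hb : ∀ x, bb x (t.1 *ᵥ x) = 0) :
    ∃ w : VV 2 F, w ≠ 0 ∧ t = gamma (tv w) := by
  let b := Module.finBasisOfFinrankEq F (LinearMap.range (TT t)) hr
  let e : I4 → VV 2 F := fun I => Pi.single I 1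
  have hli := b.linearIndependent
  have h0 : ∀ i, (b i : VV 2 F) ≠ 0 := fun i h => b.ne_zero i (Subtype.ext h)
  have hspan : ∀ x, ∃ c d : F, TT t x = c • (b 0 : VV 2 F) + d • (b 1 : VV 2 F) := by
    intro x
    have := b.sum_repr ⟨TT t x, LinearMap.mem_range_self _ x⟩
    rw [Fin.sum_univ_two] at this
    exact ⟨_, _, (congrArg Subtype.val this).symm⟩
  have hiso : bb (b 0 : VV 2 F) (b 1 : VV 2 F) = 0 := by
    obtain ⟨x, hx⟩ := (b 0).2
    obtain ⟨y, hy⟩ := (b 1).2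
    rw [← hx, ← hy]; exact invol_iso ht x y
  have hnp : ∀ c : F, (b 1 : VV 2 F) ≠ c • (b 0 : VV 2 F) := by
    intro c hc
    have h2 : b 1 = c • b 0 := Subtype.ext hc
    have := Fintype.linearIndependent_iff.1 hli ![c, -1] (by rw [Fin.sum_univ_two, h2]; simp) 1
    simp at this
  have he0 : e (.inl 0) ≠ 0 := by
    intro h; have := congrFun h (.inl 0); simp [e] at this
  have hen : ∀ c : F, e (.inl 1) ≠ c • e (.inl 0) := by
    intro c h; have := congrFun h (.inl 1); simp [e] at this
  have hee : bb (e (.inl 0)) (e (.inl 1)) = 0 := by simp [e, bb_eq]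
  obtain ⟨h, hh0, hh1⟩ := exists_trans2 (h0 0) he0 hiso hee hnp hen
  let t' := h * t * h⁻¹
  have ht' : t' * t' = 1 := by
    have : t' * t' = h * (t * t) * h⁻¹ := by simp only [t']; group
    rw [this, ht]; group
  have hT : ∀ y, ∃ c d : F, TT t' y = c • e (.inl 0) + d • e (.inl 1) := by
    intro y
    obtain ⟨c, d, hcd⟩ := hspan (h⁻¹.1 *ᵥ y)
    have h3 := TT_conj h t (h⁻¹.1 *ᵥ y)
    rw [act_inv, hcd, mulVec_add, mulVec_smul, mulVec_smul, hh0, hh1] at h3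
    exact ⟨c, d, h3⟩
  have hb' : ∀ x, bb x (t'.1 *ᵥ x) = 0 := by
    intro x
    have : t'.1 *ᵥ x = h.1 *ᵥ (t.1 *ᵥ (h⁻¹.1 *ᵥ x)) := by simp only [t', mul_act]
    have h4 := bb_act h (h⁻¹.1 *ᵥ x) (t.1 *ᵥ (h⁻¹.1 *ᵥ x))
    rw [act_inv, hb] at h4
    rw [this, h4]
  have hker : ∀ i, TT t' (e (.inl i)) = 0 := by
    have hk : ∀ i, TT t' (h.1 *ᵥ (b i : VV 2 F)) = 0 := by
      intro i
      obtain ⟨x, hx⟩ := (b i).2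
      rw [TT_conj, ← hx, invol_TT ht, mulVec_zero]
    intro i
    fin_cases i
    · have := hk 0; rw [hh0] at this; exact this
    · have := hk 1; rw [hh1] at this; exact this
  have hact : ∀ y, t'.1 *ᵥ y = TT t' y + y := by
    intro y; rw [TT_apply, add_assoc, vadd_self, add_zero]
  obtain ⟨a1, b1, h1⟩ := hT (e (.inr 0))
  obtain ⟨a2, b2, h2⟩ := hT (e (.inr 1))
  have q1 := hb' (e (.inr 0))
  have q2 := hb' (e (.inr 1))
  have q3 := invol_bb ht' (e (.inr 0)) (e (.inr 1))
  rw [hact, h1] at q1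
  rw [hact, h2] at q2
  rw [hact, hact, h1, h2] at q3
  simp [bb_eq, e, Fin.sum_univ_two] at q1 q2 q3
  subst q1 q2
  rw [CharTwo.neg_eq] at q3
  subst q3
  obtain ⟨c, hc⟩ := exists_sqrt a2
  have key : t' = gamma (tv (c • e (.inl 0))) := by
    apply Subtype.ext; ext I K
    rw [entry_act, hact, gamma_coe, gm_apply, pmin]
    rw [entry_act (tv _), entry_act (tv _), entry_act (tv _), entry_act (tv _), tv_act, tv_act]
    rcases K with k | k
    · have := hker k
      simp only [e] at this
      rw [this]
      rcases I with i | i <;> fin_cases i <;> fin_cases k <;>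
        simp [pa, pb, bb_eq, e, Fin.sum_univ_two, Pi.single_apply]
    · fin_cases k
      · have := h1
        simp only [e] at this
        simp only [Fin.zero_eta]
        rw [this]
        rcases I with i | i <;> fin_cases i <;>
          simp [pa, pb, bb_eq, e, Fin.sum_univ_two, Pi.single_apply, hc]
      · have := h2
        simp only [e] at this
        simp only [Fin.mk_one]
        rw [this]
        rcases I with i | i <;> fin_cases i <;>
          simp [pa, pb, bb_eq, e, Fin.sum_univ_two, Pi.single_apply, hc]
  obtain ⟨k, hk⟩ := gamma.surjective h
  have hfin : t = gamma (tv (k⁻¹.1 *ᵥ (c • e (.inl 0)))) := by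
    rw [← conj_tv, inv_inv, map_mul, map_mul, ← key, map_inv, hk]
    simp only [t']; group
  refine ⟨_, ?_, hfin⟩
  intro hz
  rw [hz, tv_zero, map_one] at hfin
  obtain ⟨x, hx⟩ := (b 0).2
  apply h0 0
  rw [← hx, TT_apply, hfin, one_act, vadd_self]

theorem aut_cases {m : ℕ} (hm : 1 ≤ m) (σ : MulAut (GG m F)) :
    (∃ (A : GG m F) (φ : F ≃+* F), ∀ g, σ g = A * phiG φ g * A⁻¹) ∨ m = 2 := by
  rcases image_cases hm σ with h | h
  · exact Or.inl (semilinear σ h hm)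
  · exact Or.inr h.1

theorem aut_cases2 (σ : MulAut (GG 2 F)) :
    (∃ (A : GG 2 F) (φ : F ≃+* F), ∀ g, σ g = A * phiG φ g * A⁻¹) ∨
    (∃ (A : GG 2 F) (φ : F ≃+* F), ∀ g, σ g = gamma (A * phiG φ g * A⁻¹)) := by
  rcases image_cases (by norm_num) σ with h | ⟨-, h⟩
  · exact Or.inl (semilinear σ h (by norm_num))
  · right
    obtain ⟨A, φ, H⟩ := semilinear (gamma⁻¹ * σ) (fun v hv => by
      obtain ⟨h1, h2⟩ := h v hv
      obtain ⟨w, hw, h3⟩ := exists_gamma_tv (by rw [← map_mul, tv_mul_self, map_one]) h1 h2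
      refine ⟨w, hw, ?_⟩
      rw [MulAut.mul_apply, h3]
      simp) (by norm_num)
    refine ⟨A, φ, fun g => ?_⟩
    rw [← H g]
    simp
end graph2
end SpAut
end PartD2

section PartB1
open Matrix
set_option linter.unusedSectionVars false
namespace SpAut

section polys
open Polynomial
variable {k : Type} [Field k] [CharP k 2] [Fintype k]

theorem irr_facts {f : k[X]} (hf : Irreducible f) (hm : f.Monic) (h0 : f.coeff 0 ≠ 0) :
    1 ≤ f.natDegree ∧ f ∣ X ^ (Fintype.card k ^ f.natDegree - 1) - 1 ∧
    (f ∣ f.reverse → f.eval 1 ≠ 0 → ∃ d, 1 ≤ d ∧ f.natDegree = 2 * d ∧ f ∣ X ^ (Fintype.card k ^ d + 1) - 1) := by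
  haveI := Fact.mk hf
  have hfin : Module.Finite k (AdjoinRoot f) := hm.finite_adjoinRoot
  haveI : Finite (AdjoinRoot f) := Module.finite_of_finite k
  letI : Fintype (AdjoinRoot f) := Fintype.ofFinite _
  have hfr : Module.finrank k (AdjoinRoot f) = f.natDegree := by
    have := (AdjoinRoot.powerBasis hf.ne_zero).finrank
    rwa [AdjoinRoot.powerBasis_dim] at this
  have hcard : Fintype.card (AdjoinRoot f) = Fintype.card k ^ f.natDegree := by
    rw [← hfr]; exact Module.card_eq_pow_finrank
  have hdvd : ∀ g : k[X], f ∣ g ↔ aeval (AdjoinRoot.root f) g = 0 := by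
    intro g; rw [AdjoinRoot.aeval_eq, AdjoinRoot.mk_eq_zero]
  set α := AdjoinRoot.root f with hα
  have hr : aeval α f = 0 := (hdvd f).1 dvd_rfl
  have hα0 : α ≠ 0 := by
    intro h
    rw [h, aeval_def, eval₂_at_zero] at hr
    exact h0 ((map_eq_zero _).1 hr)
  have hD : 1 ≤ f.natDegree := hf.natDegree_pos
  refine ⟨hD, ?_, ?_⟩
  · rw [hdvd]
    simp only [map_sub, map_pow, aeval_X, map_one]
    rw [← hcard, FiniteField.pow_card_sub_one_eq_one α hα0, sub_self]
  · intro hrev h1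
    have hr2 : aeval α⁻¹ f = 0 := by
      letI := invertibleOfNonzero hα0
      have := (hdvd _).1 hrev
      rw [aeval_def] at this ⊢
      rw [← invOf_eq_inv]
      rw [← eval₂_reverse_eq_zero_iff]
      simpa using this
    have hmin : minpoly k α = f := (minpoly.eq_of_irreducible_of_monic hf hr hm).symm
    have hmin2 : minpoly k α⁻¹ = f := (minpoly.eq_of_irreducible_of_monic hf hr2 hm).symm
    have hconj : IsConjRoot k α⁻¹ α := hmin2.trans hmin.symm
    obtain ⟨τ, hτ⟩ := isConjRoot_iff_exists_algEquiv.1 hconj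
    obtain ⟨⟨j, hj⟩, hj2⟩ := (FiniteField.bijective_frobeniusAlgEquivOfAlgebraic_pow k (AdjoinRoot f)).2 τ
    have hfrob : ∀ (n : ℕ) (x : AdjoinRoot f), (FiniteField.frobeniusAlgEquivOfAlgebraic k (AdjoinRoot f) ^ n) x
        = x ^ (Fintype.card k ^ n) := by
      intro n x
      rw [AlgEquiv.coe_pow, FiniteField.coe_frobeniusAlgEquivOfAlgebraic_iterate]
    have hαj : α ^ (Fintype.card k ^ j) = α⁻¹ := by
      rw [← hfrob, ← hτ, ← hj2]
    rw [hfr] at hj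
    have hττ : τ * τ = 1 := by
      apply AlgEquiv.coe_toAlgHom_injective
      apply AdjoinRoot.algHom_ext
      change τ (τ α) = α
      rw [hτ, map_inv₀, hτ, inv_inv]
    have hinj := (FiniteField.bijective_frobeniusAlgEquivOfAlgebraic_pow k (AdjoinRoot f)).1
    have hord : orderOf (FiniteField.frobeniusAlgEquivOfAlgebraic k (AdjoinRoot f)) = f.natDegree := by
      rw [← hfr]; exact FiniteField.orderOf_frobeniusAlgEquivOfAlgebraic k (AdjoinRoot f)
    have hd2 : f.natDegree ∣ 2 * j := by
      rw [← hord, orderOf_dvd_iff_pow_eq_one, mul_comm, pow_mul, sq]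
      have hj3 : FiniteField.frobeniusAlgEquivOfAlgebraic k (AdjoinRoot f) ^ j = τ := hj2
      rw [hj3, hττ]
    have hj0 : j ≠ 0 := by
      rintro rfl
      have h2 : α ^ 2 = 1 := by
        rw [pow_zero, pow_one] at hαj
        rw [sq]; nth_rewrite 2 [hαj]; exact mul_inv_cancel₀ hα0
      haveI : CharP (AdjoinRoot f) 2 := charP_of_injective_algebraMap (algebraMap k (AdjoinRoot f)).injective 2
      have h3 : α = 1 := by
        have : (α - 1) ^ 2 = 0 := by rw [sub_sq, h2, CharTwo.two_eq_zero]; ring_nf; exact CharTwo.two_eq_zero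
        exact sub_eq_zero.1 (pow_eq_zero_iff (two_ne_zero) |>.1 this)
      rw [h3, aeval_def, ← map_one (algebraMap k (AdjoinRoot f)), eval₂_at_apply] at hr
      exact h1 ((map_eq_zero _).1 hr)
    obtain ⟨c, hc⟩ := hd2
    have hc1 : c = 1 := by
      have : c < 2 := by
        by_contra hcon
        have : f.natDegree * 2 ≤ f.natDegree * c := Nat.mul_le_mul_left _ (by omega)
        omega
      interval_cases c <;> omega
    refine ⟨j, by omega, by rw [hc, hc1]; omega, ?_⟩
    rw [hdvd]
    simp only [map_sub, map_pow, aeval_X, map_one]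
    rw [pow_succ, hαj, inv_mul_cancel₀ hα0, sub_self]

/-- self-reciprocal up to units -/
def SymP (p : k[X]) : Prop := p.coeff 0 ≠ 0 ∧ Associated p.reverse p

/-- cost of a multiplicity -/
def cM (M : ℕ) : ℕ := if M ≤ 1 then 0 else (M + 1) / 2

theorem cM_mono {a b : ℕ} (h : a ≤ b) : cM a ≤ cM b := by
  unfold cM; split_ifs <;> omega

/-- the number attached to a pair -/
def pv (q : ℕ) (x : ℕ × Bool) : ℕ := if x.2 then q ^ x.1 + 1 else q ^ x.1 - 1

/-- lcm of a list -/
def lcmL (q : ℕ) (l : List (ℕ × Bool)) : ℕ := (l.map (pv q)).foldr Nat.lcm 1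

theorem lcmL_nil (q : ℕ) : lcmL q [] = 1 := rfl
theorem lcmL_cons (q : ℕ) (x) (l : List (ℕ × Bool)) : lcmL q (x :: l) = Nat.lcm (pv q x) (lcmL q l) := rfl
theorem lcmL_append (q : ℕ) (l l' : List (ℕ × Bool)) : lcmL q (l ++ l') = Nat.lcm (lcmL q l) (lcmL q l') := by
  induction l with
  | nil => simp [lcmL_nil]
  | cons x l ih => rw [List.cons_append, lcmL_cons, lcmL_cons, ih, Nat.lcm_assoc]

/-- total degree of a list -/
def sumL (l : List (ℕ × Bool)) : ℕ := (l.map Prod.fst).sum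

/-- decomposition data -/
def QP (p : k[X]) : Prop := ∃ (n : ℕ) (l : List (ℕ × Bool)) (M : ℕ), 1 ≤ M ∧ p.natDegree = 2 * n ∧
  (∀ x ∈ l, 1 ≤ x.1) ∧ sumL l + cM M ≤ n ∧ p ∣ (X ^ lcmL (Fintype.card k) l - 1) ^ M

theorem QP_mul {p r : k[X]} (hp : QP p) (hr : QP r) (hc : IsCoprime p r) (hp0 : p ≠ 0) (hr0 : r ≠ 0) : QP (p * r) := by
  obtain ⟨n, l, M, hM, hn, hl, hs, hd⟩ := hp
  obtain ⟨n', l', M', hM', hn', hl', hs', hd'⟩ := hr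
  refine ⟨n + n', l ++ l', max M M', le_max_of_le_left hM, by rw [natDegree_mul hp0 hr0]; omega, ?_, ?_, ?_⟩
  · intro x hx; rcases List.mem_append.1 hx with h | h
    · exact hl x h
    · exact hl' x h
  · have : cM (max M M') ≤ cM M + cM M' := by
      rcases le_total M M' with h | h
      · rw [max_eq_right h]; omega
      · rw [max_eq_left h]; omega
    simp only [sumL, List.map_append, List.sum_append] at *
    omega
  · rw [lcmL_append]
    apply hc.mul_dvd
    · exact hd.trans ((pow_dvd_pow_of_dvd (by
        have := Nat.dvd_lcm_left (lcmL (Fintype.card k) l) (lcmL (Fintype.card k) l')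
        obtain ⟨c, hc⟩ := this
        rw [hc, pow_mul]; simpa using sub_dvd_pow_sub_pow (X ^ lcmL (Fintype.card k) l : k[X]) 1 c) M).trans
        (pow_dvd_pow _ (le_max_left _ _)))
    · exact hd'.trans ((pow_dvd_pow_of_dvd (by
        have := Nat.dvd_lcm_right (lcmL (Fintype.card k) l) (lcmL (Fintype.card k) l')
        obtain ⟨c, hc⟩ := this
        rw [hc, pow_mul]; simpa using sub_dvd_pow_sub_pow (X ^ lcmL (Fintype.card k) l' : k[X]) 1 c) M').trans
        (pow_dvd_pow _ (le_max_right _ _)))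

theorem rev_rev {p : k[X]} (h : p.coeff 0 ≠ 0) : p.reverse.reverse = p := by
  have hd : p.reverse.natDegree = p.natDegree := by
    rw [reverse_natDegree, natTrailingDegree_eq_zero.2 (Or.inr h), Nat.sub_zero]
  rw [reverse, hd, reverse, reflect_reflect]

theorem rev_deg {p : k[X]} (h : p.coeff 0 ≠ 0) : p.reverse.natDegree = p.natDegree := by
  rw [reverse_natDegree, natTrailingDegree_eq_zero.2 (Or.inr h), Nat.sub_zero]

theorem rev_dvd {p r : k[X]} (h : p ∣ r) : p.reverse ∣ r.reverse := by
  obtain ⟨c, rfl⟩ := h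
  rw [reverse_mul_of_domain]; exact dvd_mul_right _ _

theorem rev_pow (p : k[X]) (n : ℕ) : (p ^ n).reverse = p.reverse ^ n := by
  induction n with
  | zero => simpa using reverse_C (1 : k)
  | succ n ih => rw [pow_succ, reverse_mul_of_domain, ih, pow_succ]

theorem symP_ne {p : k[X]} (h : SymP p) : p ≠ 0 := by
  rintro rfl; exact h.1 (by simp)

theorem symP_right {p r : k[X]} (hp : SymP p) (h : SymP (p * r)) : SymP r := by
  have h0 := h.1
  rw [mul_coeff_zero] at h0
  refine ⟨right_ne_zero_of_mul h0, ?_⟩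
  have h2 := h.2
  rw [reverse_mul_of_domain] at h2
  have h3 : Associated (p * r.reverse) (p * r) := (hp.2.symm.mul_right _).trans h2
  exact h3.of_mul_left (Associated.refl _) (symP_ne hp)

theorem rev_Xpow (N : ℕ) (hN : 0 < N) : (X ^ N - 1 : k[X]).reverse = X ^ N - 1 := by
  have h1 : (X ^ N - 1 : k[X]) = X ^ N + C 1 := by
    rw [sub_eq_add_neg, CharTwo.neg_eq, map_one]
  rw [h1, reverse_add_C]
  have h2 : (X ^ N : k[X]).reverse = 1 := by
    have := reverse_X_pow_mul (1 : k[X]) N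
    rw [mul_one] at this
    rw [this]; simpa using reverse_C (1 : k)
  rw [h2]; simp [add_comm]

theorem rev_irr {f : k[X]} (hf : Irreducible f) (h0 : f.coeff 0 ≠ 0) : Irreducible f.reverse := by
  have hun : ∀ a : k[X], a.coeff 0 ≠ 0 → (IsUnit a.reverse → IsUnit a) := by
    intro a ha hu
    have ha0 : a ≠ 0 := by rintro rfl; simp at ha
    rw [isUnit_iff_degree_eq_zero, degree_eq_natDegree ha0, ← rev_deg ha, natDegree_eq_zero_of_isUnit hu]; rfl
  have hl : f.reverse.coeff 0 ≠ 0 := by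
    rw [coeff_zero_reverse]; exact leadingCoeff_ne_zero.2 hf.ne_zero
  constructor
  · intro h
    exact hf.not_isUnit (hun f h0 h)
  · intro a b hab
    have h1 : f = a.reverse * b.reverse := by rw [← reverse_mul_of_domain, ← hab, rev_rev h0]
    rw [hab, mul_coeff_zero] at hl
    exact (hf.isUnit_or_isUnit h1).imp (hun a (left_ne_zero_of_mul hl)) (hun b (right_ne_zero_of_mul hl))

theorem QP_of_sym : ∀ (n : ℕ) (p : k[X]), p.natDegree ≤ n → SymP p → p.eval 1 ≠ 0 → QP p := by
  intro n
  induction n with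
  | zero =>
    intro p hn hs h1
    refine ⟨0, [], 1, le_rfl, by omega, by simp, by simp [sumL, cM], ?_⟩
    have : IsUnit p := by
      rw [isUnit_iff_degree_eq_zero, degree_eq_natDegree (symP_ne hs)]; simp; omega
    exact this.dvd
  | succ n ih =>
    intro p hn hs h1
    by_cases hu : IsUnit p
    · refine ⟨0, [], 1, le_rfl, by rw [natDegree_eq_zero_of_isUnit hu], by simp, by simp [sumL, cM], hu.dvd⟩
    obtain ⟨f, hfm, hfi, hfp⟩ := exists_monic_irreducible_factor p hu
    have hp0 := symP_ne hs
    obtain ⟨μ, s, hfs, hps⟩ : ∃ μ s, ¬ f ∣ s ∧ p = f ^ μ * s := by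
      have hfinm : FiniteMultiplicity f p := FiniteMultiplicity.of_prime_left hfi.prime hp0
      obtain ⟨s, h2, h3⟩ := hfinm.exists_eq_pow_mul_and_not_dvd
      exact ⟨_, s, h3, h2⟩
    have hμ : 1 ≤ μ := by
      rcases Nat.eq_zero_or_pos μ with h | h
      · subst h; rw [pow_zero, one_mul] at hps; exact absurd (hps ▸ hfp) hfs
      · exact h
    have hf0 : f.coeff 0 ≠ 0 := by
      intro h
      apply hs.1
      obtain ⟨c, rfl⟩ := hfp
      rw [mul_coeff_zero, h, zero_mul]
    have hf1 : f.eval 1 ≠ 0 := by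
      intro h
      apply h1
      obtain ⟨c, rfl⟩ := hfp
      rw [eval_mul, h, zero_mul]
    obtain ⟨hD, hA, hB⟩ := irr_facts hfi hfm hf0
    have hs1 : s.eval 1 ≠ 0 := by
      intro h; apply h1; rw [hps, eval_mul, h, mul_zero]
    have hfμ0 : f ^ μ ≠ 0 := pow_ne_zero _ hfi.ne_zero
    have hcop : IsCoprime (f ^ μ) s := IsCoprime.pow_left ((hfi.coprime_iff_not_dvd).2 hfs)
    have hs0 : s ≠ 0 := by rintro rfl; exact hp0 (by rw [hps, mul_zero])
    have hdeg : p.natDegree = μ * f.natDegree + s.natDegree := by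
      rw [hps, natDegree_mul hfμ0 hs0, natDegree_pow]
    have hμD : 1 ≤ μ * f.natDegree := Nat.mul_pos hμ hD
    by_cases hrev : f ∣ f.reverse
    · obtain ⟨d, hd1, hd2, hd3⟩ := hB hrev hf1
      have hsymf : SymP (f ^ μ) := by
        refine ⟨by rw [coeff_zero_eq_eval_zero, eval_pow, ← coeff_zero_eq_eval_zero]; exact pow_ne_zero _ hf0, ?_⟩
        rw [rev_pow]
        apply Associated.pow_pow
        refine (associated_of_dvd_of_natDegree_le hrev (by rw [Ne, reverse_eq_zero]; exact hfi.ne_zero) (rev_deg hf0).le).symm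
      have hsyms : SymP s := symP_right hsymf (hps ▸ hs)
      rw [hps]
      refine QP_mul ⟨d * μ, [(d, true)], μ, hμ, by rw [natDegree_pow, hd2]; ring, by simpa using hd1, ?_, ?_⟩
        (ih s (by omega) hsyms hs1) hcop hfμ0 hs0
      · simp only [sumL, cM, List.map_cons, List.map_nil, List.sum_cons, List.sum_nil]
        split_ifs with h
        · nlinarith
        · have : d * μ = d * (μ - 1) + d := by
            obtain ⟨μ, rfl⟩ : ∃ x, μ = x + 1 := ⟨μ - 1, by omega⟩
            simp; ring
          have : 1 * (μ - 1) ≤ d * (μ - 1) := Nat.mul_le_mul_right _ hd1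
          omega
      · apply pow_dvd_pow_of_dvd
        simpa [lcmL_cons, lcmL_nil, pv] using hd3
    · have hri := rev_irr hfi hf0
      have hcff : IsCoprime f f.reverse := (hfi.coprime_iff_not_dvd).2 hrev
      have hdv : f.reverse ^ μ ∣ s := by
        have h2 : f.reverse ^ μ ∣ p := by
          rw [← hs.2.dvd_iff_dvd_right, ← rev_pow]
          exact rev_dvd (hps ▸ dvd_mul_right _ _)
        rw [hps] at h2
        exact (hcff.symm.pow (m := μ) (n := μ)).dvd_of_dvd_mul_left h2
      obtain ⟨r, hr⟩ := hdv
      have hpr : p = (f * f.reverse) ^ μ * r := by rw [hps, hr, mul_pow]; ring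
      have hl : f.reverse.coeff 0 ≠ 0 := by
        rw [coeff_zero_reverse]; exact leadingCoeff_ne_zero.2 hfi.ne_zero
      have hsymf : SymP ((f * f.reverse) ^ μ) := by
        refine ⟨by rw [coeff_zero_eq_eval_zero, eval_pow, ← coeff_zero_eq_eval_zero, mul_coeff_zero];
                   exact pow_ne_zero _ (mul_ne_zero hf0 hl), ?_⟩
        rw [rev_pow, reverse_mul_of_domain, rev_rev hf0, mul_comm]
      have hsymr : SymP r := symP_right hsymf (hpr ▸ hs)
      have hr1 : r.eval 1 ≠ 0 := by
        intro h; apply hs1; rw [hr, eval_mul, h, mul_zero]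
      have hfr : ¬ f ∣ r := fun h => hfs (hr ▸ h.mul_left _)
      have hfr2 : ¬ f.reverse ∣ r := by
        intro h
        have := rev_dvd h
        rw [rev_rev hf0, hsymr.2.dvd_iff_dvd_right] at this
        exact hfr this
      have hcop2 : IsCoprime ((f * f.reverse) ^ μ) r :=
        IsCoprime.pow_left (IsCoprime.mul_left ((hfi.coprime_iff_not_dvd).2 hfr) ((hri.coprime_iff_not_dvd).2 hfr2))
      have hff0 : (f * f.reverse) ^ μ ≠ 0 := symP_ne hsymf
      have hdff : ((f * f.reverse) ^ μ).natDegree = 2 * (f.natDegree * μ) := by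
        rw [natDegree_pow, natDegree_mul hfi.ne_zero hri.ne_zero, rev_deg hf0]; ring
      have hdr : p.natDegree = 2 * (f.natDegree * μ) + r.natDegree := by
        rw [hpr, natDegree_mul hff0 (symP_ne hsymr), hdff]
      rw [hpr]
      refine QP_mul ⟨f.natDegree * μ, [(f.natDegree, false)], μ, hμ, hdff, by simpa using hD, ?_, ?_⟩
        (ih r (by rw [mul_comm] at hμD; omega) hsymr hr1) hcop2 hff0 (symP_ne hsymr)
      · simp only [sumL, cM, List.map_cons, List.map_nil, List.sum_cons, List.sum_nil]
        split_ifs with h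
        · nlinarith
        · have : f.natDegree * μ = f.natDegree * (μ - 1) + f.natDegree := by
            obtain ⟨μ, rfl⟩ : ∃ x, μ = x + 1 := ⟨μ - 1, by omega⟩
            simp; ring
          have : 1 * (μ - 1) ≤ f.natDegree * (μ - 1) := Nat.mul_le_mul_right _ hD
          omega
      · apply pow_dvd_pow_of_dvd
        have hN : 0 < Fintype.card k ^ f.natDegree - 1 := by
          have := Nat.one_lt_pow (n := f.natDegree) (by omega) (Fintype.one_lt_card (α := k))
          omega
        have : f * f.reverse ∣ X ^ (Fintype.card k ^ f.natDegree - 1) - 1 := by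
          apply hcff.mul_dvd hA
          rw [← rev_Xpow _ hN]
          exact rev_dvd hA
        simpa [lcmL_cons, lcmL_nil, pv] using this

theorem QP_of_sym' (p : k[X]) (hs : SymP p) (m : ℕ) (hd : p.natDegree = 2 * m) : QP p := by
  have hp0 := symP_ne hs
  have hX : (X - C (1 : k)).natDegree = 1 := natDegree_X_sub_C 1
  have hirr : Irreducible (X - C (1 : k)) := irreducible_X_sub_C 1
  obtain ⟨μ, s, hfs, hps⟩ : ∃ μ s, ¬ (X - C (1 : k)) ∣ s ∧ p = (X - C (1 : k)) ^ μ * s := by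
    have hfinm : FiniteMultiplicity (X - C (1 : k)) p := FiniteMultiplicity.of_prime_left hirr.prime hp0
    obtain ⟨s, h2, h3⟩ := hfinm.exists_eq_pow_mul_and_not_dvd
    exact ⟨_, s, h3, h2⟩
  have hsymX : SymP ((X - C (1 : k)) ^ μ) := by
    refine ⟨by rw [coeff_zero_eq_eval_zero, eval_pow]; simp, ?_⟩
    have := rev_Xpow (k := k) 1 one_pos
    rw [rev_pow, map_one]
    rw [pow_one] at this
    rw [this]
  have hsyms := symP_right hsymX (hps ▸ hs)
  have hQ := QP_of_sym _ s le_rfl hsyms (fun h => hfs (dvd_iff_isRoot.2 h))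
  have hdd : p.natDegree = μ + s.natDegree := by
    rw [hps, natDegree_mul (symP_ne hsymX) (symP_ne hsyms), natDegree_pow, hX, mul_one]
  have hQ2 := hQ
  obtain ⟨n, -, -, -, hn, -⟩ := hQ2
  obtain ⟨j, hj⟩ : ∃ j, μ = 2 * j := ⟨m - n, by omega⟩
  rcases Nat.eq_zero_or_pos j with h | h
  · subst h; rw [hj, mul_zero, pow_zero, one_mul] at hps; rwa [hps]
  rw [hps]
  refine QP_mul ⟨j, [], μ, by omega, by rw [natDegree_pow, hX]; omega, by simp, ?_, ?_⟩ hQ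
    (IsCoprime.pow_left ((hirr.coprime_iff_not_dvd).2 hfs)) (symP_ne hsymX) (symP_ne hsyms)
  · simp only [sumL, cM, List.map_nil, List.sum_nil]
    split_ifs <;> omega
  · simp [lcmL_nil]

/-- cost of the 2-part of the order -/
def uc (a : ℕ) : ℕ := if a = 0 then 0 else if a = 1 then 1 else 2 ^ (a - 2) + 1

theorem sym_exponent (p : k[X]) (hs : SymP p) (m : ℕ) (hd : p.natDegree = 2 * m) :
    ∃ (l : List (ℕ × Bool)) (a : ℕ), (∀ x ∈ l, 1 ≤ x.1) ∧ sumL l + uc a ≤ m ∧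
      p ∣ X ^ (lcmL (Fintype.card k) l * 2 ^ a) - 1 := by
  obtain ⟨n, l, M, hM, hn, hl, hsum, hdv⟩ := QP_of_sym' p hs m hd
  have hnm : n = m := by omega
  subst hnm
  refine ⟨l, Nat.clog 2 M, hl, ?_, ?_⟩
  · have : uc (Nat.clog 2 M) ≤ cM M := by
      rcases Nat.lt_or_ge M 2 with h | h
      · have : M = 1 := by omega
        subst this; simp [uc]
      · have h1 := Nat.pow_pred_clog_lt_self (b := 2) one_lt_two (x := M) (by omega)
        have h3 : Nat.clog 2 M ≠ 0 := by
          have := Nat.clog_pos one_lt_two h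
          omega
        unfold uc cM
        rw [if_neg h3, if_neg (show ¬ M ≤ 1 by omega)]
        split_ifs with h4
        · omega
        · obtain ⟨b, hb⟩ : ∃ b, Nat.clog 2 M = b + 2 := ⟨Nat.clog 2 M - 2, by omega⟩
          rw [hb] at h1 ⊢
          simp [pow_succ] at h1 ⊢
          omega
    omega
  · refine hdv.trans ((pow_dvd_pow _ (Nat.le_pow_clog one_lt_two M)).trans (dvd_of_eq ?_))
    rw [sub_pow_char_pow, one_pow, pow_mul]

end polys
end SpAut
end PartB1

section PartB2
open Matrix
set_option linter.unusedSectionVars false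
namespace SpAut

section orders
open Polynomial
variable {m : ℕ} {F : Type} [Field F] [CharP F 2] [Fintype F]

theorem phiG_mul (φ ψ : RingAut F) (g : GG m F) : phiG (φ * ψ) g = phiG φ (phiG ψ g) := by
  apply Subtype.ext; ext I K; simp only [phiG_coe, Matrix.map_apply]; rfl

theorem phiG_one (g : GG m F) : phiG (1 : RingAut F) g = g := by
  apply Subtype.ext; ext I K; simp only [phiG_coe, Matrix.map_apply]; rfl

theorem semi_pow (σ : MulAut (GG m F)) (A : GG m F) (φ : RingAut F) (H : ∀ g, σ g = A * phiG φ g * A⁻¹) (n : ℕ) :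
    ∃ h : GG m F, ∀ g, (σ ^ n) g = h * phiG (φ ^ n) g * h⁻¹ := by
  induction n with
  | zero => exact ⟨1, fun g => by simp [phiG_one]⟩
  | succ n ih =>
    obtain ⟨h, hh⟩ := ih
    refine ⟨h * phiG (φ ^ n) A, fun g => ?_⟩
    rw [pow_succ, MulAut.mul_apply, H, hh, pow_succ, phiG_mul, map_mul, map_mul, map_inv]
    group

theorem semi_conj (σ : MulAut (GG m F)) (A : GG m F) (φ : RingAut F) (H : ∀ g, σ g = A * phiG φ g * A⁻¹) :
    ∃ h : GG m F, σ ^ orderOf φ = MulAut.conj h := by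
  obtain ⟨h, hh⟩ := semi_pow σ A φ H (orderOf φ)
  refine ⟨h, MulEquiv.ext fun g => ?_⟩
  rw [hh, pow_orderOf_eq_one, phiG_one, MulAut.conj_apply]

theorem conj_fix {τ : MulAut (GG m F)} {h : GG m F} (hc : Commute τ (MulAut.conj h)) : τ h = h := by
  apply conj_injective
  ext1 g
  have h1 := congrArg (fun f : MulAut (GG m F) => f (τ⁻¹ g)) hc.eq
  simp only [MulAut.mul_apply, MulAut.conj_apply, map_mul, map_inv, MulAut.apply_inv_self] at h1
  simpa [MulAut.conj_apply] using h1

theorem charpoly_phi (φ : F ≃+* F) (h : GG m F) : (phiG φ h).1.charpoly = h.1.charpoly.map (φ : F →+* F) := by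
  rw [phiG_coe, ← charpoly_map]; rfl

theorem charpoly_conj (A h : GG m F) : (A * h * A⁻¹).1.charpoly = h.1.charpoly := by
  have h1 : (A * h * A⁻¹).1 = A.1 * (h.1 * (A⁻¹).1) := by rw [← mul_assoc]; rfl
  have h2 : h.1 * (A⁻¹).1 * A.1 = h.1 := by
    have : h * A⁻¹ * A = h := by group
    exact congrArg Subtype.val this
  rw [h1, charpoly_mul_comm, h2]

theorem charpoly_fix {σ : MulAut (GG m F)} {A : GG m F} {φ : F ≃+* F} (H : ∀ g, σ g = A * phiG φ g * A⁻¹)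
    {h : GG m F} (hh : σ h = h) : h.1.charpoly.map (φ : F →+* F) = h.1.charpoly := by
  rw [← charpoly_phi, ← charpoly_conj A, ← H, hh]

theorem charpoly_sym (h : GG m F) : h.1.charpoly.coeff 0 = 1 ∧ h.1.charpoly.reverse = h.1.charpoly := by
  have hdet : h.1.det = 1 := SymplecticGroup.det_eq_one h.2
  have hu : IsUnit h.1 := by rw [isUnit_iff_isUnit_det, hdet]; exact isUnit_one
  constructor
  · have := det_eq_sign_charpoly_coeff h.1
    rw [hdet] at this
    rw [CharTwo.neg_eq, one_pow, one_mul] at this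
    exact this.symm
  · rw [reverse_charpoly]
    have h1 := charpoly_inv h.1 hu
    rw [hdet, Ring.inverse_one, map_one, mul_one, CharTwo.neg_eq, one_pow, one_mul] at h1
    rw [← h1]
    have h2 : h.1⁻¹ = (h⁻¹).1 := by
      apply inv_eq_right_inv
      have : h * h⁻¹ = 1 := by group
      exact congrArg Subtype.val this
    have h3 := SymplecticGroup.coe_inv' h
    have hneg : ∀ M : Matrix (Fin m ⊕ Fin m) (Fin m ⊕ Fin m) F, -M = M := by
      intro M; ext i j; rw [Matrix.neg_apply, CharTwo.neg_eq]
    have hJ : J (Fin m) F * J (Fin m) F = 1 := by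
      rw [J_squared, hneg]
    rw [← h3]
    rw [SymplecticGroup.coe_inv]
    rw [hneg, charpoly_mul_comm, ← Matrix.mul_assoc, hJ, Matrix.one_mul, charpoly_transpose]

theorem field_bound (ψ : RingAut F) (h : GG m F) (hh : h.1.charpoly.map (ψ : F →+* F) = h.1.charpoly) :
    ∃ (q0 : ℕ) (l : List (ℕ × Bool)) (a : ℕ), q0 ^ orderOf ψ = Fintype.card F ∧ (∀ x ∈ l, 1 ≤ x.1) ∧
      sumL l + uc a ≤ m ∧ h ^ (lcmL q0 l * 2 ^ a) = 1 := by
  classical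
  letI : Finite (RingAut F) := Finite.of_injective (fun φ : RingAut F => (φ : F → F)) DFunLike.coe_injective
  letI : Fintype (RingAut F) := Fintype.ofFinite _
  let G := Subgroup.zpowers ψ
  letI : Fintype G := Fintype.ofFinite _
  let k := FixedPoints.subfield G F
  have hfr : Module.finrank k F = orderOf ψ := by
    have := FixedPoints.finrank_eq_card G F
    rw [this]; rw [← Nat.card_eq_fintype_card]; exact Nat.card_zpowers ψ
  haveI : CharP k 2 := inferInstance
  letI : Fintype k := Fintype.ofFinite k
  have hcard : Fintype.card k ^ orderOf ψ = Fintype.card F := by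
    rw [← hfr]; exact Module.card_eq_pow_finrank.symm
  have hfixc : ∀ n, ψ (h.1.charpoly.coeff n) = h.1.charpoly.coeff n := by
    intro n
    have := congrArg (fun p => p.coeff n) hh
    simpa using this
  have hk : ∀ x : F, ψ x = x → x ∈ k := by
    intro x hx
    rintro ⟨τ, n, rfl⟩
    change (ψ ^ n) x = x
    have hs : ψ ∈ MulAction.stabilizer (RingAut F) x := hx
    exact (MulAction.stabilizer (RingAut F) x).zpow_mem hs n
  have hl : h.1.charpoly ∈ lifts (algebraMap k F) := by
    rw [lifts_iff_coeff_lifts]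
    intro n
    exact ⟨⟨_, hk _ (hfixc n)⟩, rfl⟩
  obtain ⟨p, hp⟩ := hl
  have hp' : p.map (algebraMap k F) = h.1.charpoly := hp
  obtain ⟨s1, s2⟩ := charpoly_sym h
  have hinj : Function.Injective (algebraMap k F) := (algebraMap k F).injective
  have hdeg : p.natDegree = 2 * m := by
    rw [← natDegree_map_eq_of_injective hinj, hp', charpoly_natDegree_eq_dim]
    simp; ring
  have hsym : SymP p := by
    constructor
    · intro h0
      rw [← hp', coeff_map, h0, map_zero] at s1
      exact zero_ne_one s1
    · have : p.reverse = p := by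
        apply Polynomial.map_injective _ hinj
        ext n
        rw [coeff_map, coeff_reverse, hp', ← s2, coeff_reverse, ← hp', coeff_map, natDegree_map_eq_of_injective hinj]
      rw [this]
  obtain ⟨l, a, h1, h2, h3⟩ := sym_exponent p hsym m hdeg
  refine ⟨Fintype.card k, l, a, hcard, h1, h2, ?_⟩
  have h4 : h.1.charpoly ∣ X ^ (lcmL (Fintype.card k) l * 2 ^ a) - 1 := by
    rw [← hp']
    have := Polynomial.map_dvd (algebraMap k F) h3
    simpa using this
  obtain ⟨c, hc⟩ := h4
  have h5 := congrArg (aeval h.1) hc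
  rw [map_mul, aeval_self_charpoly, zero_mul] at h5
  simp only [map_sub, map_pow, aeval_X, map_one] at h5
  apply Subtype.ext
  have : ∀ n, (h ^ n).1 = h.1 ^ n := fun n => rfl
  rw [this]
  exact sub_eq_zero.1 h5

theorem semi_bound (σ : MulAut (GG m F)) (A : GG m F) (φ : RingAut F) (H : ∀ g, σ g = A * phiG φ g * A⁻¹) :
    ∃ (q0 : ℕ) (l : List (ℕ × Bool)) (a : ℕ), q0 ^ orderOf φ = Fintype.card F ∧ (∀ x ∈ l, 1 ≤ x.1) ∧
      sumL l + uc a ≤ m ∧ orderOf σ ∣ orderOf φ * (lcmL q0 l * 2 ^ a) := by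
  obtain ⟨h, hh⟩ := semi_conj σ A φ H
  have hf : σ h = h := conj_fix (hh ▸ Commute.self_pow σ _)
  obtain ⟨q0, l, a, h1, h2, h3, h4⟩ := field_bound φ h (charpoly_fix H hf)
  refine ⟨q0, l, a, h1, h2, h3, ?_⟩
  rw [orderOf_dvd_iff_pow_eq_one, pow_mul, hh, ← map_pow, h4, map_one]

end orders
end SpAut
end PartB2

section PartC1
open Matrix
set_option linter.unusedSectionVars false
namespace SpAut

section comb

/-- product over binary digits, bounded -/
def PPn (q n t : ℕ) : ℕ := ∏ i ∈ Finset.range n, if t.testBit i then q ^ 2 ^ i + 1 else 1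
/-- product over binary digits -/
def PP (q t : ℕ) : ℕ := PPn q (t + 1) t

theorem PPn_eq (q t : ℕ) : ∀ n k, t < 2 ^ n → PPn q (n + k) t = PPn q n t := by
  intro n k h
  induction k with
  | zero => rfl
  | succ k ih =>
    rw [← ih, ← add_assoc, PPn, Finset.prod_range_succ, if_neg]
    · simp [PPn]
    · rw [Nat.testBit_lt_two_pow]
      · simp
      · exact h.trans_le (Nat.pow_le_pow_right (by norm_num) (by omega))

theorem PP_eq (q t n : ℕ) (h : t < 2 ^ n) : PP q t = PPn q n t := by
  have h1 : t < 2 ^ (t + 1) := (Nat.lt_two_pow_self).trans (Nat.pow_lt_pow_right (by norm_num) (by omega))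
  rcases le_total n (t + 1) with h2 | h2
  · obtain ⟨k, hk⟩ := Nat.exists_eq_add_of_le h2
    rw [PP, hk, PPn_eq _ _ _ _ h]
  · obtain ⟨k, hk⟩ := Nat.exists_eq_add_of_le h2
    rw [hk, PPn_eq _ _ _ _ h1, PP]

theorem PPn_succ (q n t : ℕ) : PPn q (n + 1) t = (if t % 2 = 1 then q + 1 else 1) * PPn (q ^ 2) n (t / 2) := by
  rw [PPn, Finset.prod_range_succ', mul_comm, PPn]
  congr 1
  · simp [Nat.testBit_zero]
  · apply Finset.prod_congr rfl
    intro i _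
    rw [Nat.testBit_succ, ← pow_mul, pow_succ, mul_comm (2 ^ i)]

theorem PP_zero (q : ℕ) : PP q 0 = 1 := by simp [PP, PPn]

theorem PP_even (q s : ℕ) : PP q (2 * s) = PP (q ^ 2) s := by
  have h : s < 2 ^ s := Nat.lt_two_pow_self
  rw [PP_eq q (2 * s) (s + 1) (by rw [pow_succ]; omega), PP_eq _ s s h, PPn_succ]
  simp

theorem PP_odd (q s : ℕ) : PP q (2 * s + 1) = (q + 1) * PP (q ^ 2) s := by
  have h : s < 2 ^ s := Nat.lt_two_pow_self
  rw [PP_eq q (2 * s + 1) (s + 1) (by rw [pow_succ]; omega), PP_eq _ s s h, PPn_succ]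
  rw [if_pos (by omega), show (2 * s + 1) / 2 = s by omega]

theorem PP_ge (q t : ℕ) (hq : 1 ≤ q) : q ^ t ≤ PP q t := by
  induction t using Nat.strong_induction_on generalizing q with
  | _ t ih =>
    rcases Nat.eq_zero_or_pos t with h | h
    · subst h; simp [PP_zero]
    obtain ⟨s, hs⟩ := Nat.even_or_odd' t
    have h1 := ih s (by omega) (q ^ 2) (Nat.one_le_pow _ _ hq)
    rw [← pow_mul] at h1
    rcases hs with rfl | rfl
    · rwa [PP_even]
    · rw [PP_odd, pow_succ, mul_comm]
      exact Nat.mul_le_mul (by omega) h1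

theorem PP_lt (q t : ℕ) (hq : 2 ≤ q) : PP q t * (q - 1) + 1 ≤ q ^ (t + 1) := by
  induction t using Nat.strong_induction_on generalizing q with
  | _ t ih =>
    rcases Nat.eq_zero_or_pos t with h | h
    · subst h; simp [PP_zero]; omega
    obtain ⟨s, hs⟩ := Nat.even_or_odd' t
    have h1 := ih s (by omega) (q ^ 2) (by nlinarith)
    obtain ⟨r, rfl⟩ : ∃ r, q = r + 1 := ⟨q - 1, by omega⟩
    have h2 : (r + 1) ^ 2 - 1 = r * (r + 2) := by
      have : (r + 1) ^ 2 = r * (r + 2) + 1 := by ring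
      omega
    rw [h2, ← pow_mul] at h1
    simp only [Nat.add_sub_cancel]
    rcases hs with rfl | rfl
    · rw [PP_even]
      generalize PP ((r + 1) ^ 2) s = P at *
      have h3 : (r + 1) ^ (2 * (s + 1)) = (r + 1) ^ (2 * s + 1) * (r + 1) := by ring
      have h4 : r + 1 ≤ (r + 1) ^ (2 * s + 1) := Nat.le_self_pow (by omega) _
      generalize (r + 1) ^ (2 * s + 1) = Y at *
      rw [h3] at h1
      nlinarith
    · rw [PP_odd]
      have h3 : (r + 1) ^ (2 * (s + 1)) = (r + 1) ^ (2 * s + 1 + 1) := by ring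
      rw [← h3]
      refine le_trans (le_of_eq ?_) h1
      ring

theorem PP_jk (q j k : ℕ) (hq : 1 ≤ q) :
    PP q (2 ^ j - 1 + 2 ^ (j + 1) * k) * (q - 1) = (q ^ 2 ^ j - 1) * PP (q ^ 2 ^ (j + 1)) k := by
  induction j generalizing q with
  | zero => simp [PP_even]; ring
  | succ j ih =>
    have h1 : 1 ≤ 2 ^ j := Nat.one_le_two_pow
    have h2 : 2 ^ (j + 1) - 1 + 2 ^ (j + 1 + 1) * k = 2 * (2 ^ j - 1 + 2 ^ (j + 1) * k) + 1 := by
      have : 2 ^ (j + 1 + 1) * k = 2 * (2 ^ (j + 1) * k) := by ring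
      rw [this]; generalize 2 ^ (j + 1) * k = z
      rw [pow_succ]; omega
    rw [h2, PP_odd]
    have h3 := ih (q ^ 2) (Nat.one_le_pow _ _ hq)
    rw [← pow_mul, ← pow_mul, ← pow_succ', ← pow_succ'] at h3
    rw [← h3]
    obtain ⟨r, rfl⟩ : ∃ r, q = r + 1 := ⟨q - 1, by omega⟩
    have h4 : (r + 1) ^ 2 - 1 = r * (r + 2) := by
      have : (r + 1) ^ 2 = r * (r + 2) + 1 := by ring
      omega
    rw [h4]; simp; ring

theorem PP_step (q t c : ℕ) (hq : 2 ≤ q) (hc : 1 ≤ c) :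
    (q ^ (2 * c + 1) + 1) * PP (q ^ 2) t ≤ (q + 1) * PP (q ^ 2) (t + c) := by
  have h1 := PP_lt (q ^ 2) t (by nlinarith)
  have h2 := PP_ge (q ^ 2) (t + c) (by nlinarith)
  have h3 : q ^ 2 ≤ (q ^ 2) ^ c := Nat.le_self_pow (by omega) _
  rw [pow_add] at h2
  rw [pow_succ (q ^ 2) t] at h1
  rw [pow_succ q (2 * c), pow_mul q 2 c]
  have ht : 0 < (q ^ 2) ^ t := by positivity
  generalize (q ^ 2) ^ t = T at *
  generalize (q ^ 2) ^ c = Y at *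
  generalize PP (q ^ 2) t = P at *
  generalize PP (q ^ 2) (t + c) = P' at *
  obtain ⟨r, rfl⟩ : ∃ r, q = r + 2 := ⟨q - 2, by omega⟩
  have h4 : (r + 2) ^ 2 - 1 = (r + 1) * (r + 3) := by
    have : (r + 2) ^ 2 = (r + 1) * (r + 3) + 1 := by ring
    omega
  rw [h4] at h1
  have h5 : (Y * (r + 2) + 1) * (r + 2) ^ 2 ≤ (r + 2 + 1) * Y * ((r + 1) * (r + 3)) := by
    have : (r + 2 + 1) * Y * ((r + 1) * (r + 3)) = Y * (r + 2) * (r + 2) ^ 2 + Y * (r ^ 2 + 3 * r + 1) := by ring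
    rw [this, add_mul, one_mul]
    have : Y * 1 ≤ Y * (r ^ 2 + 3 * r + 1) := Nat.mul_le_mul_left _ (by omega)
    omega
  have h6 : (Y * (r + 2) + 1) * (P * ((r + 1) * (r + 3))) ≤ (r + 2 + 1) * (T * Y) * ((r + 1) * (r + 3)) := by
    calc _ ≤ (Y * (r + 2) + 1) * (T * (r + 2) ^ 2) := Nat.mul_le_mul_left _ (by omega)
      _ = T * ((Y * (r + 2) + 1) * (r + 2) ^ 2) := by ring
      _ ≤ T * ((r + 2 + 1) * Y * ((r + 1) * (r + 3))) := Nat.mul_le_mul_left _ h5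
      _ = _ := by ring
  have h7 : 0 < (r + 1) * (r + 3) := by positivity
  have h8 : (Y * (r + 2) + 1) * P ≤ (r + 2 + 1) * (T * Y) := by
    apply Nat.le_of_mul_le_mul_right _ h7
    rw [mul_assoc]; exact h6
  exact h8.trans (Nat.mul_le_mul_left _ h2)

theorem PP_max (n : ℕ) : ∀ (q : ℕ) (D : ℕ → ℕ), 2 ≤ q → (∀ i, D i = 0 ∨ Odd (D i)) →
    ∏ i ∈ Finset.range n, (if D i = 0 then 1 else q ^ (2 ^ i * D i) + 1) ≤ PP q (∑ i ∈ Finset.range n, 2 ^ i * D i) := by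
  induction n with
  | zero => intro q D _ _; simp [PP_zero]
  | succ n ih =>
    intro q D hq hD
    rw [Finset.prod_range_succ', Finset.sum_range_succ']
    have h1 := ih (q ^ 2) (fun i => D (i + 1)) (by nlinarith) (fun i => hD _)
    have e1 : ∏ i ∈ Finset.range n, (if D (i + 1) = 0 then 1 else q ^ (2 ^ (i + 1) * D (i + 1)) + 1)
      = ∏ i ∈ Finset.range n, (if D (i + 1) = 0 then 1 else (q ^ 2) ^ (2 ^ i * D (i + 1)) + 1) := by
      apply Finset.prod_congr rfl
      intro i _
      rw [← pow_mul, show 2 ^ (i+1) * D (i+1) = 2 * (2 ^ i * D (i+1)) by ring]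
    have e2 : ∑ i ∈ Finset.range n, 2 ^ (i + 1) * D (i + 1) = 2 * ∑ i ∈ Finset.range n, 2 ^ i * D (i + 1) := by
      rw [Finset.mul_sum]; apply Finset.sum_congr rfl; intro i _; ring
    rw [e1, e2]
    generalize ∑ i ∈ Finset.range n, 2 ^ i * D (i + 1) = t at *
    simp only [pow_zero, one_mul]
    rcases hD 0 with h0 | ⟨c, hc⟩
    · rw [h0, if_pos rfl, mul_one, add_zero, PP_even]; exact h1
    · rw [if_neg (by omega), hc]
      rw [show 2 * t + (2 * c + 1) = 2 * (t + c) + 1 by ring, PP_odd, mul_comm]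
      refine (Nat.mul_le_mul_left _ h1).trans ?_
      rcases Nat.eq_zero_or_pos c with h | h
      · subst h; simp
      · exact PP_step q t c hq h

end comb
end SpAut
end PartC1

section PartC2
open Matrix
set_option linter.unusedSectionVars false
namespace SpAut

/-- lcm of the numbers `q ^ a - 1` -/
def lcmA (q : ℕ) (A : List ℕ) : ℕ := (A.map (fun a => q ^ a - 1)).foldr Nat.lcm 1

theorem lcmA_nil (q : ℕ) : lcmA q [] = 1 := rfl
theorem lcmA_cons (q a : ℕ) (A : List ℕ) : lcmA q (a :: A) = Nat.lcm (q ^ a - 1) (lcmA q A) := rfl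

/-- bookkeeping predicate for bounding lcms -/
def StP (q n N s : ℕ) : Prop := ∃ (D Λ : ℕ → ℕ) (A : List ℕ),
  (∀ i, (D i = 0 ∧ Λ i = 1) ∨ (Odd (D i) ∧ Λ i ≤ q ^ (2 ^ i * D i) + 1 ∧ (q ^ 2 ^ i + 1) ∣ Λ i ∧ 0 < Λ i)) ∧
  (∀ a ∈ A, Odd a) ∧ N ∣ (∏ i ∈ Finset.range n, Λ i) * lcmA q A ∧
  ∑ i ∈ Finset.range n, 2 ^ i * D i + A.sum ≤ s

theorem StP_dvd {q n N N' s : ℕ} (h : StP q n N s) (h' : N' ∣ N) : StP q n N' s := by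
  obtain ⟨D, Λ, A, h1, h2, h3, h4⟩ := h
  exact ⟨D, Λ, A, h1, h2, h'.trans h3, h4⟩

theorem StP_plus {q n N s d : ℕ} (hq : 2 ≤ q) (h : StP q n N s) (hd : 1 ≤ d) (hdn : d < 2 ^ n) :
    StP q n (Nat.lcm (q ^ d + 1) N) (s + d) := by
  obtain ⟨D, Λ, A, h1, h2, h3, h4⟩ := h
  obtain ⟨i, o, ho, rfl⟩ := Nat.exists_eq_two_pow_mul_odd (show d ≠ 0 by omega)
  have ho1 : 1 ≤ o := ho.pos
  have hin : i < n := by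
    by_contra hc
    have : 2 ^ n ≤ 2 ^ i := Nat.pow_le_pow_right (by norm_num) (by omega)
    nlinarith
  have him : i ∈ Finset.range n := Finset.mem_range.2 hin
  set G := q ^ 2 ^ i with hG
  have hG2 : 2 ≤ G := hq.trans (Nat.le_self_pow (by positivity) _)
  have hx : G + 1 ∣ q ^ (2 ^ i * o) + 1 := by
    rw [pow_mul, ← hG]
    simpa using Odd.nat_add_dvd_pow_add_pow G 1 ho
  have key : ∃ D' Λ', (Odd D' ∧ Λ' ≤ q ^ (2 ^ i * D') + 1 ∧ (q ^ 2 ^ i + 1) ∣ Λ' ∧ 0 < Λ') ∧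
      q ^ (2 ^ i * o) + 1 ∣ Λ' ∧ Λ i ∣ Λ' ∧ D' ≤ D i + o := by
    rcases h1 i with ⟨hD, hL⟩ | ⟨hD, hL, hdv, hpos⟩
    · exact ⟨o, q ^ (2 ^ i * o) + 1, ⟨ho, le_rfl, hx, by positivity⟩, dvd_rfl, by simp [hL], by omega⟩
    · obtain ⟨u, hu⟩ := hD
      obtain ⟨v, hv⟩ := ho
      refine ⟨D i + o - 1, Nat.lcm (Λ i) (q ^ (2 ^ i * o) + 1), ⟨⟨u + v, by omega⟩, ?_, hdv.trans (Nat.dvd_lcm_left _ _), Nat.lcm_pos hpos (by positivity)⟩, Nat.dvd_lcm_right _ _, Nat.dvd_lcm_left _ _, by omega⟩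
      have e1 := Nat.gcd_mul_lcm (Λ i) (q ^ (2 ^ i * o) + 1)
      have e2 : G + 1 ≤ Nat.gcd (Λ i) (q ^ (2 ^ i * o) + 1) :=
        Nat.le_of_dvd (Nat.gcd_pos_of_pos_left _ hpos) (Nat.dvd_gcd hdv hx)
      generalize Nat.lcm (Λ i) (q ^ (2 ^ i * o) + 1) = M at *
      rw [pow_mul, ← hG] at hL e1 e2 ⊢
      rw [show D i = 2 * u + 1 from hu] at hL ⊢
      rw [hv] at e1 e2 ⊢
      rw [show 2 * u + 1 + (2 * v + 1) - 1 = 2 * u + (2 * v + 1) by omega]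
      have e3 : (G + 1) * M ≤ (G + 1) * (G ^ (2 * u + (2 * v + 1)) + 1) := by
        calc (G + 1) * M ≤ _ := Nat.mul_le_mul_right _ e2
          _ = _ := e1
          _ ≤ (G ^ (2 * u + 1) + 1) * (G ^ (2 * v + 1) + 1) := by
              exact Nat.mul_le_mul_right _ hL
          _ ≤ _ := by
            have a1 : 1 ≤ G ^ (2 * u) := Nat.one_le_pow _ _ (by omega)
            have a2 : 1 ≤ G ^ (2 * v) := Nat.one_le_pow _ _ (by omega)
            rw [pow_add G (2 * u) (2 * v + 1), pow_succ, pow_succ]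
            generalize G ^ (2 * u) = X at *
            generalize G ^ (2 * v) = Y at *
            obtain ⟨X, rfl⟩ := Nat.exists_eq_add_of_le a1
            obtain ⟨Y, rfl⟩ := Nat.exists_eq_add_of_le a2
            nlinarith [Nat.zero_le (X * Y * G)]
      exact Nat.le_of_mul_le_mul_left e3 (by omega)
  obtain ⟨D', Λ', k1, k2, k3, k4⟩ := key
  refine ⟨Function.update D i D', Function.update Λ i Λ', A, ?_, h2, ?_, ?_⟩
  · intro j
    by_cases hj : j = i
    · subst hj; right; simpa using k1
    · simpa [Function.update_of_ne hj] using h1 j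
  · rw [Finset.prod_update_of_mem him]
    apply Nat.lcm_dvd
    · exact k2.trans (by rw [mul_assoc]; exact dvd_mul_right _ _)
    · refine h3.trans (mul_dvd_mul ?_ dvd_rfl)
      rw [← Finset.mul_prod_erase _ _ him, Finset.sdiff_singleton_eq_erase]
      exact mul_dvd_mul k3 dvd_rfl
  · have e1 : ∑ j ∈ Finset.range n, 2 ^ j * Function.update D i D' j ≤ ∑ j ∈ Finset.range n, 2 ^ j * D j + 2 ^ i * o := by
      rw [← Finset.add_sum_erase _ _ him, ← Finset.add_sum_erase _ _ him]
      rw [Finset.sum_congr rfl (g := fun j => 2 ^ j * D j)]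
      · rw [Function.update_self]
        have := Nat.mul_le_mul_left (2 ^ i) k4
        rw [mul_add] at this
        omega
      · intro j hj
        rw [Function.update_of_ne (Finset.ne_of_mem_erase hj)]
    omega

theorem StP_minus {q n : ℕ} (hq : 2 ≤ q) (he : Even q) : ∀ d {N s : ℕ}, StP q n N s → 1 ≤ d → d < 2 ^ n →
    StP q n (Nat.lcm (q ^ d - 1) N) (s + d) := by
  intro d
  induction d using Nat.strong_induction_on with
  | _ d ih =>
  intro N s h hd hdn
  obtain ⟨c, rfl | rfl⟩ := Nat.even_or_odd' d
  · have h1 := ih c (by omega) (StP_plus hq h (d := c) (by omega) (by omega)) (by omega) (by omega)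
    rw [show s + c + c = s + 2 * c by ring] at h1
    apply StP_dvd h1
    have hc1 : 1 ≤ q ^ c := Nat.one_le_pow _ _ (by omega)
    have e : q ^ (2 * c) - 1 = (q ^ c - 1) * (q ^ c + 1) := by
      rw [mul_comm 2 c, pow_mul, mul_comm]
      simpa using Nat.sq_sub_sq (q ^ c) 1
    have hcop : Nat.Coprime (q ^ c - 1) (q ^ c + 1) := by
      have hev : Even (q ^ c) := he.pow_of_ne_zero (by omega)
      have ho : Odd (q ^ c - 1) := Nat.Even.sub_odd hc1 hev odd_one
      rw [show q ^ c + 1 = 2 + (q ^ c - 1) by omega, Nat.coprime_add_self_right]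
      exact ho.coprime_two_right
    apply Nat.lcm_dvd
    · rw [e]
      apply Nat.Coprime.mul_dvd_of_dvd_of_dvd hcop
      · exact Nat.dvd_lcm_left _ _
      · exact (Nat.dvd_lcm_left _ _).trans (Nat.dvd_lcm_right _ _)
    · exact (Nat.dvd_lcm_right _ _).trans (Nat.dvd_lcm_right _ _)
  · obtain ⟨D, Λ, A, h1, h2, h3, h4⟩ := h
    refine ⟨D, Λ, (2 * c + 1) :: A, h1, ?_, ?_, ?_⟩
    · intro a ha
      rcases List.mem_cons.1 ha with rfl | ha
      · exact ⟨c, rfl⟩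
      · exact h2 a ha
    · rw [lcmA_cons]
      apply Nat.lcm_dvd
      · exact (Nat.dvd_lcm_left _ _).trans (dvd_mul_left _ _)
      · exact h3.trans (mul_dvd_mul dvd_rfl (Nat.dvd_lcm_right _ _))
    · rw [List.sum_cons]; omega

theorem StP_list {q n : ℕ} (hq : 2 ≤ q) (he : Even q) (l : List (ℕ × Bool)) (hl : ∀ x ∈ l, 1 ≤ x.1)
    (hn : ∀ x ∈ l, x.1 < 2 ^ n) : StP q n (lcmL q l) (sumL l) := by
  induction l with
  | nil => exact ⟨fun _ => 0, fun _ => 1, [], fun i => Or.inl ⟨rfl, rfl⟩, by simp, by simp [lcmL_nil], by simp⟩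
  | cons x l ih =>
    have h := ih (fun y hy => hl y (List.mem_cons_of_mem _ hy)) (fun y hy => hn y (List.mem_cons_of_mem _ hy))
    have h1 := hl x List.mem_cons_self
    have h2 := hn x List.mem_cons_self
    have e : sumL (x :: l) = sumL l + x.1 := by simp [sumL, add_comm]
    rw [lcmL_cons, e, pv]
    split_ifs
    · exact StP_plus hq h h1 h2
    · exact StP_minus hq he _ h h1 h2

theorem lcmA_pos (q : ℕ) (hq : 2 ≤ q) (A : List ℕ) (hA : ∀ a ∈ A, Odd a) : 0 < lcmA q A := by
  induction A with
  | nil => simp [lcmA_nil]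
  | cons a A ih =>
    rw [lcmA_cons]
    apply Nat.lcm_pos
    · have h1 := (hA a List.mem_cons_self).pos
      have : q ≤ q ^ a := Nat.le_self_pow (by omega) _
      omega
    · exact ih (fun a ha => hA a (List.mem_cons_of_mem _ ha))

theorem lcmL_bound {q : ℕ} (hq : 2 ≤ q) (he : Even q) (l : List (ℕ × Bool)) (hl : ∀ x ∈ l, 1 ≤ x.1) :
    ∃ (t : ℕ) (A : List ℕ), (∀ a ∈ A, Odd a) ∧ lcmL q l ≤ PP q t * lcmA q A ∧ t + A.sum ≤ sumL l := by
  have hn : ∀ x ∈ l, x.1 < 2 ^ (sumL l) := by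
    intro x hx
    have : x.1 ≤ sumL l := List.le_sum_of_mem (List.mem_map_of_mem hx)
    exact this.trans_lt Nat.lt_two_pow_self
  obtain ⟨D, Λ, A, h1, h2, h3, h4⟩ := StP_list hq he l hl hn
  refine ⟨∑ i ∈ Finset.range (sumL l), 2 ^ i * D i, A, h2, ?_, h4⟩
  have hΛ : ∀ i, Λ i ≤ if D i = 0 then 1 else q ^ (2 ^ i * D i) + 1 := by
    intro i
    rcases h1 i with ⟨a, b⟩ | ⟨a, b, _⟩
    · simp [a, b]
    · rw [if_neg (by intro h; rw [h] at a; simp at a)]; exact b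
  have hΛ0 : ∀ i, 0 < Λ i := by
    intro i
    rcases h1 i with ⟨a, b⟩ | ⟨a, b, c, d⟩
    · omega
    · exact d
  refine (Nat.le_of_dvd ?_ h3).trans (Nat.mul_le_mul_right _ ?_)
  · exact Nat.mul_pos (Finset.prod_pos fun i _ => hΛ0 i) (lcmA_pos q hq A h2)
  · refine (Finset.prod_le_prod' fun i _ => hΛ i).trans (PP_max _ q D hq fun i => ?_)
    rcases h1 i with ⟨a, _⟩ | ⟨a, _⟩
    · exact Or.inl a
    · exact Or.inr a

end SpAut
end PartC2

section PartC3
open Matrix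
set_option linter.unusedSectionVars false
namespace SpAut

theorem low_zero (t : ℕ) : ∃ j k, t = 2 ^ j - 1 + 2 ^ (j + 1) * k := by
  obtain ⟨j, o, ⟨k, hk⟩, h⟩ := Nat.exists_eq_two_pow_mul_odd (show t + 1 ≠ 0 by omega)
  refine ⟨j, k, ?_⟩
  subst hk
  have h1 : 1 ≤ 2 ^ j := Nat.one_le_two_pow
  have : 2 ^ j * (2 * k + 1) = 2 ^ (j + 1) * k + 2 ^ j := by ring
  omega

theorem PPQ (q j k : ℕ) (hq : 2 ≤ q) :
    PP q (2 ^ j - 1 + 2 ^ (j + 1) * k) * (q - 1) * (q ^ 2 ^ j + 1) ≤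
      q ^ (2 ^ j - 1 + 2 ^ (j + 1) * k + 1) * q ^ 2 ^ j := by
  have h2 := PP_lt (q ^ 2 ^ (j + 1)) k (hq.trans (Nat.le_self_pow (by positivity) _))
  rw [PP_jk _ _ _ (by omega)]
  have h1 : 1 ≤ 2 ^ j := Nat.one_le_two_pow
  rw [← pow_mul] at h2
  have e1 : q ^ (2 ^ j - 1 + 2 ^ (j + 1) * k + 1) * q ^ 2 ^ j = q ^ (2 ^ (j + 1) * (k + 1)) := by
    rw [← pow_add]; congr 1
    have : 2 ^ (j + 1) * (k + 1) = 2 ^ (j + 1) * k + (2 ^ j + 2 ^ j) := by ring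
    omega
  rw [e1]
  have e2 : q ^ 2 ^ (j + 1) - 1 = (q ^ 2 ^ j - 1) * (q ^ 2 ^ j + 1) := by
    rw [pow_succ, pow_mul, mul_comm]
    simpa using Nat.sq_sub_sq (q ^ 2 ^ j) 1
  rw [e2] at h2
  refine le_trans (le_of_eq ?_) (le_trans (Nat.le_succ _) h2)
  ring

theorem uc_ge (a : ℕ) : a ≤ uc a := by
  unfold uc
  split_ifs with h1 h2
  · omega
  · omega
  · have : a - 2 < 2 ^ (a - 2) := Nat.lt_two_pow_self
    omega

theorem uc_gt (a : ℕ) (h : 4 ≤ a) : a < uc a := by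
  unfold uc
  rw [if_neg (by omega), if_neg (by omega)]
  obtain ⟨b, rfl⟩ := Nat.exists_eq_add_of_le h
  have : b < 2 ^ b := Nat.lt_two_pow_self
  rw [show 4 + b - 2 = b + 2 by omega, pow_add]
  omega

theorem lcmA_le (q : ℕ) (hq : 2 ≤ q) (A : List ℕ) : lcmA q A ≤ q ^ A.sum := by
  induction A with
  | nil => simp [lcmA_nil]
  | cons a A ih =>
    rw [lcmA_cons, List.sum_cons, pow_add]
    have h0 : 0 < q ^ a := by positivity
    rcases Nat.eq_zero_or_pos a with h | h
    · subst h; simp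
    rcases Nat.eq_zero_or_pos (lcmA q A) with h' | h'
    · rw [h']; simp
    refine (Nat.le_of_dvd ?_ (Nat.lcm_dvd_mul _ _)).trans (Nat.mul_le_mul (by omega) ih)
    apply Nat.mul_pos _ h'
    have : q ≤ q ^ a := Nat.le_self_pow (by omega) _
    omega

theorem PP_le_two (q t : ℕ) (hq : 2 ≤ q) : PP q t ≤ 2 * q ^ t := by
  have := PP_lt q t hq
  rw [pow_succ] at this
  obtain ⟨r, rfl⟩ : ∃ r, q = r + 2 := ⟨q - 2, by omega⟩
  rw [show r + 2 - 1 = r + 1 by omega] at this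
  by_contra hc
  push Not at hc
  nlinarith

theorem crude (q t a m : ℕ) (A : List ℕ) (hq : 2 ≤ q) (h : t + A.sum + uc a ≤ m) :
    PP q t * lcmA q A * 2 ^ a ≤ 2 * q ^ m := by
  have h1 := PP_le_two q t hq
  have h2 := lcmA_le q hq A
  have h3 : 2 ^ a ≤ q ^ uc a := (Nat.pow_le_pow_left hq a).trans (Nat.pow_le_pow_right (by omega) (uc_ge a))
  calc _ ≤ 2 * q ^ t * q ^ A.sum * q ^ uc a := by gcongr
    _ = 2 * q ^ (t + A.sum + uc a) := by rw [pow_add, pow_add]; ring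
    _ ≤ _ := by gcongr; omega

theorem two_red (t a m : ℕ) (A : List ℕ) (hA : ∀ a ∈ A, Odd a) (h : t + A.sum + uc a ≤ m) :
    (PP 2 t * lcmA 2 A * 2 ^ a ≤ PP 2 t * 2 ^ (m - t) ∧ m - t ≤ 3) ∨
    PP 2 t * lcmA 2 A * 2 ^ a ≤ 2 ^ m ∨
    ∃ b, Odd b ∧ b ≤ m - t ∧ PP 2 t * lcmA 2 A * 2 ^ a ≤ PP 2 t * ((2 ^ b - 1) * 2 ^ (m - t - b)) := by
  have hu := uc_ge a
  rcases A with _ | ⟨b, A⟩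
  · simp only [List.sum_nil, lcmA_nil, mul_one, add_zero] at *
    by_cases h3 : m - t ≤ 3
    · left; refine ⟨?_, h3⟩
      gcongr
      · norm_num
      · omega
    · right; left
      have h4 : a ≤ m - t - 1 := by
        by_contra hc
        have := uc_gt a (by omega)
        omega
      calc _ ≤ 2 * 2 ^ t * 2 ^ (m - t - 1) := by
            gcongr
            · exact PP_le_two 2 t le_rfl
            · norm_num
        _ = 2 ^ (1 + t + (m - t - 1)) := by rw [pow_add, pow_add, pow_one]
        _ = _ := by congr 1; omega
  · right; right
    rw [List.sum_cons] at h
    refine ⟨b, hA b List.mem_cons_self, by omega, ?_⟩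
    rw [mul_assoc]
    apply Nat.mul_le_mul_left
    have hp := lcmA_pos 2 le_rfl A (fun x hx => hA x (List.mem_cons_of_mem _ hx))
    have hb := (hA b List.mem_cons_self).pos
    have h2b : 2 ≤ 2 ^ b := Nat.le_self_pow (by omega) _
    rw [lcmA_cons]
    have h1 : Nat.lcm (2 ^ b - 1) (lcmA 2 A) ≤ (2 ^ b - 1) * 2 ^ A.sum := by
      refine (Nat.le_of_dvd ?_ (Nat.lcm_dvd_mul _ _)).trans (Nat.mul_le_mul_left _ (lcmA_le 2 le_rfl A))
      exact Nat.mul_pos (by omega) hp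
    calc _ ≤ (2 ^ b - 1) * 2 ^ A.sum * 2 ^ a := Nat.mul_le_mul_right _ h1
      _ = (2 ^ b - 1) * 2 ^ (A.sum + a) := by rw [pow_add]; ring
      _ ≤ _ := by
        gcongr
        · norm_num
        · omega

theorem Mm_two (m : ℕ) (hm : 1 ≤ m) : ∃ L, 2 ^ (L + 1) - 1 ≤ m ∧ m < 2 ^ (L + 2) - 1 ∧ Mm m 2 =
    (if m - (2 ^ (L + 1) - 1) ≤ 3 then 2 ^ (m - (2 ^ (L + 1) - 1)) * (2 ^ 2 ^ (L + 1) - 1)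
    else if m - (2 ^ (L + 1) - 1) < 2 ^ L then
      if Odd (m - (2 ^ (L + 1) - 1)) then (2 ^ (2 ^ L + (m - (2 ^ (L + 1) - 1))) - 1) * (2 ^ 2 ^ L - 1)
      else 2 * (2 ^ (2 ^ L + (m - (2 ^ (L + 1) - 1)) - 1) - 1) * (2 ^ 2 ^ L - 1)
    else if m - (2 ^ (L + 1) - 1) = 2 ^ L then (2 ^ 2 ^ (L + 1) + 1) * (2 ^ 2 ^ L - 1)
    else if Odd (m - (2 ^ (L + 1) - 1)) then (2 ^ (m - (2 ^ (L + 1) - 1)) - 1) * (2 ^ 2 ^ (L + 1) - 1)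
    else 2 * (2 ^ (m - (2 ^ (L + 1) - 1) - 1) - 1) * (2 ^ 2 ^ (L + 1) - 1)) := by
  obtain ⟨L, hL⟩ : ∃ L, Nat.findGreatest (fun l => 0 < l ∧ 2 ^ l - 1 ≤ m) m = L := ⟨_, rfl⟩
  have h1 := Nat.findGreatest_spec (P := fun l => 0 < l ∧ 2 ^ l - 1 ≤ m) (n := m) (m := 1) hm (by simpa using hm)
  rw [hL] at h1
  obtain ⟨L, rfl⟩ : ∃ L', L = L' + 1 := ⟨L - 1, by omega⟩
  refine ⟨L, h1.2, ?_, ?_⟩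
  · by_contra hc
    have h2 : L + 2 < 2 ^ (L + 2) := Nat.lt_two_pow_self
    have := Nat.findGreatest_is_greatest (P := fun l => 0 < l ∧ 2 ^ l - 1 ≤ m) (n := m) (k := L + 2) (by omega) (by omega)
    apply this
    constructor <;> omega
  · unfold Mm
    rw [if_pos rfl, hL]
    simp only [Nat.add_sub_cancel]

end SpAut
end PartC3

section PartC4
open Matrix
set_option linter.unusedSectionVars false
namespace SpAut

theorem Mm_two' (m : ℕ) (hm : 1 ≤ m) : ∃ L m0, m + 1 = 2 * 2 ^ L + m0 ∧ m0 < 2 * 2 ^ L ∧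
    ((m0 ≤ 3 ∧ Mm m 2 = 2 ^ m0 * (2 ^ (2 * 2 ^ L) - 1)) ∨
     (3 < m0 ∧ m0 < 2 ^ L ∧ ∃ b, Odd b ∧ b ≤ 2 ^ L + m0 ∧ 2 ^ L + m0 ≤ b + 1 ∧
        Mm m 2 = 2 ^ (2 ^ L + m0 - b) * (2 ^ b - 1) * (2 ^ 2 ^ L - 1)) ∨
     (3 < m0 ∧ m0 = 2 ^ L ∧ Mm m 2 = (2 ^ (2 * 2 ^ L) + 1) * (2 ^ 2 ^ L - 1)) ∨
     (3 < m0 ∧ 2 ^ L < m0 ∧ ∃ b, Odd b ∧ b ≤ m0 ∧ m0 ≤ b + 1 ∧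
        Mm m 2 = 2 ^ (m0 - b) * (2 ^ b - 1) * (2 ^ (2 * 2 ^ L) - 1))) := by
  obtain ⟨L, h1, h2, h3⟩ := Mm_two m hm
  have e1 : 2 ^ (L + 1) = 2 * 2 ^ L := by ring
  have e2 : 2 ^ (L + 2) = 4 * 2 ^ L := by ring
  have e3 : 1 ≤ 2 ^ L := Nat.one_le_two_pow
  rw [e1] at h1 h3
  rw [e2] at h2
  obtain ⟨m0, hm0⟩ : ∃ m0, m - (2 * 2 ^ L - 1) = m0 := ⟨_, rfl⟩
  rw [hm0] at h3
  refine ⟨L, m0, by omega, by omega, ?_⟩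
  have hev : 3 < m0 → Even (2 ^ L) := by
    intro h
    rcases L with _ | L
    · simp at *; omega
    · rw [pow_succ]; exact even_two.mul_left _
  rw [h3]
  by_cases c1 : m0 ≤ 3
  · left; rw [if_pos c1]; exact ⟨c1, rfl⟩
  right
  rw [if_neg c1]
  push Not at c1
  have hev' := hev c1
  by_cases c2 : m0 < 2 ^ L
  · left
    refine ⟨c1, c2, ?_⟩
    rw [if_pos c2]
    by_cases c3 : Odd m0
    · rw [if_pos c3]
      exact ⟨2 ^ L + m0, hev'.add_odd c3, le_rfl, by omega, by simp⟩
    · rw [if_neg c3]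
      refine ⟨2 ^ L + m0 - 1, ?_, by omega, by omega, ?_⟩
      · rw [Nat.not_odd_iff_even] at c3
        exact Nat.Even.sub_odd (by omega) (hev'.add c3) odd_one
      · rw [show 2 ^ L + m0 - (2 ^ L + m0 - 1) = 1 by omega, pow_one]
  right
  rw [if_neg c2]
  by_cases c3 : m0 = 2 ^ L
  · left; rw [if_pos c3]; exact ⟨c1, c3, rfl⟩
  · right; rw [if_neg c3]
    refine ⟨c1, by omega, ?_⟩
    by_cases c4 : Odd m0
    · rw [if_pos c4]; exact ⟨m0, c4, le_rfl, by omega, by simp⟩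
    · rw [if_neg c4]
      refine ⟨m0 - 1, ?_, by omega, by omega, ?_⟩
      · rw [Nat.not_odd_iff_even] at c4
        exact Nat.Even.sub_odd (by omega) c4 odd_one
      · rw [show m0 - (m0 - 1) = 1 by omega, pow_one]

theorem pw_le {b c M : ℕ} (h : b ≤ c) (h' : c ≤ M) : (2 ^ b - 1) * 2 ^ (M - b) ≤ (2 ^ c - 1) * 2 ^ (M - c) := by
  rw [Nat.sub_mul, Nat.sub_mul, ← pow_add, ← pow_add, show b + (M - b) = M by omega, show c + (M - c) = M by omega]
  apply Nat.sub_le_sub_left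
  gcongr
  norm_num

/-- `2 ^ (m+1) * (H - 2) ≤ Mm * H` gives the bound for small `Q`. -/
theorem small_Q {X Q H P M : ℕ} (h1 : X * (Q + 1) ≤ P * Q) (h2 : Q * Q ≤ H) (hH : 16 ≤ H)
    (h3 : P * (H - 2) ≤ M * H) : X ≤ M := by
  have h4 : 2 * (Q + 1) ≤ H := by
    by_contra hc
    have : Q ≤ 3 ∨ 4 ≤ Q := by omega
    rcases this with h | h
    · omega
    · nlinarith
  obtain ⟨K, rfl⟩ := Nat.exists_eq_add_of_le h4
  have h5 : 2 * (Q + 1) + K - 2 = 2 * Q + K := by omega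
  rw [h5] at h3
  apply Nat.le_of_mul_le_mul_right (c := (Q + 1) * (2 * (Q + 1) + K)) _ (by positivity)
  calc X * ((Q + 1) * (2 * (Q + 1) + K)) = X * (Q + 1) * (2 * (Q + 1) + K) := by ring
    _ ≤ P * Q * (2 * (Q + 1) + K) := Nat.mul_le_mul_right _ h1
    _ = P * (Q * (2 * (Q + 1) + K)) := by ring
    _ ≤ P * ((2 * Q + K) * (Q + 1)) := Nat.mul_le_mul_left _ (by nlinarith)
    _ = P * (2 * Q + K) * (Q + 1) := by ring
    _ ≤ M * (2 * (Q + 1) + K) * (Q + 1) := Nat.mul_le_mul_right _ h3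
    _ = _ := by ring

theorem PP_two_ones (L : ℕ) : PP 2 (2 ^ L - 1) = 2 ^ 2 ^ L - 1 := by
  have := PP_jk 2 L 0 (by norm_num)
  simpa [PP_zero] using this

theorem PP_one (q : ℕ) : PP q 1 = q + 1 := by
  have := PP_odd q 0
  simpa [PP_zero] using this

theorem PP_two_three (L : ℕ) : PP 2 (2 ^ L - 1 + 2 ^ (L + 1)) = (2 ^ 2 ^ L - 1) * (2 ^ (2 * 2 ^ L) + 1) := by
  have := PP_jk 2 L 1 (by norm_num)
  rw [PP_one, mul_one] at this
  simpa [pow_succ, mul_comm] using this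

theorem two_pow_le_Mm (m : ℕ) (hm : 1 ≤ m) : 2 ^ m ≤ Mm m 2 := by
  obtain ⟨L, m0, h1, h2, h⟩ := Mm_two' m hm
  have hh : 1 ≤ 2 ^ L := Nat.one_le_two_pow
  generalize 2 ^ L = h' at *
  have hH : 2 ≤ 2 ^ h' := Nat.le_self_pow (by omega) _
  have hH2 : (2:ℕ) ^ (2 * h') = 2 ^ h' * 2 ^ h' := by rw [two_mul, pow_add]
  rcases h with ⟨h3, h4⟩ | ⟨h3, h4, b, hb, hb1, hb2, h5⟩ | ⟨h3, h4, h5⟩ | ⟨h3, h4, b, hb, hb1, hb2, h5⟩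
  · rw [h4, hH2]
    have : 2 * 2 ^ m = 2 ^ m0 * (2 ^ h' * 2 ^ h') := by
      rw [← hH2, ← pow_succ', h1, pow_add]; ring
    have h9 : 1 ≤ 2 ^ m0 := Nat.one_le_two_pow
    generalize 2 ^ m0 = P at *
    generalize 2 ^ h' = H at *
    obtain ⟨K, rfl⟩ := Nat.exists_eq_add_of_le hH
    have : (2 + K) * (2 + K) - 1 = 3 + 4 * K + K * K := by
      have : (2 + K) * (2 + K) = 4 + 4 * K + K * K := by ring
      omega
    rw [this]
    nlinarith [Nat.zero_le (P * K), Nat.zero_le (P * (K * K))]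
  · rw [h5]
    have hB : 4 ≤ 2 ^ b := (show 4 = 2 ^ 2 by norm_num) ▸ Nat.pow_le_pow_right (by norm_num) (by omega)
    have : 2 * 2 ^ m = 2 ^ (h' + m0 - b) * 2 ^ b * 2 ^ h' := by
      rw [← pow_add, ← pow_add, ← pow_succ', h1]; congr 1; omega
    have hH : 4 ≤ 2 ^ h' := (show 4 = 2 ^ 2 by norm_num) ▸ Nat.pow_le_pow_right (by norm_num) (by omega)
    generalize 2 ^ (h' + m0 - b) = P at *
    generalize 2 ^ b = B at *
    generalize 2 ^ h' = H at *
    obtain ⟨B, rfl⟩ := Nat.exists_eq_add_of_le hB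
    obtain ⟨H, rfl⟩ := Nat.exists_eq_add_of_le hH
    rw [show 4 + B - 1 = 3 + B by omega, show 4 + H - 1 = 3 + H by omega]
    nlinarith [Nat.zero_le P, Nat.zero_le (P * B), Nat.zero_le (P * H), Nat.zero_le (P * B * H)]
  · rw [h5, hH2]
    have : 2 * 2 ^ m = 2 ^ h' * 2 ^ h' * 2 ^ h' := by
      rw [← pow_add, ← pow_add, ← pow_succ', h1]; congr 1; omega
    generalize 2 ^ h' = H at *
    obtain ⟨H, rfl⟩ := Nat.exists_eq_add_of_le hH
    rw [show 2 + H - 1 = 1 + H by omega]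
    nlinarith [Nat.zero_le (H*H), Nat.zero_le (H * H * H)]
  · rw [h5, hH2]
    have hB : 4 ≤ 2 ^ b := (show 4 = 2 ^ 2 by norm_num) ▸ Nat.pow_le_pow_right (by norm_num) (by omega)
    have : 2 * 2 ^ m = 2 ^ (m0 - b) * 2 ^ b * (2 ^ h' * 2 ^ h') := by
      rw [← pow_add, ← pow_add, ← pow_add, ← pow_succ', h1]; congr 1; omega
    have hHH : 4 ≤ 2 ^ h' * 2 ^ h' := by nlinarith
    generalize 2 ^ (m0 - b) = P at *
    generalize 2 ^ b = B at *
    generalize 2 ^ h' * 2 ^ h' = H at *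
    obtain ⟨B, rfl⟩ := Nat.exists_eq_add_of_le hB
    obtain ⟨H, rfl⟩ := Nat.exists_eq_add_of_le hHH
    rw [show 4 + B - 1 = 3 + B by omega, show 4 + H - 1 = 3 + H by omega]
    nlinarith [Nat.zero_le P, Nat.zero_le (P * B), Nat.zero_le (P * H), Nat.zero_le (P * B * H)]

end SpAut
end PartC4

section PartC5
open Matrix
set_option linter.unusedSectionVars false
namespace SpAut

set_option maxHeartbeats 2000000 in
theorem two_main (t m N : ℕ) (hm : 1 ≤ m) (htm : t ≤ m)
    (hred : (N ≤ PP 2 t * 2 ^ (m - t) ∧ m - t ≤ 3) ∨ N ≤ 2 ^ m ∨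
      ∃ b, Odd b ∧ b ≤ m - t ∧ N ≤ PP 2 t * ((2 ^ b - 1) * 2 ^ (m - t - b))) : N ≤ Mm m 2 := by
  have hMm := two_pow_le_Mm m hm
  by_cases hN2 : N ≤ 2 ^ m
  · exact hN2.trans hMm
  have hred' : (m - t ≤ 3) ∨ ∃ b, Odd b ∧ b ≤ m - t ∧ N ≤ PP 2 t * ((2 ^ b - 1) * 2 ^ (m - t - b)) := by
    rcases hred with h | h | h
    · exact Or.inl h.2
    · exact absurd h hN2
    · exact Or.inr h
  have hX : N ≤ PP 2 t * 2 ^ (m - t) := by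
    rcases hred with h | h | ⟨b, hb, hbm, h⟩
    · exact h.1
    · exact absurd h hN2
    · refine h.trans (Nat.mul_le_mul_left _ ?_)
      have : 2 ^ (m - t) = 2 ^ b * 2 ^ (m - t - b) := by rw [← pow_add]; congr 1; omega
      rw [this]
      exact Nat.mul_le_mul_right _ (Nat.sub_le _ _)
  clear hred
  obtain ⟨L, m0, h1, h2, h⟩ := Mm_two' m hm
  obtain ⟨j, k, hjk⟩ := low_zero t
  have hh : 1 ≤ 2 ^ L := Nat.one_le_two_pow
  have hQ := PPQ 2 j k le_rfl
  rw [← hjk] at hQ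
  simp only [Nat.add_one_sub_one, mul_one] at hQ
  have hXQ : PP 2 t * 2 ^ (m - t) * (2 ^ 2 ^ j + 1) ≤ 2 ^ (m + 1) * 2 ^ 2 ^ j := by
    calc _ = PP 2 t * (2 ^ 2 ^ j + 1) * 2 ^ (m - t) := by ring
      _ ≤ 2 ^ (t + 1) * 2 ^ 2 ^ j * 2 ^ (m - t) := Nat.mul_le_mul_right _ hQ
      _ = 2 ^ (t + 1 + (m - t)) * 2 ^ 2 ^ j := by rw [pow_add]; ring
      _ = _ := by rw [show t + 1 + (m - t) = m + 1 by omega]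
  have hH2 : (2:ℕ) ^ (2 * 2 ^ L) = 2 ^ 2 ^ L * 2 ^ 2 ^ L := by rw [two_mul, pow_add]
  -- possible values of j
  have hjt : 2 ^ j ≤ t + 1 := by omega
  have hjL : j ≤ L + 1 := by
    by_contra hc
    have : 2 ^ (L + 2) ≤ 2 ^ j := Nat.pow_le_pow_right (by norm_num) (by omega)
    rw [pow_add] at this
    omega
  -- values of t
  have htL1 : j = L + 1 → t = 2 ^ (L + 1) - 1 ∧ PP 2 t = 2 ^ (2 * 2 ^ L) - 1 := by
    intro hj
    have : k = 0 := by
      by_contra hk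
      have hk1 : 1 ≤ k := by omega
      rw [hj] at hjk
      have e : 2 ^ (L + 1 + 1) = 4 * 2 ^ L := by ring
      have e' : 2 ^ (L + 1) = 2 * 2 ^ L := by ring
      rw [e, e'] at hjk
      nlinarith
    subst this
    subst hj
    have e' : 2 ^ (L + 1) = 2 * 2 ^ L := by ring
    refine ⟨by omega, ?_⟩
    rw [hjk, mul_zero, add_zero, PP_two_ones, e']
  have htL : j = L → (t = 2 ^ L - 1 ∧ PP 2 t = 2 ^ 2 ^ L - 1) ∨
      (t = 3 * 2 ^ L - 1 ∧ PP 2 t = (2 ^ 2 ^ L - 1) * (2 ^ (2 * 2 ^ L) + 1)) := by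
    intro hj
    subst hj
    have e' : 2 ^ (j + 1) = 2 * 2 ^ j := by ring
    have : k = 0 ∨ k = 1 := by
      by_contra hk
      have hk1 : 2 ≤ k := by omega
      have : 2 ^ (j + 1) * 2 ≤ 2 ^ (j + 1) * k := Nat.mul_le_mul_left _ hk1
      omega
    rcases this with rfl | rfl
    · left; rw [hjk, mul_zero, add_zero, PP_two_ones]; exact ⟨rfl, rfl⟩
    · right; refine ⟨by omega, ?_⟩
      rw [hjk, mul_one, PP_two_three]
  have hjsmall : j < L → 2 ^ 2 ^ j * 2 ^ 2 ^ j ≤ 2 ^ 2 ^ L := by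
    intro hj
    rw [← pow_add]
    apply Nat.pow_le_pow_right (by norm_num)
    rw [← two_mul, ← pow_succ']
    exact Nat.pow_le_pow_right (by norm_num) hj
  have hcase : j < L ∨ j = L ∨ j = L + 1 := by omega
  have hm1 : 2 ^ (m + 1) = 2 ^ 2 ^ L * 2 ^ 2 ^ L * 2 ^ m0 := by
    rw [h1, pow_add, hH2]
  -- m0 ≤ 3
  rcases h with ⟨h3, h4⟩ | h
  · rw [h4]
    refine hX.trans ?_
    have hj : j ≤ L ∨ j = L + 1 := by omega
    rcases hj with hj | hj
    · have hQH : 2 ^ 2 ^ j ≤ 2 ^ 2 ^ L :=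
        Nat.pow_le_pow_right (by norm_num) (Nat.pow_le_pow_right (by norm_num) hj)
      have hQ1 : 1 ≤ 2 ^ 2 ^ j := Nat.one_le_two_pow
      have hH1 : 2 ≤ 2 ^ 2 ^ L := Nat.le_self_pow (by omega) _
      rw [hm1] at hXQ
      rw [hH2]
      generalize 2 ^ 2 ^ j = Q at *
      generalize 2 ^ 2 ^ L = H at *
      generalize 2 ^ m0 = P at *
      generalize PP 2 t * 2 ^ (m - t) = X at *
      have hHH : 1 ≤ H * H := by nlinarith
      have hQH2 : Q + 1 ≤ H * H := by nlinarith
      obtain ⟨Y, hY⟩ := Nat.exists_eq_add_of_le hHH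
      rw [hY, Nat.add_sub_cancel_left]
      rw [hY] at hXQ hQH2
      apply Nat.le_of_mul_le_mul_right (c := Q + 1) _ (by omega)
      refine hXQ.trans ?_
      have : P * Q ≤ P * Y := Nat.mul_le_mul_left _ (by omega)
      nlinarith
    · obtain ⟨e1, e2⟩ := htL1 hj
      rw [e2, mul_comm]
      apply Nat.mul_le_mul_right
      apply Nat.pow_le_pow_right (by norm_num)
      have : 2 ^ (L + 1) = 2 * 2 ^ L := by ring
      omega
  have hm03 : 3 < m0 := by
    rcases h with h | h | h
    · exact h.1
    · exact h.1
    · exact h.1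
  have hh4 : 4 ≤ 2 ^ L := by
    rcases L with _ | _ | L
    · omega
    · omega
    · rw [pow_add, pow_add]; have : 1 ≤ 2 ^ L := Nat.one_le_two_pow
      omega
  have hH16 : 16 ≤ 2 ^ 2 ^ L := (show 16 = 2 ^ 4 by norm_num) ▸ Nat.pow_le_pow_right (by norm_num) hh4
  have hLev : ∀ b, Odd b → b ≤ 2 ^ L → b + 1 ≤ 2 ^ L := by
    intro b hb hbL
    have hev : Even (2 ^ L) := by
      apply even_two.pow_of_ne_zero
      rintro rfl; omega
    rcases Nat.lt_or_eq_of_le hbL with h | h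
    · omega
    · subst h; exact absurd hev (Nat.not_even_iff_odd.2 hb)
  -- the case j < L
  have hsm : 2 ^ (m + 1) * (2 ^ 2 ^ L - 2) ≤ Mm m 2 * 2 ^ 2 ^ L := by
    rcases h with ⟨h3, h4, b, hb, hb1, hb2, h5⟩ | ⟨h3, h4, h5⟩ | ⟨h3, h4, b, hb, hb1, hb2, h5⟩
    · rw [h5]
      have hB : 2 ^ 2 ^ L ≤ 2 ^ b := Nat.pow_le_pow_right (by norm_num) (by omega)
      have e : 2 ^ (m + 1) = 2 ^ (2 ^ L + m0 - b) * 2 ^ b * 2 ^ 2 ^ L := by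
        rw [← pow_add, ← pow_add, h1]; congr 1; omega
      rw [e]
      generalize 2 ^ (2 ^ L + m0 - b) = P at *
      generalize 2 ^ b = B at *
      generalize 2 ^ 2 ^ L = H at *
      obtain ⟨H, rfl⟩ := Nat.exists_eq_add_of_le hH16
      obtain ⟨B, rfl⟩ := Nat.exists_eq_add_of_le hB
      rw [show 16 + H - 2 = 14 + H by omega, show 16 + H - 1 = 15 + H by omega,
        show 16 + H + B - 1 = 15 + H + B by omega]
      have : (16 + H + B) * (14 + H) ≤ (15 + H + B) * (15 + H) := by clear * -; ring_nf; omega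
      calc _ = P * (16 + H) * ((16 + H + B) * (14 + H)) := by ring
        _ ≤ P * (16 + H) * ((15 + H + B) * (15 + H)) := Nat.mul_le_mul_left _ this
        _ = _ := by ring
    · rw [h5, hH2]
      have e : 2 ^ (m + 1) = 2 ^ 2 ^ L * 2 ^ 2 ^ L * 2 ^ 2 ^ L := by
        rw [← pow_add, ← pow_add, h1]; congr 1; omega
      rw [e]
      generalize 2 ^ 2 ^ L = H at *
      have : H - 2 ≤ H - 1 := by omega
      calc _ ≤ H * H * H * (H - 1) := Nat.mul_le_mul_left _ this
        _ = H * H * (H - 1) * H := by ring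
        _ ≤ _ := by gcongr; omega
    · rw [h5]
      have hB : 2 ^ 2 ^ L ≤ 2 ^ b := Nat.pow_le_pow_right (by norm_num) (by omega)
      have e : 2 ^ (m + 1) = 2 ^ (m0 - b) * 2 ^ b * (2 ^ 2 ^ L * 2 ^ 2 ^ L) := by
        rw [← pow_add, ← pow_add, ← pow_add, h1]; congr 1; omega
      rw [e, hH2]
      generalize 2 ^ (m0 - b) = P at *
      generalize 2 ^ b = B at *
      generalize 2 ^ 2 ^ L = H at *
      obtain ⟨H, rfl⟩ := Nat.exists_eq_add_of_le hH16
      obtain ⟨B, rfl⟩ := Nat.exists_eq_add_of_le hB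
      rw [show 16 + H - 2 = 14 + H by omega, show (16 + H) * (16 + H) - 1 = (15 + H) * (17 + H) by
        have : (16 + H) * (16 + H) = (15 + H) * (17 + H) + 1 := by ring
        omega, show 16 + H + B - 1 = 15 + H + B by omega]
      have : (16 + H + B) * (14 + H) * (16 + H) ≤ (15 + H + B) * ((15 + H) * (17 + H)) := by clear * -; ring_nf; nlinarith
      calc _ = P * (16 + H) * ((16 + H + B) * (14 + H) * (16 + H)) := by ring
        _ ≤ P * (16 + H) * ((15 + H + B) * ((15 + H) * (17 + H))) := Nat.mul_le_mul_left _ this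
        _ = _ := by ring
  rcases hcase with hj | hj
  · exact hX.trans (small_Q hXQ (hjsmall hj) hH16 hsm)
  clear hsm hXQ hjsmall hQ
  have e4 : 2 ^ (L + 1) = 2 * 2 ^ L := by ring
  rcases h with ⟨h3, h4, c, hc, hc1, hc2, h5⟩ | ⟨h3, h4, h5⟩ | ⟨h3, h4, c, hc, hc1, hc2, h5⟩
  · -- m0 < h
    rw [h5]
    rcases hj with hj | hj
    · rcases htL hj with ⟨e1, e2⟩ | ⟨e1, e2⟩
      · rcases hred' with h | ⟨b, hb, hbm, h⟩
        · omega
        refine h.trans ?_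
        rw [e2, mul_comm]
        apply Nat.mul_le_mul_right
        have e3 : m - t = 2 ^ L + m0 := by omega
        rw [e3] at hbm ⊢
        rw [mul_comm (2 ^ (2 ^ L + m0 - c))]
        apply pw_le _ hc1
        rcases Nat.lt_or_ge c b with hlt | hge
        · exfalso
          have : b = c + 1 := by omega
          rw [this] at hb
          exact absurd hb (Nat.not_odd_iff_even.2 hc.add_one)
        · exact hge
      · omega
    · obtain ⟨e1, e2⟩ := htL1 hj
      rcases hred' with h | ⟨b, hb, hbm, h⟩
      · omega
      have e3 : m - t = m0 := by omega
      rw [e3] at hbm h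
      refine h.trans ?_
      rw [e2, hH2]
      have hBH : 2 * (2 ^ b) ≤ 2 ^ 2 ^ L := by
        rw [← pow_succ']; exact Nat.pow_le_pow_right (by norm_num) (by omega)
      have hCH : 2 ^ 2 ^ L ≤ 2 ^ c := Nat.pow_le_pow_right (by norm_num) (by omega)
      have e5 : 2 ^ (2 ^ L + m0 - c) * 2 ^ c = 2 ^ 2 ^ L * (2 ^ b * 2 ^ (m0 - b)) := by
        rw [← pow_add, ← pow_add, ← pow_add]; congr 1; omega
      have hb1 : 1 ≤ 2 ^ b := Nat.one_le_two_pow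
      generalize 2 ^ (2 ^ L + m0 - c) = R at *
      generalize 2 ^ c = C at *
      generalize 2 ^ 2 ^ L = H at *
      generalize 2 ^ (m0 - b) = P at *
      generalize 2 ^ b = B at *
      clear * - hH16 hBH hCH e5 hb1
      -- (H^2-1)(B-1)P ≤ R (C-1)(H-1)
      obtain ⟨H, rfl⟩ := Nat.exists_eq_add_of_le hH16
      rw [show (16 + H) * (16 + H) - 1 = (15 + H) * (17 + H) by
        have : (16 + H) * (16 + H) = (15 + H) * (17 + H) + 1 := by ring
        omega, show 16 + H - 1 = 15 + H by omega]
      obtain ⟨B, rfl⟩ := Nat.exists_eq_add_of_le hb1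
      rw [Nat.add_sub_cancel_left]
      have hR : R * (C - 1) = R * C - R := by rw [Nat.mul_sub, mul_one]
      have hRle : R ≤ (1 + B) * P := by
        have : R * (16 + H) ≤ R * C := Nat.mul_le_mul_left _ hCH
        rw [e5] at this
        apply Nat.le_of_mul_le_mul_right (c := 16 + H) _ (by omega)
        linarith
      have key : (17 + H) * (B * P) ≤ R * (C - 1) := by
        rw [hR, e5]
        apply Nat.le_sub_of_add_le
        have : P * (2 * (1 + B)) ≤ P * (16 + H) := Nat.mul_le_mul_left _ hBH
        nlinarith
      calc _ = (17 + H) * (B * P) * (15 + H) := by ring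
        _ ≤ _ := Nat.mul_le_mul_right _ key
  · -- m0 = h
    rw [h5]
    rcases hj with hj | hj
    · rcases htL hj with ⟨e1, e2⟩ | ⟨e1, e2⟩
      · refine hX.trans ?_
        rw [e2, mul_comm]
        apply Nat.mul_le_mul_right
        rw [show m - t = 2 * 2 ^ L by omega]
        omega
      · refine hX.trans ?_
        rw [e2, show m - t = 0 by omega, pow_zero, mul_one, mul_comm]
    · obtain ⟨e1, e2⟩ := htL1 hj
      rcases hred' with h | ⟨b, hb, hbm, h⟩
      · omega
      have e3 : m - t = 2 ^ L := by omega
      rw [e3] at hbm h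
      refine h.trans ?_
      rw [e2]
      apply Nat.mul_le_mul (by omega)
      rw [Nat.sub_mul, ← pow_add, show b + (2 ^ L - b) = 2 ^ L by omega]
      have : 1 ≤ 2 ^ (2 ^ L - b) := Nat.one_le_two_pow
      omega
  · -- m0 > h
    rw [h5]
    have hhH : m - t + t = m := by omega
    rcases hj with hj | hj
    · have hbd : PP 2 t * 2 ^ (m - t) ≤ (2 ^ 2 ^ L - 1) * (2 ^ (2 * 2 ^ L) + 1) * 2 ^ (m0 - 2 ^ L) := by
        rcases htL hj with ⟨e1, e2⟩ | ⟨e1, e2⟩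
        · rw [e2, show m - t = 2 * 2 ^ L + (m0 - 2 ^ L) by omega, pow_add, mul_assoc]
          apply Nat.mul_le_mul_left
          apply Nat.mul_le_mul_right
          omega
        · rw [e2, show m - t = m0 - 2 ^ L by omega]
      refine (hX.trans hbd).trans ?_
      rw [hH2]
      have hcL : 2 ^ L + 1 ≤ c := by
        by_contra hcon
        have : c = 2 ^ L := by omega
        have := hLev c hc (by omega)
        omega
      have hCH : 2 * 2 ^ 2 ^ L ≤ 2 ^ c := by
        rw [← pow_succ']; exact Nat.pow_le_pow_right (by norm_num) hcL
      have e5 : 2 ^ (m0 - c) * 2 ^ c = 2 ^ 2 ^ L * 2 ^ (m0 - 2 ^ L) := by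
        rw [← pow_add, ← pow_add]; congr 1; omega
      generalize 2 ^ (m0 - c) = R at *
      generalize 2 ^ c = C at *
      generalize 2 ^ 2 ^ L = H at *
      generalize 2 ^ (m0 - 2 ^ L) = P at *
      clear * - hH16 hCH e5
      obtain ⟨H, rfl⟩ := Nat.exists_eq_add_of_le hH16
      rw [show (16 + H) * (16 + H) - 1 = (15 + H) * (17 + H) by
        have : (16 + H) * (16 + H) = (15 + H) * (17 + H) + 1 := by ring
        omega, show 16 + H - 1 = 15 + H by omega]
      have hR : R * (C - 1) = R * C - R := by rw [Nat.mul_sub, mul_one]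
      have hRle : 2 * R ≤ P := by
        have : R * (2 * (16 + H)) ≤ R * C := Nat.mul_le_mul_left _ hCH
        rw [e5] at this
        apply Nat.le_of_mul_le_mul_right (c := 16 + H) _ (by omega)
        linarith
      have key : ((16 + H) * (16 + H) + 1) * P ≤ R * (C - 1) * (17 + H) := by
        rw [hR, e5]
        have : (15 + H) * P ≤ (16 + H) * P - R := by
          apply Nat.le_sub_of_add_le
          nlinarith
        have h2 : 2 * ((16 + H) * P - R) = 2 * ((16 + H) * P) - 2 * R := by omega
        have h3 : (31 + 2 * H) * P ≤ 2 * ((16 + H) * P - R) := by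
          rw [h2]
          apply Nat.le_sub_of_add_le
          nlinarith
        generalize (16 + H) * P - R = Z at *
        nlinarith
      calc _ = (15 + H) * (((16 + H) * (16 + H) + 1) * P) := by ring
        _ ≤ (15 + H) * (R * (C - 1) * (17 + H)) := Nat.mul_le_mul_left _ key
        _ = _ := by ring
    · obtain ⟨e1, e2⟩ := htL1 hj
      rcases hred' with h | ⟨b, hb, hbm, h⟩
      · omega
      refine h.trans ?_
      rw [e2, mul_comm]
      apply Nat.mul_le_mul_right
      have e3 : m - t = m0 := by omega
      rw [e3] at hbm ⊢
      rw [mul_comm (2 ^ (m0 - c))]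
      apply pw_le _ hc1
      rcases Nat.lt_or_ge c b with hlt | hge
      · exfalso
        have : b = c + 1 := by omega
        rw [this] at hb
        exact absurd hb (Nat.not_odd_iff_even.2 hc.add_one)
      · exact hge

end SpAut
end PartC5

section PartC6
open Matrix
set_option linter.unusedSectionVars false
namespace SpAut

theorem Mm_odd (m q : ℕ) (hq : 4 ≤ q) (hm : Odd m) : Mm m q = PP q m := by
  unfold Mm
  rw [if_neg (by omega), if_pos hm]; rfl

theorem Mm_m2 (q : ℕ) (hq : 4 ≤ q) : Mm 2 q = q ^ 2 + 1 := by
  unfold Mm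
  rw [if_neg (by omega), if_neg (by decide), if_pos rfl]

theorem Mm_even (m q : ℕ) (hq : 4 ≤ q) (hm : Even m) (hm4 : 4 ≤ m) :
    ∃ L, 3 * 2 ^ L ≤ m ∧ m < 6 * 2 ^ L ∧
      Mm m q = (q ^ (m - 2 * 2 ^ L + 1) - 1) * (q ^ (2 * 2 ^ L) - 1) / (q - 1) := by
  obtain ⟨L, hL⟩ : ∃ L, Nat.findGreatest (fun l => 0 < l ∧ 2 ^ l + 2 ^ (l - 1) ≤ m) m = L := ⟨_, rfl⟩
  have h1 := Nat.findGreatest_spec (P := fun l => 0 < l ∧ 2 ^ l + 2 ^ (l - 1) ≤ m) (n := m) (m := 1) (by omega) (by norm_num; omega)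
  rw [hL] at h1
  obtain ⟨L, rfl⟩ : ∃ L', L = L' + 1 := ⟨L - 1, by omega⟩
  have e1 : 2 ^ (L + 1) = 2 * 2 ^ L := by ring
  have e2 : 2 ^ (L + 2) = 4 * 2 ^ L := by ring
  have h2 := h1.2
  rw [Nat.add_sub_cancel, e1] at h2
  refine ⟨L, by omega, ?_, ?_⟩
  · by_contra hc
    have h2 : L + 2 < 2 ^ (L + 2) := Nat.lt_two_pow_self
    have := Nat.findGreatest_is_greatest (P := fun l => 0 < l ∧ 2 ^ l + 2 ^ (l - 1) ≤ m) (n := m) (k := L + 2) (by omega) (by omega)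
    apply this
    refine ⟨by omega, ?_⟩
    rw [show L + 2 - 1 = L + 1 by omega]
    omega
  · unfold Mm
    rw [if_neg (by omega), if_neg (Nat.not_odd_iff_even.2 hm), if_neg (by omega), hL]
    show (q ^ (m - 2 ^ (L + 1) + 1) - 1) * (q ^ 2 ^ (L + 1) - 1) / (q - 1) = _
    rw [e1]

theorem PP_even_lt (q m : ℕ) (hq : 2 ≤ q) (hm : Even m) : PP q m * ((q - 1) * (q + 1)) ≤ q ^ (m + 2) := by
  obtain ⟨s, hs⟩ := hm
  have hs' : m = 2 * s := by omega
  subst hs'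
  have h := PP_lt (q ^ 2) s (by nlinarith)
  rw [PP_even]
  have : q ^ 2 - 1 = (q - 1) * (q + 1) := by
    rw [mul_comm]; simpa using Nat.sq_sub_sq q 1
  rw [this, ← pow_mul] at h
  have e : 2 * (s + 1) = 2 * s + 2 := by ring
  rw [e] at h
  omega

theorem even_aux {q X Y : ℕ} (hq : 4 ≤ q) (hX : q * q ≤ X) (hY : q * q ≤ Y) :
    q * q * (X * Y) ≤ (q + 1) * ((q * X - 1) * (Y - 1)) := by
  have hX1 : 1 ≤ q * X := by nlinarith
  have hY1 : 1 ≤ Y := by nlinarith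
  have e : (q * X - 1) * (Y - 1) + (q * X + Y) = q * X * Y + 1 := by
    obtain ⟨A, hA⟩ := Nat.exists_eq_add_of_le hX1
    obtain ⟨B, hB⟩ := Nat.exists_eq_add_of_le hY1
    rw [hA, hB]; simp; ring
  generalize (q * X - 1) * (Y - 1) = Z at *
  have h1 : 2 * (q + 1) ≤ Y := by nlinarith
  have h2 : 2 * (q + 1) ≤ q * X := by nlinarith
  have h3 : q * X * (2 * (q + 1)) ≤ q * X * Y := Nat.mul_le_mul_left _ h1
  have h4 : Y * (2 * (q + 1)) ≤ Y * (q * X) := Nat.mul_le_mul_left _ h2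
  have h5 : (q + 1) * Z + (q + 1) * (q * X + Y) = (q + 1) * (q * X * Y + 1) := by rw [← mul_add, e]
  nlinarith

theorem even_aux2 {Q X Y : ℕ} (hQ : 16 ≤ Q) (hX : 4 * Q ≤ X) (hY : Q * Q ≤ Y) :
    X * Y * Q ≤ (Q + 1) * ((X - 1) * (Y - 1)) := by
  have hX1 : 1 ≤ X := by nlinarith
  have hY1 : 1 ≤ Y := by nlinarith
  have e : (X - 1) * (Y - 1) + (X + Y) = X * Y + 1 := by
    obtain ⟨A, hA⟩ := Nat.exists_eq_add_of_le hX1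
    obtain ⟨B, hB⟩ := Nat.exists_eq_add_of_le hY1
    rw [hA, hB]; simp; ring
  generalize (X - 1) * (Y - 1) = Z at *
  have h1 : 2 * (Q + 1) ≤ Y := by nlinarith
  have h2 : 2 * (Q + 1) ≤ X := by nlinarith
  have h3 : X * (2 * (Q + 1)) ≤ X * Y := Nat.mul_le_mul_left _ h1
  have h4 : Y * (2 * (Q + 1)) ≤ Y * X := Nat.mul_le_mul_left _ h2
  have h5 : (Q + 1) * Z + (Q + 1) * (X + Y) = (Q + 1) * (X * Y + 1) := by rw [← mul_add, e]
  nlinarith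

theorem even_main (m q : ℕ) (hq : 4 ≤ q) (hm : Even m) (hm4 : 4 ≤ m) :
    PP q m ≤ Mm m q ∧ ∀ t a, Odd a → t + a = m → PP q t * (q ^ a - 1) ≤ Mm m q := by
  obtain ⟨L, h1, h2, h3⟩ := Mm_even m q hq hm hm4
  have hh : 1 ≤ 2 ^ L := Nat.one_le_two_pow
  have hc : 2 ≤ m - 2 * 2 ^ L := by
    obtain ⟨s, hs⟩ := hm
    omega
  have hq0 : 0 < q := by omega
  have hsplit : q ^ (m + 1) = q ^ (m - 2 * 2 ^ L + 1) * q ^ (2 * 2 ^ L) := by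
    rw [← pow_add]; congr 1; omega
  have hX : q * q ≤ q ^ (m - 2 * 2 ^ L) := by
    rw [← pow_two]; exact Nat.pow_le_pow_right hq0 hc
  have hY : q * q ≤ q ^ (2 * 2 ^ L) := by
    rw [← pow_two]; exact Nat.pow_le_pow_right hq0 (by omega)
  constructor
  · rw [h3, Nat.le_div_iff_mul_le (by omega)]
    have h4 := PP_even_lt q m (by omega) hm
    apply Nat.le_of_mul_le_mul_left (c := q + 1) _ (by omega)
    have h5 := even_aux hq hX hY
    rw [pow_succ' q (m - 2 * 2 ^ L)]
    refine le_trans ?_ h5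
    calc _ = PP q m * ((q - 1) * (q + 1)) := by ring
      _ ≤ _ := h4
      _ = q * q ^ (m + 1) := by ring
      _ = _ := by rw [hsplit]; ring
  · intro t a ha hta
    rw [h3, Nat.le_div_iff_mul_le (by omega)]
    have ha1 := ha.pos
    have hto : Odd t := by
      by_contra hcon
      rw [Nat.not_odd_iff_even] at hcon
      have := hcon.add_odd ha
      rw [hta] at this
      exact absurd hm (Nat.not_even_iff_odd.2 this)
    obtain ⟨j, k, hjk⟩ := low_zero t
    have hQ := PPQ q j k (by omega)
    have hPP := PP_jk q j k (by omega)
    rw [← hjk] at hQ hPP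
    have hj1 : 1 ≤ j := by
      by_contra hcon
      have : j = 0 := by omega
      subst this
      obtain ⟨s, hs⟩ := hto
      omega
    have hcases : j ≤ L ∨ j = L + 1 ∨ j = L + 2 ∨ L + 3 ≤ j := by omega
    rcases hcases with hj | hj | hj | hj
    · have hQ16 : 16 ≤ q ^ 2 ^ j := by
        have : 2 ≤ 2 ^ j := Nat.le_self_pow (by omega) _
        calc 16 = 4 ^ 2 := by norm_num
          _ ≤ q ^ 2 := Nat.pow_le_pow_left hq 2
          _ ≤ _ := Nat.pow_le_pow_right hq0 this
      have hjL : 2 ^ j ≤ 2 ^ L := Nat.pow_le_pow_right (by norm_num) hj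
      have hXQ : 4 * q ^ 2 ^ j ≤ q ^ (m - 2 * 2 ^ L + 1) := by
        rw [pow_succ']
        apply Nat.mul_le_mul hq
        exact Nat.pow_le_pow_right hq0 (by omega)
      have hYQ : q ^ 2 ^ j * q ^ 2 ^ j ≤ q ^ (2 * 2 ^ L) := by
        rw [← pow_add]
        exact Nat.pow_le_pow_right hq0 (by omega)
      have h5 := even_aux2 hQ16 hXQ hYQ
      apply Nat.le_of_mul_le_mul_left (c := q ^ 2 ^ j + 1) _ (by omega)
      refine le_trans ?_ h5
      rw [← hsplit]
      calc _ ≤ (q ^ 2 ^ j + 1) * (PP q t * q ^ a * (q - 1)) := by gcongr; omega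
        _ = PP q t * (q - 1) * (q ^ 2 ^ j + 1) * q ^ a := by ring
        _ ≤ q ^ (t + 1) * q ^ 2 ^ j * q ^ a := Nat.mul_le_mul_right _ hQ
        _ = q ^ (t + 1 + a) * q ^ 2 ^ j := by rw [pow_add]; ring
        _ = _ := by rw [show t + 1 + a = m + 1 by omega]
    · subst hj
      have e1 : 2 ^ (L + 1) = 2 * 2 ^ L := by ring
      have e2 : 2 ^ (L + 1 + 1) = 4 * 2 ^ L := by ring
      rw [e1] at hjk hPP
      have hk : k = 0 := by
        by_contra hk
        have : 2 ^ (L + 1 + 1) * 1 ≤ 2 ^ (L + 1 + 1) * k := Nat.mul_le_mul_left _ (by omega)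
        omega
      rw [hk, PP_zero, mul_one] at hPP
      have ea : a = m - 2 * 2 ^ L + 1 := by
        rw [hk] at hjk; omega
      rw [← ea, mul_right_comm, hPP, mul_comm]
    · subst hj
      have e1 : 2 ^ (L + 2) = 4 * 2 ^ L := by ring
      have e2 : 2 ^ (L + 2 + 1) = 8 * 2 ^ L := by ring
      rw [e1] at hjk hPP
      have hk : k = 0 := by
        by_contra hk
        have : 2 ^ (L + 2 + 1) * 1 ≤ 2 ^ (L + 2 + 1) * k := Nat.mul_le_mul_left _ (by omega)
        omega
      rw [hk, PP_zero, mul_one] at hPP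
      have ea : a + 2 * 2 ^ L = m - 2 * 2 ^ L + 1 := by
        rw [hk] at hjk; omega
      rw [← ea, mul_right_comm, hPP]
      have ea2 : q ^ a ≤ q ^ (2 * 2 ^ L) := Nat.pow_le_pow_right hq0 (by omega)
      have ea1 : 1 ≤ q ^ a := Nat.one_le_pow _ _ hq0
      rw [show 4 * 2 ^ L = 2 * 2 ^ L + 2 * 2 ^ L by ring, pow_add, pow_add]
      generalize q ^ a = A at *
      generalize q ^ (2 * 2 ^ L) = Y at *
      clear * - ea2 ea1
      obtain ⟨A, rfl⟩ := Nat.exists_eq_add_of_le ea1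
      obtain ⟨Y, rfl⟩ := Nat.exists_eq_add_of_le ea2
      have f1 : (1 + A + Y) * (1 + A + Y) - 1 = (A + Y) * (2 + A + Y) := by
        have : (1 + A + Y) * (1 + A + Y) = (A + Y) * (2 + A + Y) + 1 := by ring
        omega
      have f2 : (1 + A) * (1 + A + Y) - 1 = A * (2 + A + Y) + Y := by
        have : (1 + A) * (1 + A + Y) = A * (2 + A + Y) + Y + 1 := by ring
        omega
      rw [f1, f2, show 1 + A - 1 = A by omega, show 1 + A + Y - 1 = A + Y by omega]
      nlinarith [Nat.zero_le (Y * (A + Y))]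
    · exfalso
      have : 2 ^ (L + 3) ≤ 2 ^ j := Nat.pow_le_pow_right (by norm_num) hj
      have e : 2 ^ (L + 3) = 8 * 2 ^ L := by ring
      omega

theorem q_main (m q : ℕ) (hq : 4 ≤ q) (hm : 1 ≤ m) :
    PP q m ≤ Mm m q ∧ ∀ t a, Odd a → t + a = m → PP q t * (q ^ a - 1) ≤ Mm m q := by
  rcases Nat.even_or_odd m with he | ho
  · by_cases h2 : m = 2
    · subst h2
      rw [Mm_m2 q hq]
      have e2 : PP q 2 = q ^ 2 + 1 := by
        have := PP_even q 1
        rwa [PP_one] at this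
      refine ⟨e2.le, ?_⟩
      intro t a ha hta
      have : a = 1 := by
        obtain ⟨s, hs⟩ := ha
        omega
      subst this
      have : t = 1 := by omega
      subst this
      rw [PP_one, pow_one]
      have : q - 1 ≤ q := by omega
      nlinarith [Nat.sq_sub_sq q 1, Nat.sub_le (q^2) (1^2)]
    · apply even_main m q hq he
      obtain ⟨s, hs⟩ := he
      omega
  · rw [Mm_odd m q hq ho]
    refine ⟨le_rfl, ?_⟩
    intro t a ha hta
    have hte : Even t := by
      by_contra hcon
      rw [Nat.not_even_iff_odd] at hcon
      have := hcon.add_odd ha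
      rw [hta] at this
      exact absurd this (Nat.not_even_iff_odd.2 ho)
    have h1 := PP_even_lt q t (by omega) hte
    obtain ⟨s, hs⟩ := ho
    have h2 : (q + 1) * q ^ (2 * s) ≤ PP q m := by
      rw [hs, PP_odd, pow_mul]
      exact Nat.mul_le_mul_left _ (PP_ge _ _ (by nlinarith))
    refine le_trans ?_ h2
    apply Nat.le_of_mul_le_mul_right (c := (q - 1) * (q + 1)) _ (Nat.mul_pos (by omega) (by omega))
    calc _ ≤ PP q t * q ^ a * ((q - 1) * (q + 1)) := by gcongr; omega
      _ = PP q t * ((q - 1) * (q + 1)) * q ^ a := by ring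
      _ ≤ q ^ (t + 2) * q ^ a := Nat.mul_le_mul_right _ h1
      _ = q ^ (2 * s + 3) := by rw [← pow_add]; congr 1; omega
      _ = q ^ (2 * s) * q ^ 3 := by rw [pow_add]
      _ ≤ q ^ (2 * s) * ((q + 1) * ((q - 1) * (q + 1))) := by
        apply Nat.mul_le_mul_left
        obtain ⟨r, rfl⟩ := Nat.exists_eq_add_of_le hq
        rw [show 4 + r - 1 = 3 + r by omega]
        nlinarith [Nat.zero_le (r*r), Nat.zero_le (r*r*r)]
      _ = _ := by ring

theorem pow_le_Mm (m q : ℕ) (hq : 4 ≤ q) (hm : 1 ≤ m) : q ^ m ≤ Mm m q :=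
  (PP_ge q m (by omega)).trans (q_main m q hq hm).1

theorem q_red (q t a m : ℕ) (hq : 4 ≤ q) (hm : 1 ≤ m) (A : List ℕ) (hA : ∀ a ∈ A, Odd a) (h : t + A.sum + uc a ≤ m) :
    PP q t * lcmA q A * 2 ^ a ≤ Mm m q := by
  have hqm := pow_le_Mm m q hq hm
  have h1 := PP_le_two q t (by omega)
  have h2 := lcmA_le q (by omega) A
  rcases Nat.eq_zero_or_pos a with ha | ha
  · subst ha
    rw [show uc 0 = 0 from rfl, add_zero] at h
    rw [pow_zero, mul_one]
    by_cases hs : t + A.sum < m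
    · refine le_trans ?_ hqm
      calc _ ≤ 2 * q ^ t * q ^ A.sum := by gcongr
        _ ≤ q * q ^ t * q ^ A.sum := by gcongr; omega
        _ = q ^ (1 + t + A.sum) := by rw [pow_add, pow_add, pow_one]
        _ ≤ _ := Nat.pow_le_pow_right (by omega) (by omega)
    have hs' : t + A.sum = m := by omega
    rcases A with _ | ⟨a1, _ | ⟨a2, A⟩⟩
    · rw [lcmA_nil, mul_one]
      simp at hs'
      subst hs'
      exact (q_main _ q hq hm).1
    · rw [lcmA_cons, lcmA_nil, Nat.lcm_one_right]
      simp at hs'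
      exact (q_main _ q hq hm).2 t a1 (hA a1 List.mem_cons_self) hs'
    · refine le_trans ?_ hqm
      have o1 := (hA a1 List.mem_cons_self).pos
      have o2 := (hA a2 (List.mem_cons_of_mem _ List.mem_cons_self)).pos
      have hp := lcmA_pos q (by omega) A (fun x hx => hA x (List.mem_cons_of_mem _ (List.mem_cons_of_mem _ hx)))
      have hl := lcmA_le q (by omega) A
      rw [lcmA_cons, lcmA_cons, ← Nat.lcm_assoc]
      have p1 : q ≤ q ^ a1 := Nat.le_self_pow (by omega) _
      have p2 : q ≤ q ^ a2 := Nat.le_self_pow (by omega) _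
      have g1 : q - 1 ∣ q ^ a1 - 1 := Nat.sub_one_dvd_pow_sub_one _ _
      have g2 : q - 1 ∣ q ^ a2 - 1 := Nat.sub_one_dvd_pow_sub_one _ _
      have g3 : q - 1 ≤ Nat.gcd (q ^ a1 - 1) (q ^ a2 - 1) :=
        Nat.le_of_dvd (Nat.gcd_pos_of_pos_left _ (by omega)) (Nat.dvd_gcd g1 g2)
      have g4 := Nat.gcd_mul_lcm (q ^ a1 - 1) (q ^ a2 - 1)
      have g5 : Nat.lcm (Nat.lcm (q ^ a1 - 1) (q ^ a2 - 1)) (lcmA q A) ≤ Nat.lcm (q ^ a1 - 1) (q ^ a2 - 1) * q ^ A.sum := by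
        refine (Nat.le_of_dvd ?_ (Nat.lcm_dvd_mul _ _)).trans (Nat.mul_le_mul_left _ hl)
        exact Nat.mul_pos (Nat.lcm_pos (by omega) (by omega)) hp
      have g6 : (q - 1) * Nat.lcm (q ^ a1 - 1) (q ^ a2 - 1) ≤ q ^ a1 * q ^ a2 := by
        refine (Nat.mul_le_mul_right _ g3).trans ?_
        rw [g4]
        exact Nat.mul_le_mul (by omega) (by omega)
      have g7 := PP_lt q t (by omega)
      generalize Nat.lcm (q ^ a1 - 1) (q ^ a2 - 1) = M at *
      apply Nat.le_of_mul_le_mul_left (c := (q - 1) * (q - 1)) _ (Nat.mul_pos (by omega) (by omega))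
      calc _ ≤ (q - 1) * (q - 1) * (PP q t * (M * q ^ A.sum)) := by gcongr
        _ = (PP q t * (q - 1)) * ((q - 1) * M) * q ^ A.sum := by ring
        _ ≤ q ^ (t + 1) * (q ^ a1 * q ^ a2) * q ^ A.sum := by gcongr; omega
        _ = q * q ^ (t + (a1 + (a2 + A.sum))) := by rw [pow_add, pow_add, pow_add, pow_add]; ring
        _ = q * q ^ m := by rw [← hs']; simp
        _ ≤ _ := by
          apply Nat.mul_le_mul_right
          obtain ⟨r, rfl⟩ := Nat.exists_eq_add_of_le hq
          rw [show 4 + r - 1 = 3 + r by omega]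
          nlinarith
  · refine le_trans ?_ hqm
    have h3 : 2 * 2 ^ a ≤ q ^ uc a := by
      have := uc_ge a
      calc 2 * 2 ^ a = 2 ^ (a + 1) := by ring
        _ ≤ 2 ^ (2 * uc a) := Nat.pow_le_pow_right (by norm_num) (by omega)
        _ = 4 ^ uc a := by rw [pow_mul]; norm_num
        _ ≤ _ := Nat.pow_le_pow_left hq _
    calc _ ≤ 2 * q ^ t * q ^ A.sum * 2 ^ a := by gcongr
      _ = q ^ t * q ^ A.sum * (2 * 2 ^ a) := by ring
      _ ≤ q ^ t * q ^ A.sum * q ^ uc a := by gcongr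
      _ = q ^ (t + A.sum + uc a) := by rw [pow_add, pow_add]
      _ ≤ _ := Nat.pow_le_pow_right (by omega) h

/-- main combinatorial bound -/
theorem comb_bound (q m a : ℕ) (l : List (ℕ × Bool)) (hm : 1 ≤ m) (hq : q = 2 ∨ (4 ≤ q ∧ Even q))
    (hl : ∀ x ∈ l, 1 ≤ x.1) (h : sumL l + uc a ≤ m) : lcmL q l * 2 ^ a ≤ Mm m q ∧ lcmL q l * 2 ^ a ≤ 2 * q ^ m := by
  have hq2 : 2 ≤ q := by omega
  have he : Even q := by
    rcases hq with rfl | h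
    · exact even_two
    · exact h.2
  obtain ⟨t, A, hA, h1, h2⟩ := lcmL_bound hq2 he l hl
  have h3 : lcmL q l * 2 ^ a ≤ PP q t * lcmA q A * 2 ^ a := Nat.mul_le_mul_right _ h1
  constructor
  · refine h3.trans ?_
    rcases hq with rfl | hq
    · exact two_main t m _ hm (by omega) (two_red t a m A hA (by omega))
    · exact q_red q t a m hq.1 hm A hA (by omega)
  · exact h3.trans (crude q t a m A hq2 (by omega))

end SpAut
end PartC6

section PartU1
open Matrix
set_option linter.unusedSectionVars false
namespace SpAut

/-- the claimed value -/
def NN (m q : ℕ) : ℕ := if m = 1 ∧ q = 4 then 6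
      else if m = 2 ∧ q = 2 then 10
      else if m = 2 ∧ q = 4 then 20
      else Mm m q

theorem Mm_one_two : Mm 1 2 = 3 := by decide
theorem Mm_two_two : Mm 2 2 = 6 := by decide

theorem Mm_le_NN (m q : ℕ) : Mm m q ≤ NN m q := by
  unfold NN
  split_ifs with h1 h2 h3
  · obtain ⟨rfl, rfl⟩ := h1
    rw [Mm_odd 1 4 le_rfl (by decide), PP_one]; norm_num
  · obtain ⟨rfl, rfl⟩ := h2
    rw [Mm_two_two]; norm_num
  · obtain ⟨rfl, rfl⟩ := h3
    rw [Mm_m2 4 le_rfl]; norm_num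
  · exact le_rfl

theorem four_pow_ge (e : ℕ) (he : 2 ≤ e) : 2 * e ≤ 4 ^ (e - 1) := by
  induction e, he using Nat.le_induction with
  | base => norm_num
  | succ n hn ih =>
    obtain ⟨k, rfl⟩ : ∃ k, n = k + 1 := ⟨n - 1, by omega⟩
    simp only [Nat.add_sub_cancel] at *
    rw [pow_succ]; omega

theorem two_pow_ge (e : ℕ) (he : 4 ≤ e) : 2 * e ≤ 2 ^ (e - 1) := by
  induction e, he using Nat.le_induction with
  | base => norm_num
  | succ n hn ih =>
    obtain ⟨k, rfl⟩ : ∃ k, n = k + 1 := ⟨n - 1, by omega⟩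
    simp only [Nat.add_sub_cancel] at *
    rw [pow_succ]; omega

theorem q0_cases {q0 e f : ℕ} (hf : 1 ≤ f) (h : q0 ^ e = 2 ^ f) (he : 1 ≤ e) : ∃ s, 1 ≤ s ∧ q0 = 2 ^ s := by
  have h1 : q0 ∣ 2 ^ f := h ▸ dvd_pow_self _ (by omega)
  obtain ⟨s, _, hs⟩ := (Nat.dvd_prime_pow Nat.prime_two).1 h1
  refine ⟨s, ?_, hs⟩
  rcases Nat.eq_zero_or_pos s with h0 | h0
  · subst h0
    rw [hs] at h
    simp at h
    have := Nat.one_lt_two_pow (n := f) (by omega)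
    omega
  · exact h0

theorem pow_cases {q s : ℕ} (hs : 1 ≤ s) (h : q = 2 ^ s) : q = 2 ∨ (4 ≤ q ∧ Even q) := by
  rcases Nat.lt_or_ge s 2 with h1 | h1
  · have : s = 1 := by omega
    subst this; left; simpa using h
  · right
    rw [h]
    exact ⟨(show 4 = 2 ^ 2 by norm_num) ▸ Nat.pow_le_pow_right (by norm_num) h1, even_two.pow_of_ne_zero (by omega)⟩

theorem arith_semi (f q m q0 e a : ℕ) (l : List (ℕ × Bool)) (hf : 1 ≤ f) (hq : q = 2 ^ f) (hm : 1 ≤ m)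
    (he : 1 ≤ e) (h0 : q0 ^ e = q) (hl : ∀ x ∈ l, 1 ≤ x.1) (hs : sumL l + uc a ≤ m) :
    e * (lcmL q0 l * 2 ^ a) ≤ NN m q := by
  obtain ⟨s, hs1, hq0⟩ := q0_cases hf (h0.trans hq) he
  obtain ⟨b1, b2⟩ := comb_bound q0 m a l hm (pow_cases hs1 hq0) hl hs
  rcases Nat.lt_or_ge e 2 with he2 | he2
  · have : e = 1 := by omega
    subst this
    rw [pow_one] at h0
    subst h0
    rw [one_mul]
    exact b1.trans (Mm_le_NN _ _)
  by_cases hc : m = 1 ∧ q0 = 2 ∧ e < 4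
  · obtain ⟨rfl, rfl, h4⟩ := hc
    rw [Mm_one_two] at b1
    have : e = 2 ∨ e = 3 := by omega
    rcases this with rfl | rfl
    · rw [← h0]; simp [NN]; omega
    · rw [← h0]; simp only [NN]; rw [Mm_odd 1 _ (by norm_num) (by decide), PP_one]
      norm_num; omega
  · have h22 : 2 ≤ q0 := by rw [hq0]; exact Nat.le_self_pow (by omega) _
    have hq4 : 4 ≤ q := by
      rw [← h0]
      calc 4 = 2 ^ 2 := by norm_num
        _ ≤ q0 ^ 2 := Nat.pow_le_pow_left h22 _
        _ ≤ _ := Nat.pow_le_pow_right (by omega) he2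
    refine le_trans ?_ ((pow_le_Mm m q hq4 hm).trans (Mm_le_NN _ _))
    have key : 2 * e ≤ (q0 ^ m) ^ (e - 1) := by
      by_cases h4 : 4 ≤ q0 ^ m
      · exact (four_pow_ge e he2).trans (Nat.pow_le_pow_left h4 _)
      · have h6 : q0 ≤ q0 ^ m := Nat.le_self_pow (by omega) _
        have hm1 : m = 1 := by
          by_contra hm1
          have : q0 ^ 2 ≤ q0 ^ m := Nat.pow_le_pow_right (by omega) (by omega)
          nlinarith
        have h7 : q0 = 2 := by
          rcases pow_cases hs1 hq0 with h | h
          · exact h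
          · omega
        subst hm1 h7
        rw [pow_one]
        exact two_pow_ge e (by omega)
    calc e * (lcmL q0 l * 2 ^ a) ≤ e * (2 * q0 ^ m) := Nat.mul_le_mul_left _ b2
      _ = 2 * e * q0 ^ m := by ring
      _ ≤ (q0 ^ m) ^ (e - 1) * q0 ^ m := Nat.mul_le_mul_right _ key
      _ = q ^ m := by
        rw [← pow_succ, show e - 1 + 1 = e by omega, ← h0, ← pow_mul, ← pow_mul, mul_comm]

end SpAut
end PartU1

section PartD3
open Matrix
set_option linter.unusedSectionVars false
namespace SpAut

section
variable {K : Type*} [Field K]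

theorem sum_prod_cases {x y u v : K} (h1 : x + y = u + v) (h2 : x * y = u * v) : (x = u ∧ y = v) ∨ (x = v ∧ y = u) := by
  have : (x - u) * (x - v) = 0 := by linear_combination x * h1 - h2
  rcases mul_eq_zero.1 this with h | h
  · left; have := sub_eq_zero.1 h; subst this; exact ⟨rfl, by linear_combination h1⟩
  · right; have := sub_eq_zero.1 h; subst this; exact ⟨rfl, by linear_combination h1⟩

theorem inv_sum_cases {x a : K} (hx : x ≠ 0) (ha : a ≠ 0) (h : x + x⁻¹ = a + a⁻¹) :
    ∃ ε : ℤ, (ε = 1 ∨ ε = -1) ∧ x = a ^ ε := by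
  rcases sum_prod_cases h (by rw [mul_inv_cancel₀ hx, mul_inv_cancel₀ ha]) with h | h
  · exact ⟨1, Or.inl rfl, by simpa using h.1⟩
  · exact ⟨-1, Or.inr rfl, by simpa using h.1⟩

theorem zcalc {a b : K} (ha : a ≠ 0) (hb : b ≠ 0) (Q : ℕ) (hQ : 1 ≤ Q) (ε δ : ℤ) (he : ε = 1 ∨ ε = -1) (hd : δ = 1 ∨ δ = -1)
    (h1 : (a * b) ^ Q = a ^ ε) (h2 : (a * b⁻¹) ^ Q = b ^ δ) :
    ∃ n, 0 < n ∧ n ≤ 2 * Q ^ 2 + 2 * Q + 1 ∧ a ^ n = 1 ∧ b ^ n = 1 := by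
  have hdd : δ * δ = 1 := by rcases hd with rfl | rfl <;> norm_num
  have h3 : b ^ (Q : ℤ) = a ^ (ε - Q) := by
    rw [zpow_sub₀ ha, ← h1, mul_pow, zpow_natCast, zpow_natCast]; field_simp
  have h4 : b = a ^ ((ε - 2 * Q) * (-δ)) := by
    have : b ^ δ = a ^ (2 * Q - ε) := by
      rw [← h2, zpow_sub₀ ha, ← h1, mul_comm (2:ℤ), _root_.zpow_mul, zpow_natCast, mul_pow, mul_pow, inv_pow]
      have := pow_ne_zero Q hb
      have := pow_ne_zero Q ha
      field_simp

    calc b = b ^ (δ * δ) := by rw [hdd, zpow_one]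
      _ = _ := by rw [_root_.zpow_mul, this, ← _root_.zpow_mul]; congr 1; ring
  have h5 : a ^ (((ε - 2 * Q) * (-δ)) * Q - (ε - Q)) = 1 := by
    rw [zpow_sub₀ ha, ← h3, _root_.zpow_mul, ← h4]
    exact div_self (zpow_ne_zero _ hb)
  have h6 : a ^ (2 * (Q:ℤ) ^ 2 + (δ - ε) * Q - ε * δ) = 1 := by
    have : 2 * (Q:ℤ) ^ 2 + (δ - ε) * Q - ε * δ = (((ε - 2 * Q) * (-δ)) * Q - (ε - Q)) * δ := by
      linear_combination (- 2 * (Q:ℤ)^2 + ε * Q) * hdd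
    rw [this, _root_.zpow_mul, h5, _root_.one_zpow]
  have hQ' : (1 : ℤ) ≤ Q := by exact_mod_cast hQ
  obtain ⟨n, hn⟩ : ∃ n : ℕ, (n : ℤ) = 2 * (Q:ℤ) ^ 2 + (δ - ε) * Q - ε * δ := by
    refine Int.eq_ofNat_of_zero_le ?_ |>.imp fun _ h => h.symm
    rcases he with rfl | rfl <;> rcases hd with rfl | rfl <;> nlinarith
  have h7 : a ^ n = 1 := by rw [← zpow_natCast, hn, h6]
  refine ⟨n, ?_, ?_, h7, ?_⟩
  · zify
    rw [hn]
    rcases he with rfl | rfl <;> rcases hd with rfl | rfl <;> nlinarith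
  · zify
    rw [hn]
    rcases he with rfl | rfl <;> rcases hd with rfl | rfl <;> nlinarith
  · rw [h4, ← zpow_natCast, ← _root_.zpow_mul, mul_comm, _root_.zpow_mul, zpow_natCast, h7, _root_.one_zpow]

theorem roots_pow [CharP K 2] {a b : K} (ha : a ≠ 0) (hb : b ≠ 0) (j : ℕ)
    (h1 : ((a + a⁻¹) * (b + b⁻¹)) ^ 2 ^ j = (a + a⁻¹) + (b + b⁻¹))
    (h2 : ((a + a⁻¹) + (b + b⁻¹)) ^ (2 * 2 ^ j) = (a + a⁻¹) * (b + b⁻¹)) :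
    ∃ n, 0 < n ∧ n ≤ 2 * (2 ^ j) ^ 2 + 2 * 2 ^ j + 1 ∧ a ^ n = 1 ∧ b ^ n = 1 := by
  have hp : ∀ x y : K, (x + y) ^ 2 ^ j = x ^ 2 ^ j + y ^ 2 ^ j := fun x y => add_pow_char_pow x y 2 j
  set c := (a * b) ^ 2 ^ j with hc
  set d := (a * b⁻¹) ^ 2 ^ j with hd
  have hc0 : c ≠ 0 := pow_ne_zero _ (mul_ne_zero ha hb)
  have hd0 : d ≠ 0 := pow_ne_zero _ (mul_ne_zero ha (inv_ne_zero hb))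
  have e1 : (c + c⁻¹) + (d + d⁻¹) = (a + a⁻¹) + (b + b⁻¹) := by
    rw [← h1, hc, hd, ← inv_pow, ← inv_pow, ← hp, ← hp, ← hp]
    congr 1
    field_simp; ring
  have t2 : (2 : K) = 0 := CharTwo.two_eq_zero
  have e2 : (c + c⁻¹) * (d + d⁻¹) = (a + a⁻¹) * (b + b⁻¹) := by
    rw [← h2, hc, hd, ← inv_pow, ← inv_pow, ← hp, ← hp, pow_mul, ← mul_pow]
    congr 1
    field_simp
    linear_combination (-(a*b+a*b^3+2*a^2*b^2+a^3*b+a^3*b^3)) * t2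
  rcases sum_prod_cases e1 e2 with ⟨h3, h4⟩ | ⟨h3, h4⟩
  · obtain ⟨ε, he, h5⟩ := inv_sum_cases hc0 ha h3
    obtain ⟨δ, hd, h6⟩ := inv_sum_cases hd0 hb h4
    exact zcalc ha hb (2 ^ j) Nat.one_le_two_pow ε δ he hd h5 h6
  · obtain ⟨ε, he, h5⟩ := inv_sum_cases hc0 hb h3
    obtain ⟨δ, hd', h6⟩ := inv_sum_cases (x := d⁻¹) (inv_ne_zero hd0) ha (by rw [inv_inv, add_comm, h4])
    obtain ⟨n, q1, q2, q3, q4⟩ := zcalc hb ha (2 ^ j) Nat.one_le_two_pow ε δ he hd' (by rw [mul_comm]; exact h5)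
      (by rw [← h6, hd, ← inv_pow, mul_inv, inv_inv, mul_comm])
    exact ⟨n, q1, q2, q4, q3⟩
end
end SpAut
end PartD3

section PartD4
open Matrix
set_option linter.unusedSectionVars false
namespace SpAut

section graphbound
open Polynomial
variable {F : Type} [Field F] [CharP F 2] [Fintype F]

theorem exists_rootq {K : Type*} [Field K] [IsAlgClosed K] (T P : K) : ∃ u, u ^ 2 + T * u + P = 0 := by
  obtain ⟨u, hu⟩ := IsAlgClosed.exists_root (X ^ 2 + C T * X + C P) (by
    have : (X ^ 2 + C T * X + C P : K[X]).degree = 2 := by compute_degree!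
    rw [this]; norm_num)
  exact ⟨u, by simpa using hu⟩

theorem exists_ainv {K : Type*} [Field K] [CharP K 2] [IsAlgClosed K] (u : K) : ∃ a : K, a ≠ 0 ∧ a + a⁻¹ = u := by
  obtain ⟨a, ha⟩ := exists_rootq u 1
  have h0 : a ≠ 0 := by rintro rfl; simp at ha
  refine ⟨a, h0, ?_⟩
  have t2 : (2 : K) = 0 := CharTwo.two_eq_zero
  field_simp
  linear_combination ha - a * u * t2

theorem pow_of_dvd {m : ℕ} (h : GG m F) (n : ℕ) (hd : h.1.charpoly ∣ X ^ n - 1) : h ^ n = 1 := by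
  obtain ⟨r, hr⟩ := hd
  have h1 := congrArg (aeval h.1) hr
  rw [map_mul, Matrix.aeval_self_charpoly, zero_mul, map_sub, map_pow, map_one, aeval_X, sub_eq_zero] at h1
  exact Subtype.ext (by simpa using h1)

theorem lin_dvd {K : Type*} [Field K] {a : K} {n : ℕ} (h : a ^ n = 1) : (X - C a) ∣ (X ^ n - 1 : K[X]) := by
  rw [dvd_iff_isRoot]; simp [h]

theorem cop {K : Type*} [Field K] {a b : K} (h : a ≠ b) : IsCoprime (X - C a) (X - C b) :=
  isCoprime_X_sub_C_of_isUnit_sub (sub_ne_zero.2 h).isUnit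

theorem graph_pow (h : GG 2 F) (j : ℕ) (hT : Pc h.1 ^ 2 ^ j = h.1.trace) (hP : h.1.trace ^ (2 * 2 ^ j) = Pc h.1)
    (h0 : h.1.trace ≠ 0) : ∃ n, 0 < n ∧ n ≤ 2 * (2 ^ j) ^ 2 + 2 * 2 ^ j + 1 ∧ h ^ n = 1 := by
  have hc := charpoly_gg h
  set T := h.1.trace
  set P := Pc h.1
  let K := AlgebraicClosure F
  haveI : CharP K 2 := charP_of_injective_algebraMap (algebraMap F K).injective 2
  have t2 : (2 : K) = 0 := CharTwo.two_eq_zero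
  set i := algebraMap F K
  obtain ⟨u, hu⟩ := exists_rootq (i T) (i P)
  obtain ⟨a, ha, hau⟩ := exists_ainv u
  obtain ⟨b, hb, hbv⟩ := exists_ainv (u + i T)
  have hs : (a + a⁻¹) + (b + b⁻¹) = i T := by rw [hau, hbv]; linear_combination u * t2
  have hp : (a + a⁻¹) * (b + b⁻¹) = i P := by rw [hau, hbv]; linear_combination hu - i P * t2
  obtain ⟨n, hn, hn', han, hbn⟩ := roots_pow ha hb j (by rw [hs, hp, ← map_pow, hT]) (by rw [hs, hp, ← map_pow, hP])
  have hT0 : i T ≠ 0 := by simpa using h0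
  have hP0 : i P ≠ 0 := by rw [← hP, map_pow]; exact pow_ne_zero _ hT0
  have ha' : a ≠ a⁻¹ := by
    intro h; apply hP0; rw [← hp, ← h]; linear_combination a * (b + b⁻¹) * t2
  have hb' : b ≠ b⁻¹ := by
    intro h; apply hP0; rw [← hp, ← h]; linear_combination b * (a + a⁻¹) * t2
  have hab : a ≠ b := by
    intro h; apply hT0; rw [← hs, h]; linear_combination (b + b⁻¹) * t2
  have hab' : a ≠ b⁻¹ := by
    intro h; apply hT0; rw [← hs, h, inv_inv]; linear_combination (b + b⁻¹) * t2
  have hab2 : a⁻¹ ≠ b := fun h => hab' (by rw [← h, inv_inv])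
  have hab3 : a⁻¹ ≠ b⁻¹ := fun h => hab (inv_injective h)
  have han' : a⁻¹ ^ n = 1 := by rw [inv_pow, han, inv_one]
  have hbn' : b⁻¹ ^ n = 1 := by rw [inv_pow, hbn, inv_one]
  refine ⟨n, hn, hn', pow_of_dvd h n ?_⟩
  rw [← Polynomial.map_dvd_map' i]
  have hpoly : h.1.charpoly.map i = (X - C a) * (X - C a⁻¹) * ((X - C b) * (X - C b⁻¹)) := by
    rw [hc]
    simp only [Polynomial.map_add, Polynomial.map_mul, Polynomial.map_pow, Polynomial.map_X, Polynomial.map_C, Polynomial.map_one]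
    rw [← hs, ← hp]
    have e1 : (C a * C a⁻¹ : K[X]) = 1 := by rw [← C_mul, mul_inv_cancel₀ ha, C_1]
    have e2 : (C b * C b⁻¹ : K[X]) = 1 := by rw [← C_mul, mul_inv_cancel₀ hb, C_1]
    have t2' : (2 : K[X]) = 0 := by rw [← C_ofNat, t2, C_0]
    simp only [C_add, C_mul]
    generalize C a = A at *
    generalize C a⁻¹ = A' at *
    generalize C b = B at *
    generalize C b⁻¹ = B' at *
    linear_combination (-(X^2 : K[X]) + X * (B + B') - B * B') * e1 + (-(X^2) + X * (A + A') - 1) * e2 + (X^3*(A+A'+B+B') - X^2 + X*(A+A'+B+B')) * t2'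
  rw [hpoly]
  simp only [Polynomial.map_sub, Polynomial.map_pow, Polynomial.map_X, Polynomial.map_one]
  refine IsCoprime.mul_dvd ?_ (IsCoprime.mul_dvd (cop ha') (lin_dvd han) (lin_dvd han'))
    (IsCoprime.mul_dvd (cop hb') (lin_dvd hbn) (lin_dvd hbn'))
  exact IsCoprime.mul_left (IsCoprime.mul_right (cop hab) (cop hab')) (IsCoprime.mul_right (cop hab2) (cop hab3))

end graphbound
end SpAut
end PartD4

section PartD5
open Matrix
set_option linter.unusedSectionVars false
namespace SpAut

section graphbound
open Polynomial
variable {F : Type} [Field F] [CharP F 2] [Fintype F]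

instance finite_ringAut : Finite (RingAut F) :=
  Finite.of_injective (fun φ : RingAut F => (φ : F → F)) DFunLike.coe_injective

theorem lcmL_pos {q : ℕ} {l : List (ℕ × Bool)} (hq : 2 ≤ q) (hl : ∀ x ∈ l, 1 ≤ x.1) : 0 < lcmL q l := by
  unfold lcmL
  induction l with
  | nil => simp
  | cons x l ih =>
    simp only [List.map_cons, List.foldr_cons]
    refine Nat.lcm_pos ?_ (ih fun y hy => hl y (List.mem_cons_of_mem _ hy))
    have h1 := hl x List.mem_cons_self
    have : 1 < q ^ x.1 := Nat.one_lt_pow (by omega) (by omega)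
    unfold pv
    split_ifs <;> omega

theorem ringaut_pow (f : ℕ) (hF : Fintype.card F = 2 ^ f) (φ : RingAut F) :
    ∃ j, j < f ∧ ∀ x, φ x = x ^ 2 ^ j := by
  letI : Algebra (ZMod 2) F := ZMod.algebra F 2
  have hfin : Module.finrank (ZMod 2) F = f := by
    have := Module.card_eq_pow_finrank (K := ZMod 2) (V := F)
    rw [hF, ZMod.card] at this
    exact (Nat.pow_right_injective le_rfl this).symm
  obtain ⟨n, hn⟩ := (FiniteField.bijective_frobeniusAlgEquivOfAlgebraic_pow (ZMod 2) F).2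
    (AlgEquiv.ofRingEquiv (f := φ) (fun x => by
      have := RingHom.congr_fun (Subsingleton.elim ((φ : F →+* F).comp (algebraMap (ZMod 2) F)) (algebraMap (ZMod 2) F)) x
      simpa using this))
  refine ⟨n.1, by simpa [hfin] using n.2, fun x => ?_⟩
  have h1 := congrArg (fun g : F ≃ₐ[ZMod 2] F => g x) hn
  simp only [AlgEquiv.coe_pow, FiniteField.coe_frobeniusAlgEquivOfAlgebraic_iterate, ZMod.card] at h1
  exact h1.symm

theorem pow_all_ge (f r : ℕ) (hr : 1 ≤ r) (hF : Fintype.card F = 2 ^ f) (h : ∀ x : F, x ^ 2 ^ r = x) : f ≤ r := by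
  have h1 : 1 < 2 ^ r := Nat.one_lt_two_pow (by omega)
  have hne := FiniteField.X_pow_card_sub_X_ne_zero F h1
  have hle : (Finset.univ : Finset F).card ≤ (X ^ 2 ^ r - X : F[X]).natDegree := by
    apply Polynomial.card_le_degree_of_subset_roots
    intro x _
    rw [mem_roots hne]; simp [h]
  rw [FiniteField.X_pow_card_sub_X_natDegree_eq F h1, Finset.card_univ, hF] at hle
  exact (Nat.pow_le_pow_iff_right (by norm_num)).1 hle

theorem Pc_coeff (g : GG 2 F) : Pc g.1 = g.1.charpoly.coeff 2 := by
  rw [charpoly_gg]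
  simp [coeff_X, coeff_one]

theorem tr_coeff (g : GG 2 F) : g.1.trace = g.1.charpoly.coeff 3 := by
  rw [charpoly_gg]
  simp [coeff_X, coeff_one]

theorem graph_rel (σ : MulAut (GG 2 F)) (A : GG 2 F) (φ : RingAut F) (H : ∀ g, σ g = gamma (A * phiG φ g * A⁻¹))
    (h : GG 2 F) (hh : σ h = h) : h.1.trace = φ (Pc h.1) ∧ Pc h.1 = φ h.1.trace * φ h.1.trace := by
  set k := A * phiG φ h * A⁻¹ with hk
  have h1 : gamma k = h := by rw [hk, ← H, hh]
  have hcp : k.1.charpoly = h.1.charpoly.map (φ : F →+* F) := by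
    rw [hk, charpoly_conj, charpoly_phi]
  constructor
  · rw [← h1, trace_gamma, h1, Pc_coeff, Pc_coeff, hcp, coeff_map]; rfl
  · have h2 : (gamma (gamma k)).1.trace = k.1.trace * k.1.trace := by
      rw [gamma_gamma, phiG_coe]
      rw [← frob2_apply]
      simp only [Matrix.trace, Matrix.diag, Matrix.map_apply, ← map_sum]
    rw [h1, trace_gamma] at h2
    rw [h2, tr_coeff k, tr_coeff h, hcp, coeff_map]; rfl

theorem graph_sq (σ : MulAut (GG 2 F)) (A : GG 2 F) (φ : RingAut F) (H : ∀ g, σ g = gamma (A * phiG φ g * A⁻¹)) (g : GG 2 F) :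
    (σ ^ 2) g = (gamma A * phiG (φ * (frob2 : RingAut F)) A) * phiG (φ * (frob2 : RingAut F) * φ) g * (gamma A * phiG (φ * (frob2 : RingAut F)) A)⁻¹ := by
  rw [pow_two, MulAut.mul_apply, H (σ g), H g, map_mul, map_mul, gamma_phi, gamma_gamma, ← phiG_mul, map_mul, map_mul, map_inv, map_inv, phiG_mul _ φ g]
  group

theorem arith_g (q0 e : ℕ) (hq : 4 ≤ q0) (he : 2 ≤ e) : 2 * e * (q0 ^ 2 + 1) ≤ (q0 ^ e) ^ 2 + 1 := by
  have h1 := four_pow_ge e he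
  have h2 : 4 ^ (e - 1) ≤ q0 ^ (e - 1) := Nat.pow_le_pow_left hq _
  have h3 : q0 ^ 3 ≤ q0 ^ (e + 1) := Nat.pow_le_pow_right (by omega) (by omega)
  have h4 : q0 ^ 2 + 1 ≤ q0 ^ 3 := by
    rw [pow_succ q0 2]; nlinarith [pow_pos (show 0 < q0 by omega) 2]
  have h5 : (q0 ^ e) ^ 2 = q0 ^ (e - 1) * q0 ^ (e + 1) := by
    rw [← pow_mul, ← pow_add]; congr 1; omega
  rw [h5]
  have := Nat.mul_le_mul (h1.trans h2) (h4.trans h3)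
  omega

theorem arith_g2 (e : ℕ) (he : 3 ≤ e) : 12 * e ≤ (2 ^ e) ^ 2 := by
  induction e, he using Nat.le_induction with
  | base => norm_num
  | succ n hn ih => rw [pow_succ 2 n]; nlinarith

theorem graph_bound (f : ℕ) (hf : 1 ≤ f) (hF : Fintype.card F = 2 ^ f) (σ : MulAut (GG 2 F)) (A : GG 2 F) (φ : RingAut F)
    (H : ∀ g, σ g = gamma (A * phiG φ g * A⁻¹)) : orderOf σ ≤ NN 2 (2 ^ f) := by
  set ψ : RingAut F := φ * (frob2 : RingAut F) * φ with hψ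
  set B := gamma A * phiG (φ * (frob2 : RingAut F)) A
  have HB : ∀ g, (σ ^ 2) g = B * phiG ψ g * B⁻¹ := graph_sq σ A φ H
  obtain ⟨h, hh⟩ := semi_conj (σ ^ 2) B ψ HB
  have hσ : σ h = h := conj_fix (hh ▸ ((Commute.self_pow σ 2).pow_right _))
  have hσ2 : (σ ^ 2) h = h := by rw [pow_two, MulAut.mul_apply, hσ, hσ]
  obtain ⟨hT, hP⟩ := graph_rel σ A φ H h hσ
  obtain ⟨q0, l, a, h1, h2, h3, h4⟩ := field_bound ψ h (charpoly_fix HB hσ2)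
  have hord : ∀ n, 0 < n → h ^ n = 1 → orderOf σ ≤ 2 * orderOf ψ * n := by
    intro n hn h
    apply Nat.le_of_dvd (Nat.mul_pos (Nat.mul_pos two_pos (orderOf_pos ψ)) hn)
    rw [orderOf_dvd_iff_pow_eq_one, pow_mul, pow_mul, hh, ← map_pow, h, map_one]
  have he := orderOf_pos ψ
  set e := orderOf ψ with hedef
  rw [hF] at h1
  obtain ⟨s, hs, hq0⟩ := q0_cases hf h1 he
  have hef : e ≤ f := by
    have : s * e = f := by
      apply Nat.pow_right_injective (le_refl 2); simp only; rw [pow_mul, ← hq0, h1]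
    nlinarith
  obtain ⟨j, hj, hφ⟩ := ringaut_pow f hF φ
  rw [hφ] at hT hP
  have hP' : h.1.trace ^ (2 * 2 ^ j) = Pc h.1 := by rw [hP]; ring
  rcases eq_or_ne h.1.trace 0 with h0 | h0
  · -- nilpotent case
    have hP0 : Pc h.1 = 0 := by rw [← hP', h0, zero_pow (by positivity)]
    have h44 : h ^ 4 = 1 := by
      apply pow_of_dvd
      rw [charpoly_gg, h0, hP0, CharTwo.sub_eq_add]; simp
    have := hord 4 (by norm_num) h44
    rcases Nat.lt_or_ge f 3 with hf3 | hf3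
    · interval_cases f
      · norm_num [NN]; omega
      · norm_num [NN]; omega
    · refine le_trans ?_ (Mm_le_NN _ _)
      have h8 : 2 ^ 3 ≤ 2 ^ f := Nat.pow_le_pow_right (by norm_num) hf3
      rw [Mm_m2 _ (by omega)]
      have := arith_g2 f hf3
      omega
  rcases Nat.lt_or_ge f 3 with hf3 | hf3
  · have h5 : h.1.trace = Pc h.1 ∧ Pc h.1 = h.1.trace * h.1.trace := by
      have hx4 : ∀ x : F, x ^ 4 = x := by
        intro x
        have := FiniteField.pow_card x
        rw [hF] at this
        interval_cases f
        · calc x ^ 4 = (x ^ 2 ^ 1) ^ 2 ^ 1 := by ring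
            _ = x := by rw [this, this]
        · exact this
      have hj2 : j < 2 := by omega
      interval_cases j
      · simp only [pow_zero, pow_one] at *
        exact ⟨hT, hP⟩
      · simp only [pow_one] at *
        have e1 : Pc h.1 = h.1.trace := by rw [← hP']; exact hx4 _
        refine ⟨e1.symm, ?_⟩
        have := hT
        rw [e1] at this ⊢
        rw [← pow_two, ← this]
    have hT1 : h.1.trace = 1 := by
      have h6 : h.1.trace * h.1.trace = h.1.trace * 1 := by rw [mul_one, ← h5.2, ← h5.1]
      exact mul_left_cancel₀ h0 h6
    have h55 : h ^ 5 = 1 := by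
      apply pow_of_dvd
      rw [charpoly_gg, ← h5.1, hT1]
      exact ⟨X - 1, by simp; ring⟩
    have := hord 5 (by norm_num) h55
    interval_cases f
    · norm_num [NN]; omega
    · norm_num [NN]; omega
  · refine le_trans ?_ (Mm_le_NN _ _)
    have h8 : 2 ^ 3 ≤ 2 ^ f := Nat.pow_le_pow_right (by norm_num) hf3
    rw [Mm_m2 _ (by omega)]
    rcases Nat.lt_or_ge e 2 with he2 | he2
    · have he1 : e = 1 := by omega
      have hψ1 : ψ = 1 := by rw [hedef] at he1; exact orderOf_eq_one_iff.1 he1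
      have hpow : ∀ x : F, x ^ 2 ^ (2 * j + 1) = x := by
        intro x
        have := congrArg (fun g : RingAut F => g x) hψ1
        simp only [hψ, RingAut.mul_apply, hφ, RingAut.one_apply, frob2_apply] at this
        conv_rhs => rw [← this]
        rw [← pow_two, ← pow_mul, ← pow_mul]
        congr 1; ring
      have hjf : 2 * j + 1 ≤ f := by
        by_contra hc
        push Not at hc
        have := pow_all_ge f (2 * j + 1 - f) (by omega) hF (fun x => by
          have h6 := hpow x
          rw [show 2 * j + 1 = f + (2 * j + 1 - f) by omega, pow_add, pow_mul] at h6
          have h7 := FiniteField.pow_card x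
          rw [hF] at h7
          rwa [h7] at h6)
        omega
      obtain ⟨n, hn, hn', hhn⟩ := graph_pow h j hT.symm hP' h0
      have := hord n hn hhn
      rw [he1] at this
      have hQ : 2 * (2 ^ j) ^ 2 ≤ 2 ^ f := by
        rw [← pow_mul, mul_comm, ← pow_succ]
        exact Nat.pow_le_pow_right (by norm_num) (by omega)
      have hQ1 : 2 ^ j ≤ (2 ^ j) ^ 2 := Nat.le_self_pow (by norm_num) _
      have : 4 * 2 ^ f + 2 ≤ (2 ^ f) ^ 2 + 1 := by nlinarith
      omega
    · have hM := (comb_bound q0 2 a l (by norm_num) (pow_cases hs hq0) h2 h3).1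
      have hpos : 0 < lcmL q0 l * 2 ^ a := by
        exact Nat.mul_pos (lcmL_pos (hq0 ▸ Nat.le_self_pow (by omega) 2) h2) (by positivity)
      have h6 := hord _ hpos h4
      have h7 : orderOf σ ≤ 2 * e * Mm 2 q0 := h6.trans (Nat.mul_le_mul le_rfl hM)
      refine h7.trans ?_
      rcases pow_cases hs hq0 with h9 | ⟨h9, _⟩
      · rw [h9, Mm_two_two]
        rw [h9] at h1
        have : e = f := Nat.pow_right_injective le_rfl h1
        have := arith_g2 f hf3
        subst e
        omega
      · rw [Mm_m2 _ h9, ← h1]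
        exact arith_g q0 e h9 he2

end graphbound
end SpAut
end PartD5

section PartE1
open Matrix
set_option linter.unusedSectionVars false
namespace SpAut

section upper
variable {m : ℕ} {F : Type} [Field F] [CharP F 2] [Fintype F]

theorem semi_le (f : ℕ) (hf : 1 ≤ f) (hm : 1 ≤ m) (hF : Fintype.card F = 2 ^ f) (σ : MulAut (GG m F)) (A : GG m F)
    (φ : RingAut F) (H : ∀ g, σ g = A * phiG φ g * A⁻¹) : orderOf σ ≤ NN m (2 ^ f) := by
  obtain ⟨q0, l, a, h1, h2, h3, h4⟩ := semi_bound σ A φ H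
  have he := orderOf_pos φ
  rw [hF] at h1
  obtain ⟨s, hs, hq0⟩ := q0_cases hf h1 he
  have hpos : 0 < lcmL q0 l * 2 ^ a :=
    Nat.mul_pos (lcmL_pos (hq0 ▸ Nat.le_self_pow (by omega) 2) h2) (by positivity)
  exact (Nat.le_of_dvd (Nat.mul_pos he hpos) h4).trans (arith_semi f _ m q0 _ a l hf rfl hm he h1 h2 h3)

theorem upper_bound (f : ℕ) (hf : 1 ≤ f) (hm : 1 ≤ m) (hF : Fintype.card F = 2 ^ f) (σ : MulAut (GG m F)) :
    orderOf σ ≤ NN m (2 ^ f) := by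
  rcases aut_cases hm σ with ⟨A, φ, H⟩ | rfl
  · exact semi_le f hf hm hF σ A φ H
  · rcases aut_cases2 σ with ⟨A, φ, H⟩ | ⟨A, φ, H⟩
    · exact semi_le f hf hm hF σ A φ H
    · exact graph_bound f hf hF σ A φ H

end upper

section exist
variable {F : Type} [Field F]

/-- there is an element of order `N` in the symplectic group -/
def EE (F : Type) [Field F] (m N : ℕ) : Prop := ∃ h : GG m F, orderOf h = N

theorem pow_act {m : ℕ} (h : GG m F) (n : ℕ) (v : VV m F) : (h ^ n).1 *ᵥ v = (fun w => h.1 *ᵥ w)^[n] v := by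
  induction n with
  | zero => simp
  | succ n ih => rw [pow_succ', mul_act, ih, Function.iterate_succ_apply']

theorem EE_of {m N : ℕ} {V : Type} [AddCommGroup V] [Module F V] (e : V ≃ₗ[F] VV m F) (f : Module.End F V)
    (hf : ∀ v w, bb (e (f v)) (e (f w)) = bb (e v) (e w)) (hN : orderOf f = N) : EE F m N := by
  let k : VV m F →ₗ[F] VV m F := e.toLinearMap ∘ₗ f ∘ₗ e.symm.toLinearMap
  let h : GG m F := mkG k (fun v w => by simp [k, hf])
  refine ⟨h, ?_⟩
  rw [← hN, orderOf_eq_orderOf_iff]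
  intro n
  have key : ∀ n v, (h ^ n).1 *ᵥ (e v) = e ((f ^ n) v) := by
    intro n
    induction n with
    | zero => simp
    | succ n ih =>
      intro v
      rw [pow_succ, mul_act, pow_succ, Module.End.mul_apply, ← ih, mkG_act]
      simp [k]
  constructor
  · intro hn
    ext v
    apply e.injective
    rw [← key, hn, one_act]; rfl
  · intro hn
    apply gg_ext
    intro v
    obtain ⟨w, rfl⟩ := e.surjective v
    rw [key, hn, one_act]; rfl

theorem orderOf_toLin {m : ℕ} (h : GG m F) : orderOf (Matrix.toLin' h.1 : Module.End F (VV m F)) = orderOf h := by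
  rw [← orderOf_submonoid h]
  exact orderOf_injective (Matrix.toLinAlgEquiv' (R := F) (n := Fin m ⊕ Fin m)).toRingEquiv.toMonoidHom
    (Matrix.toLinAlgEquiv').injective h.1

theorem prodMap_pow {V W : Type} [AddCommGroup V] [Module F V] [AddCommGroup W] [Module F W]
    (f : Module.End F V) (g : Module.End F W) (n : ℕ) :
    (LinearMap.prodMap f g : Module.End F (V × W)) ^ n = LinearMap.prodMap (f ^ n) (g ^ n) := by
  induction n with
  | zero => ext <;> simp
  | succ n ih => rw [pow_succ, ih, pow_succ, pow_succ]; ext <;> simp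

theorem orderOf_prodMap {V W : Type} [AddCommGroup V] [Module F V] [AddCommGroup W] [Module F W]
    (f : Module.End F V) (g : Module.End F W) :
    orderOf (LinearMap.prodMap f g : Module.End F (V × W)) = Nat.lcm (orderOf f) (orderOf g) := by
  rw [← Prod.orderOf_mk, orderOf_eq_orderOf_iff]
  intro n
  rw [prodMap_pow, Prod.pow_mk, Prod.mk_eq_one]
  constructor
  · intro h
    constructor
    · ext v; simpa using congrArg Prod.fst (LinearMap.congr_fun h (v, 0))
    · ext v; simpa using congrArg Prod.snd (LinearMap.congr_fun h (0, v))
  · rintro ⟨h1, h2⟩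
    rw [h1, h2]; ext <;> simp

/-- splitting of the natural module -/
noncomputable def splitE (F : Type) [Field F] (m n : ℕ) : (VV m F × VV n F) ≃ₗ[F] VV (m + n) F where
  toFun p := Sum.elim (Fin.append (p.1 ∘ Sum.inl) (p.2 ∘ Sum.inl)) (Fin.append (p.1 ∘ Sum.inr) (p.2 ∘ Sum.inr))
  invFun v := (Sum.elim (fun i => v (.inl (Fin.castAdd n i))) (fun i => v (.inr (Fin.castAdd n i))),
    Sum.elim (fun i => v (.inl (Fin.natAdd m i))) (fun i => v (.inr (Fin.natAdd m i))))
  left_inv p := by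
    ext (i | i) <;> simp
  right_inv v := by
    ext (i | i) <;> refine Fin.addCases (fun i => ?_) (fun i => ?_) i <;> simp
  map_add' p q := by
    ext (i | i) <;> refine Fin.addCases (fun i => ?_) (fun i => ?_) i <;> simp
  map_smul' c p := by
    ext (i | i) <;> refine Fin.addCases (fun i => ?_) (fun i => ?_) i <;> simp

theorem bb_split (m n : ℕ) (p r : VV m F × VV n F) :
    bb (splitE F m n p) (splitE F m n r) = bb p.1 r.1 + bb p.2 r.2 := by
  simp only [bb_eq, Fin.sum_univ_add, splitE]
  simp

theorem EE_lcm {m n M N : ℕ} (h1 : EE F m M) (h2 : EE F n N) : EE F (m + n) (Nat.lcm M N) := by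
  obtain ⟨g, hg⟩ := h1
  obtain ⟨h, hh⟩ := h2
  refine EE_of (splitE F m n) (LinearMap.prodMap (Matrix.toLin' g.1) (Matrix.toLin' h.1)) ?_ ?_
  · intro v w
    rw [bb_split, bb_split]
    simp [bb_act]
  · rw [orderOf_prodMap, orderOf_toLin, orderOf_toLin, hg, hh]

theorem EE_mul {m n M N : ℕ} (h1 : EE F m M) (h2 : EE F n N) (h : Nat.Coprime M N) : EE F (m + n) (M * N) := by
  rw [← h.lcm_eq_mul]; exact EE_lcm h1 h2

theorem EE_one (m : ℕ) : EE F m 1 := ⟨1, orderOf_one⟩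

end exist
end SpAut
end PartE1

section PartE2
open Matrix
set_option linter.unusedSectionVars false
namespace SpAut

section torus
variable {F : Type} [Field F] {K : Type} [Field K] [Algebra F K]

/-- the companion map -/
def cmap (F : Type) [Field F] {K : Type} [Field K] [Algebra F K] (t : K) : Module.End F (K × K) where
  toFun p := (p.2, -p.1 + t * p.2)
  map_add' p r := by ext <;> simp; ring
  map_smul' c p := by ext <;> simp

theorem cmap_apply (t : K) (p : K × K) : cmap F t p = (p.2, -p.1 + t * p.2) := rfl

theorem cmap_eig {L : Type} [Field L] (i : K →+* L) (t : K) (a : L) (ha : a ≠ 0) (h : a + a⁻¹ = i t) (n : ℕ) (p : K × K) :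
    i ((cmap F t ^ n) p).2 - a⁻¹ * i ((cmap F t ^ n) p).1 = a ^ n * (i p.2 - a⁻¹ * i p.1) := by
  induction n with
  | zero => simp
  | succ n ih =>
    rw [pow_succ', Module.End.mul_apply, cmap_apply]
    simp only [map_add, map_neg, map_mul, ← h]
    rw [pow_succ', mul_assoc, ← ih]
    field_simp
    ring

theorem cmap_order {L : Type} [Field L] (i : K →+* L) (t : K) (a : L) (ha : a ≠ 0) (ha' : a ≠ a⁻¹) (h : a + a⁻¹ = i t) :
    orderOf (cmap F t) = orderOf a := by
  rw [orderOf_eq_orderOf_iff]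
  intro n
  constructor
  · intro hn
    have := cmap_eig (F := F) i t a ha h n (0, 1)
    rw [hn] at this
    simpa using this.symm
  · intro hn
    have hn' : a⁻¹ ^ n = 1 := by rw [inv_pow, hn, inv_one]
    apply LinearMap.ext
    intro p
    have h1 := cmap_eig (F := F) i t a ha h n p
    have h2 := cmap_eig (F := F) i t a⁻¹ (inv_ne_zero ha) (by rw [inv_inv, add_comm, h]) n p
    rw [hn, one_mul] at h1
    rw [hn', one_mul, inv_inv] at h2
    set r := (cmap F t ^ n) p
    have h3 : (a - a⁻¹) * (i r.1 - i p.1) = 0 := by linear_combination h1 - h2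
    have h4 : i r.1 = i p.1 := sub_eq_zero.1 ((mul_eq_zero.1 h3).resolve_left (sub_ne_zero.2 ha'))
    have h5 : i r.2 = i p.2 := by rw [h4] at h1; linear_combination h1
    exact Prod.ext (i.injective h4) (i.injective h5)

theorem trace_coord [FiniteDimensional F K] [Algebra.IsSeparable F K] {d : ℕ} (b : Module.Basis (Fin d) F K) (x y : K) :
    Algebra.trace F K (x * y) = ∑ i, b.equivFun x i * b.traceDual.equivFun y i := by
  conv_lhs => rw [← b.sum_equivFun x, Finset.sum_mul, map_sum]
  refine Finset.sum_congr rfl fun i _ => ?_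
  rw [smul_mul_assoc, map_smul, smul_eq_mul]
  congr 1
  simp [Module.Basis.equivFun_apply, Algebra.traceForm_apply, mul_comm]

theorem EE_torus [FiniteDimensional F K] [Algebra.IsSeparable F K] {L : Type} [Field L] (i : K →+* L) (t : K) (a : L)
    (ha : a ≠ 0) (ha' : a ≠ a⁻¹) (h : a + a⁻¹ = i t) : EE F (Module.finrank F K) (orderOf a) := by
  let b := Module.finBasis F K
  let e : (K × K) ≃ₗ[F] VV (Module.finrank F K) F :=
    (b.equivFun.prodCongr b.traceDual.equivFun) ≪≫ₗ (LinearEquiv.sumArrowLequivProdArrow _ _ F F).symm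
  have he : ∀ p r : K × K, bb (e p) (e r) = Algebra.trace F K (r.1 * p.2) - Algebra.trace F K (p.1 * r.2) := by
    intro p r
    rw [trace_coord b, trace_coord b, bb_eq, Finset.sum_sub_distrib]
    simp only [e]
    simp [mul_comm]
  refine EE_of e (cmap F t) ?_ (cmap_order i t a ha ha' h)
  intro p r
  rw [he, he, ← map_sub, ← map_sub, cmap_apply, cmap_apply]
  congr 1
  ring

end torus

section orders
variable {F : Type} [Field F] [CharP F 2] [Fintype F]

theorem exists_order {L : Type} [Field L] [Finite L] (N : ℕ) (h : N ∣ Nat.card L - 1) : ∃ a : L, a ≠ 0 ∧ orderOf a = N := by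
  obtain ⟨g, hg⟩ := IsCyclic.exists_generator (α := Lˣ)
  have ho : orderOf g = Nat.card L - 1 := by
    rw [orderOf_eq_card_of_forall_mem_zpowers hg, Nat.card_units]
  obtain ⟨k, hk⟩ := h
  have hpos : 0 < Nat.card L - 1 := ho ▸ orderOf_pos g
  refine ⟨((g ^ k : Lˣ) : L), Units.ne_zero _, ?_⟩
  have hk0 : k ≠ 0 := by rintro rfl; omega
  rw [orderOf_units, orderOf_pow_of_dvd hk0 (by rw [ho, hk]; exact dvd_mul_left _ _), ho, hk]
  exact Nat.mul_div_cancel _ (by omega)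

theorem ne_inv_of_order {L : Type} [Field L] {a : L} (ha : a ≠ 0) (h : 2 < orderOf a) : a ≠ a⁻¹ := by
  intro h1
  have : a ^ 2 = 1 := by rw [pow_two]; nth_rewrite 2 [h1]; exact mul_inv_cancel₀ ha
  have := Nat.le_of_dvd (by norm_num) (orderOf_dvd_of_pow_eq_one this)
  omega

theorem EE_minus (d : ℕ) (hd : 1 ≤ d) (h : 4 ≤ Fintype.card F ^ d) : EE F d (Fintype.card F ^ d - 1) := by
  haveI : NeZero d := ⟨by omega⟩
  haveI : Fact (Nat.Prime 2) := ⟨Nat.prime_two⟩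
  let K := FiniteField.Extension F 2 d
  have hcard : Nat.card K = Fintype.card F ^ d := by
    rw [FiniteField.natCard_extension, Nat.card_eq_fintype_card]
  haveI : Finite K := Nat.finite_of_card_ne_zero (by omega)
  obtain ⟨a, ha, ho⟩ := exists_order (L := K) (Fintype.card F ^ d - 1) (by rw [hcard])
  have := EE_torus (F := F) (K := K) (RingHom.id K) (a + a⁻¹) a ha (ne_inv_of_order ha (by omega)) rfl
  rwa [FiniteField.finrank_extension, ho] at this

theorem EE_plus (d : ℕ) (hd : 1 ≤ d) : EE F d (Fintype.card F ^ d + 1) := by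
  haveI : NeZero d := ⟨by omega⟩
  haveI : Fact (Nat.Prime 2) := ⟨Nat.prime_two⟩
  let K := FiniteField.Extension F 2 d
  have h1 : 1 < Fintype.card F ^ d := Nat.one_lt_pow (by omega) Fintype.one_lt_card
  have hcard : Nat.card K = Fintype.card F ^ d := by
    rw [FiniteField.natCard_extension, Nat.card_eq_fintype_card]
  haveI : Finite K := Nat.finite_of_card_ne_zero (by omega)
  haveI : CharP K 2 := charP_of_injective_algebraMap (algebraMap F K).injective 2
  let L := FiniteField.Extension K 2 2
  have hcard2 : Nat.card L = Nat.card K ^ 2 := FiniteField.natCard_extension K 2 2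
  haveI : Finite L := Nat.finite_of_card_ne_zero (by rw [hcard2, hcard]; positivity)
  obtain ⟨a, ha, ho⟩ := exists_order (L := L) (Fintype.card F ^ d + 1) (by
    rw [hcard2, hcard]; exact ⟨Fintype.card F ^ d - 1, by rw [← Nat.sq_sub_sq, one_pow]⟩)
  have ht : a + a⁻¹ = algebraMap K L (Algebra.trace K L a) := by
    rw [FiniteField.algebraMap_trace_eq_sum_pow, FiniteField.finrank_extension, Finset.sum_range_succ, Finset.sum_range_one,
      pow_zero, pow_one, pow_one, hcard]
    congr 1
    have := pow_orderOf_eq_one a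
    rw [ho, pow_succ] at this
    exact (eq_inv_of_mul_eq_one_left this).symm
  have := EE_torus (F := F) (K := K) (algebraMap K L) (Algebra.trace K L a) a ha (ne_inv_of_order ha (by omega)) ht
  rwa [FiniteField.finrank_extension, ho] at this

end orders
end SpAut
end PartE2

section PartE3
open Matrix
set_option linter.unusedSectionVars false
namespace SpAut

section unip

/-- base change from the prime field -/
noncomputable def bc (F : Type) [Field F] [CharP F 2] (m : ℕ) : GG m (ZMod 2) →* GG m F where
  toFun g := ⟨g.1.map (ZMod.castHom (dvd_refl 2) F), SymplecticGroup.map_mem g.2 _⟩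
  map_one' := Subtype.ext (by simp)
  map_mul' g h := Subtype.ext (by simp [Matrix.map_mul])

theorem bc_coe {F : Type} [Field F] [CharP F 2] {m : ℕ} (g : GG m (ZMod 2)) :
    (bc F m g).1 = g.1.map (ZMod.castHom (dvd_refl 2) F) := rfl

theorem bc_inj {F : Type} [Field F] [CharP F 2] {m : ℕ} : Function.Injective (bc F m) := by
  intro g h hh
  apply Subtype.ext
  have h1 := congrArg Subtype.val hh
  rw [bc_coe, bc_coe] at h1
  exact Matrix.map_injective (ZMod.castHom (dvd_refl 2) F).injective h1

theorem EE_bc {F : Type} [Field F] [CharP F 2] {m N : ℕ} (h : EE (ZMod 2) m N) : EE F m N := by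
  obtain ⟨g, hg⟩ := h
  exact ⟨bc F m g, by rw [orderOf_injective _ bc_inj, hg]⟩

/-- order 2 -/
def u1 : GG 1 (ZMod 2) := ⟨fromBlocks 1 1 0 1, by rw [SymplecticGroup.mem_iff]; decide +kernel⟩
/-- order 3 -/
def s3 : GG 1 (ZMod 2) := ⟨fromBlocks 0 1 1 1, by rw [SymplecticGroup.mem_iff]; decide +kernel⟩
/-- order 4 -/
def u2 : GG 2 (ZMod 2) := ⟨fromBlocks !![1, 1; 0, 1] !![0, 0; 1, 1] 0 !![1, 0; 1, 1],
  by rw [SymplecticGroup.mem_iff]; decide +kernel⟩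
/-- order 5 -/
def s5 : GG 2 (ZMod 2) := ⟨fromBlocks 0 1 1 !![1, 1; 1, 0],
  by rw [SymplecticGroup.mem_iff]; decide +kernel⟩
/-- order 8 -/
def u3 : GG 3 (ZMod 2) := ⟨fromBlocks !![1, 1, 0; 0, 1, 1; 0, 0, 1] !![0, 0, 0; 0, 0, 0; 1, 1, 1] 0
  !![1, 0, 0; 1, 1, 0; 1, 1, 1], by rw [SymplecticGroup.mem_iff]; decide +kernel⟩

theorem u1_order : orderOf u1 = 2 := by
  apply orderOf_eq_prime
  · apply Subtype.ext; rw [pow_two]; change u1.1 * u1.1 = 1; decide +kernel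
  · intro h; have := congrArg Subtype.val h; revert this; decide +kernel

theorem s3_order : orderOf s3 = 3 := by
  haveI : Fact (Nat.Prime 3) := ⟨by norm_num⟩
  apply orderOf_eq_prime
  · rw [show s3 ^ 3 = s3 * s3 * s3 by simp only [pow_succ, pow_zero, one_mul]]; apply Subtype.ext; change s3.1 * s3.1 * s3.1 = 1; decide +kernel
  · intro h; have := congrArg Subtype.val h; revert this; decide +kernel

theorem s5_order : orderOf s5 = 5 := by
  haveI : Fact (Nat.Prime 5) := ⟨by norm_num⟩
  apply orderOf_eq_prime
  · rw [show s5 ^ 5 = s5 * s5 * s5 * s5 * s5 by simp only [pow_succ, pow_zero, one_mul]]; apply Subtype.ext; change s5.1 * s5.1 * s5.1 * s5.1 * s5.1 = 1; decide +kernel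
  · intro h; have := congrArg Subtype.val h; revert this; decide +kernel

theorem u2_order : orderOf u2 = 2 ^ 2 := by
  have e2 : (u2 * u2).1 = u2.1 * u2.1 := rfl
  apply orderOf_eq_prime_pow
  · intro h
    have := congrArg Subtype.val h
    rw [pow_one, pow_two, e2] at this
    revert this; decide +kernel
  · apply Subtype.ext
    rw [show 2 ^ (1 + 1) = 2 * 2 by norm_num, pow_mul, pow_two, pow_two]
    change (u2.1 * u2.1) * (u2.1 * u2.1) = 1
    decide +kernel

theorem u3_order : orderOf u3 = 2 ^ 3 := by
  apply orderOf_eq_prime_pow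
  · intro h
    have := congrArg Subtype.val h
    rw [show 2 ^ 2 = 2 * 2 by norm_num, pow_mul, pow_two, pow_two] at this
    change (u3.1 * u3.1) * (u3.1 * u3.1) = 1 at this
    revert this; decide +kernel
  · apply Subtype.ext
    rw [show 2 ^ (2 + 1) = 2 * 2 * 2 by norm_num, pow_mul, pow_mul, pow_two, pow_two, pow_two]
    change ((u3.1 * u3.1) * (u3.1 * u3.1)) * ((u3.1 * u3.1) * (u3.1 * u3.1)) = 1
    decide +kernel

theorem EE_unip (F : Type) [Field F] [CharP F 2] (k : ℕ) (hk : k ≤ 3) : EE F k (2 ^ k) := by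
  interval_cases k
  · exact EE_one 0
  · exact EE_bc ⟨u1, u1_order⟩
  · exact EE_bc ⟨u2, u2_order⟩
  · exact EE_bc ⟨u3, u3_order⟩

end unip
end SpAut
end PartE3

section PartE4
open Matrix
set_option linter.unusedSectionVars false
namespace SpAut

section arith

/-- product of the first Fermat-type numbers -/
def Fp (q n : ℕ) : ℕ := ∏ i ∈ Finset.range n, (q ^ 2 ^ i + 1)

theorem Fp_succ (q n : ℕ) : Fp q (n + 1) = Fp q n * (q ^ 2 ^ n + 1) := Finset.prod_range_succ _ _

theorem Fp_mul (q n : ℕ) (hq : 1 ≤ q) : Fp q n * (q - 1) = q ^ 2 ^ n - 1 := by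
  induction n with
  | zero => simp [Fp]
  | succ n ih =>
    rw [Fp_succ, mul_right_comm, ih, pow_succ 2 n, pow_mul, mul_comm]
    rw [show q ^ 2 ^ n + 1 = q ^ 2 ^ n + 1 from rfl, ← Nat.sq_sub_sq, one_pow]

theorem odd_fermat {q : ℕ} (hq : Even q) (i : ℕ) : Odd (q ^ 2 ^ i + 1) :=
  (hq.pow_of_ne_zero (by positivity)).add_one

theorem cop_pm {x : ℕ} (hx : Odd (x + 1)) (h1 : 1 ≤ x) : Nat.Coprime (x + 1) (x - 1) := by
  have : Nat.gcd (x + 1) (x - 1) ∣ 2 := by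
    have h2 := Nat.dvd_sub (Nat.gcd_dvd_left (x + 1) (x - 1)) (Nat.gcd_dvd_right (x + 1) (x - 1))
    rwa [show x + 1 - (x - 1) = 2 by omega] at h2
  rcases (Nat.dvd_prime Nat.prime_two).1 this with h | h
  · exact h
  · exfalso
    have := Nat.gcd_dvd_left (x + 1) (x - 1)
    rw [h] at this
    exact (Nat.not_even_iff_odd.2 hx) (even_iff_two_dvd.2 this)

theorem fermat_dvd {q i j : ℕ} (hij : i < j) : q ^ 2 ^ i + 1 ∣ q ^ 2 ^ j - 1 := by
  rcases Nat.eq_zero_or_pos q with rfl | hq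
  · simp [zero_pow (show 2 ^ i ≠ 0 by positivity), zero_pow (show 2 ^ j ≠ 0 by positivity)]
  rw [← Fp_mul q j hq]
  exact Dvd.dvd.mul_right (Finset.dvd_prod_of_mem (fun i => q ^ 2 ^ i + 1) (Finset.mem_range.2 hij)) _

theorem cop_lt {q i j : ℕ} (hq : Even q) (h2 : 1 ≤ q) (hij : i < j) : Nat.Coprime (q ^ 2 ^ i + 1) (q ^ 2 ^ j + 1) :=
  ((cop_pm (odd_fermat hq j) (Nat.one_le_pow _ _ h2)).coprime_dvd_right (fermat_dvd hij)).symm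

theorem cop_ne {q i j : ℕ} (hq : Even q) (h2 : 1 ≤ q) (hij : i ≠ j) : Nat.Coprime (q ^ 2 ^ i + 1) (q ^ 2 ^ j + 1) := by
  rcases lt_or_gt_of_ne hij with h | h
  · exact cop_lt hq h2 h
  · exact (cop_lt hq h2 h).symm

theorem cop_minus {q b i : ℕ} (hq : Even q) (h2 : 1 ≤ q) (hb : Odd b) : Nat.Coprime (q ^ b - 1) (q ^ 2 ^ i + 1) := by
  have h1 : Nat.gcd (q ^ b - 1) (q ^ 2 ^ i + 1) ∣ q - 1 := by
    have : Nat.gcd (q ^ b - 1) (q ^ 2 ^ (i + 1) - 1) = q - 1 := by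
      rw [Nat.pow_sub_one_gcd_pow_sub_one]
      rw [(Nat.coprime_two_right.2 hb).pow_right (i + 1), pow_one]
    rw [← this]
    exact Nat.gcd_dvd_gcd_of_dvd_right _ (fermat_dvd (Nat.lt_succ_self i))
  have h3 : Nat.Coprime (q - 1) (q ^ 2 ^ i + 1) := by
    have h4 := cop_pm (odd_fermat hq i) (Nat.one_le_pow _ _ h2)
    have h5 : q - 1 ∣ q ^ 2 ^ i - 1 := by
      rw [← Fp_mul q i h2]; exact dvd_mul_left _ _
    exact (h4.coprime_dvd_right h5).symm
  have h6 := Nat.dvd_gcd h1 (Nat.gcd_dvd_right _ _)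
  rw [h3] at h6
  exact Nat.eq_one_of_dvd_one h6

theorem cop_minus_Fp {q b n : ℕ} (hq : Even q) (h2 : 1 ≤ q) (hb : Odd b) : Nat.Coprime (q ^ b - 1) (Fp q n) :=
  Nat.Coprime.prod_right fun _ _ => cop_minus hq h2 hb

end arith

section EEs
variable {F : Type} [Field F] [CharP F 2] [Fintype F]

theorem EE_minus' (d : ℕ) : EE F d (Fintype.card F ^ d - 1) ∨ d = 0 := by
  rcases Nat.eq_zero_or_pos d with h | h
  · right; exact h
  left
  rcases Nat.lt_or_ge (Fintype.card F ^ d) 4 with h4 | h4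
  · have h2 : 1 < Fintype.card F ^ d := Nat.one_lt_pow (by omega) Fintype.one_lt_card
    obtain ⟨n, hn⟩ : ∃ n : ℕ, Fintype.card F = 2 ^ n := by
      obtain ⟨n, _, hn⟩ := FiniteField.card F 2
      exact ⟨n, hn⟩
    have : Fintype.card F ^ d = 2 := by
      rw [hn, ← pow_mul] at h2 h4 ⊢
      have h5 : n * d < 2 := (Nat.pow_lt_pow_iff_right (a := 2) (by norm_num)).1 (by simpa using h4)
      generalize n * d = k at *
      interval_cases k
      · norm_num at h2
      · norm_num
    rw [this]
    exact EE_one d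
  · exact EE_minus d h h4

theorem card_even : Even (Fintype.card F) := by
  obtain ⟨n, _, hn⟩ := FiniteField.card F 2
  rw [hn]
  exact (even_two).pow_of_ne_zero n.ne_zero

theorem EE_fermat (S : Finset ℕ) : EE F (∑ i ∈ S, 2 ^ i) (∏ i ∈ S, (Fintype.card F ^ 2 ^ i + 1)) := by
  induction S using Finset.induction_on with
  | empty => exact EE_one 0
  | insert a S ha ih =>
    rw [Finset.sum_insert ha, Finset.prod_insert ha]
    refine EE_mul (EE_plus _ Nat.one_le_two_pow) ih (Nat.Coprime.prod_right fun i hi => ?_)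
    exact cop_ne card_even Fintype.card_pos (by rintro rfl; exact ha hi)

theorem EE_Fp (n : ℕ) : EE F (2 ^ n - 1) (Fp (Fintype.card F) n) := by
  have := EE_fermat (F := F) (Finset.range n)
  rwa [Nat.geomSum_eq (le_refl 2), show 2 - 1 = 1 from rfl, Nat.div_one] at this

theorem EE_PP (m : ℕ) : EE F m (PP (Fintype.card F) m) := by
  have := EE_fermat (F := F) ((Finset.range (m + 1)).filter (fun i => m.testBit i))
  rw [Finset.prod_filter] at this
  have h2 : ∑ i ∈ (Finset.range (m + 1)).filter (fun i => m.testBit i), 2 ^ i = m := by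
    rw [Finset.sum_filter]
    have : ∀ n m : ℕ, ∑ i ∈ Finset.range n, (if m.testBit i then 2 ^ i else 0) = m % 2 ^ n := by
      intro n m
      induction n with
      | zero => simp [Nat.mod_one]
      | succ n ih =>
        rw [Finset.sum_range_succ, ih, pow_succ, Nat.mod_mul, Nat.testBit_eq_decide_div_mod_eq]
        rcases Nat.mod_two_eq_zero_or_one (m / 2 ^ n) with h | h <;> simp [h]
    rw [this]
    exact Nat.mod_eq_of_lt ((Nat.lt_two_pow_self).trans (Nat.pow_lt_pow_right (by norm_num) (by omega)))
  rwa [h2] at this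

theorem EE_congr {m n M N : ℕ} (h : EE F m M) (h1 : m = n) (h2 : M = N) : EE F n N := h1 ▸ h2 ▸ h

theorem odd_pow_sub {n : ℕ} (hn : 1 ≤ n) : Odd (2 ^ n - 1) :=
  Nat.Even.sub_odd Nat.one_le_two_pow (even_two.pow_of_ne_zero (by omega)) odd_one

/-- the value for `q = 2` -/
theorem EE_two (m : ℕ) (hm : 1 ≤ m) (hF : Fintype.card F = 2) : EE F m (Mm m 2) := by
  have hFp : ∀ n, Fp 2 n = 2 ^ 2 ^ n - 1 := fun n => by simpa using Fp_mul 2 n (by norm_num)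
  have hE : ∀ n, EE F (2 ^ n - 1) (2 ^ 2 ^ n - 1) := fun n => by
    have := EE_Fp (F := F) n
    rwa [hF, hFp] at this
  have hU : ∀ b n u, u ≤ 3 → Odd b → EE F (u + (b + (2 ^ n - 1))) (2 ^ u * ((2 ^ b - 1) * (2 ^ 2 ^ n - 1))) := by
    intro b n u hu hb
    have h1 := (EE_minus' (F := F) b).resolve_right (by rintro rfl; simp at hb)
    rw [hF] at h1
    have hb1 : 1 ≤ b := hb.pos
    refine EE_mul (EE_unip F u hu) (EE_mul h1 (hE n) ?_) ?_
    · have := cop_minus_Fp (q := 2) (n := n) even_two (by norm_num) hb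
      rwa [hFp] at this
    · apply Nat.Coprime.pow_left
      rw [Nat.coprime_two_left]
      exact (odd_pow_sub hb1).mul (odd_pow_sub Nat.one_le_two_pow)
  obtain ⟨L, m0, h1, h2, h3⟩ := Mm_two' m hm
  have hL : 1 ≤ 2 ^ L := Nat.one_le_two_pow
  have hL2 : 2 ^ (L + 1) = 2 * 2 ^ L := by rw [pow_succ, mul_comm]
  rcases h3 with ⟨h3, h4⟩ | ⟨h3, h4, b, hb, hb1, hb2, h5⟩ | ⟨h3, h4, h5⟩ | ⟨h3, h4, b, hb, hb1, hb2, h5⟩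
  · rw [h4]
    have := EE_mul (EE_unip F m0 h3) (hE (L + 1)) (by
      apply Nat.Coprime.pow_left
      rw [Nat.coprime_two_left]
      exact odd_pow_sub Nat.one_le_two_pow)
    rw [hL2] at this
    exact EE_congr this (by omega) rfl
  · rw [h5]
    exact EE_congr (hU b L (2 ^ L + m0 - b) (by omega) hb) (by omega) (by ring)
  · rw [h5]
    have h6 := EE_plus (F := F) (2 * 2 ^ L) (by omega)
    rw [hF] at h6
    refine EE_congr (EE_mul h6 (hE L) ?_) (by omega) rfl
    have := cop_pm (odd_fermat even_two (L + 1)) (Nat.one_le_pow _ 2 (by norm_num))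
    rw [hL2] at this
    refine this.coprime_dvd_right ?_
    rw [mul_comm 2, pow_mul]
    exact Nat.sub_one_dvd_pow_sub_one _ _
  · rw [h5]
    have := hU b (L + 1) (m0 - b) (by omega) hb
    rw [hL2] at this
    exact EE_congr this (by omega) (by ring)

theorem EE_big (m : ℕ) (hm : 1 ≤ m) (hF : 4 ≤ Fintype.card F) : EE F m (Mm m (Fintype.card F)) := by
  rcases Nat.even_or_odd m with he | ho
  · rcases Nat.lt_or_ge m 4 with h4 | h4
    · have : m = 2 := by obtain ⟨k, hk⟩ := he; omega
      subst this
      rw [Mm_m2 _ hF]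
      exact EE_plus 2 (by norm_num)
    · obtain ⟨L, h1, h2, h3⟩ := Mm_even m _ hF he h4
      have hL : 1 ≤ 2 ^ L := Nat.one_le_two_pow
      have hL2 : 2 ^ (L + 1) = 2 * 2 ^ L := by rw [pow_succ, mul_comm]
      rw [h3]
      have hodd : Odd (m - 2 * 2 ^ L + 1) := by
        obtain ⟨k, hk⟩ := he
        exact ⟨k - 2 ^ L, by omega⟩
      have h5 := (EE_minus' (F := F) (m - 2 * 2 ^ L + 1)).resolve_right (by omega)
      refine EE_congr (EE_mul h5 (EE_Fp (L + 1)) (cop_minus_Fp card_even (by omega) hodd)) (by omega) ?_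
      have h6 := Fp_mul (Fintype.card F) (L + 1) (by omega)
      rw [hL2] at h6
      rw [← h6, ← mul_assoc, Nat.mul_div_cancel _ (by omega)]
  · rw [Mm_odd m _ hF ho]
    exact EE_PP m

end EEs
end SpAut
end PartE4

section PartE5
open Matrix
set_option linter.unusedSectionVars false
namespace SpAut

section special
variable {F : Type} [Field F] [CharP F 2] [Fintype F]

theorem phiG_bc {m : ℕ} (φ : F ≃+* F) (g : GG m (ZMod 2)) : phiG φ (bc F m g) = bc F m g := by
  apply Subtype.ext
  rw [phiG_coe, bc_coe, Matrix.map_map]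
  have : ((φ : F →+* F).comp (ZMod.castHom (dvd_refl 2) F)) = ZMod.castHom (dvd_refl 2) F := Subsingleton.elim _ _
  congr 1
  exact congrArg DFunLike.coe this

/-- elementary unipotent -/
def ux (m : ℕ) (x : F) : GG m F := ⟨fromBlocks 1 (x • 1) 0 1, by
  rw [SymplecticGroup.mem_iff, J, fromBlocks_transpose, fromBlocks_multiply, fromBlocks_multiply]
  simp⟩

theorem phiG_eq_one {m : ℕ} (hm : 1 ≤ m) (φ : F ≃+* F) (h : (phiG φ : MulAut (GG m F)) = 1) (x : F) : φ x = x := by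
  have h1 := congrArg (fun σ : MulAut (GG m F) => (σ (ux m x)).1 (Sum.inl ⟨0, hm⟩) (Sum.inr ⟨0, hm⟩)) h
  simpa [phiG_coe, ux] using h1

theorem phi_sq {m : ℕ} (hF : Fintype.card F = 4) : (phiG (frob2 : F ≃+* F) : MulAut (GG m F)) ^ 2 = 1 := by
  apply MulEquiv.ext
  intro g
  apply Subtype.ext
  rw [pow_two, MulAut.mul_apply, phiG_coe, phiG_coe, Matrix.map_map]
  ext i j
  have := FiniteField.pow_card (g.1 i j)
  rw [hF] at this
  simp only [Matrix.map_apply, Function.comp_apply, frob2_apply, MulAut.one_apply]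
  calc _ = (g.1 i j) ^ 4 := by ring
    _ = _ := this

theorem phi_ne {m : ℕ} (hm : 1 ≤ m) (hF : Fintype.card F = 4) : (phiG (frob2 : F ≃+* F) : MulAut (GG m F)) ≠ 1 := by
  intro h
  have h1 := phiG_eq_one hm _ h
  have := pow_all_ge (F := F) 2 1 le_rfl hF (fun x => by
    have := h1 x
    rw [frob2_apply] at this
    rw [pow_one, pow_two, this])
  omega

theorem phi_order {m : ℕ} (hm : 1 ≤ m) (hF : Fintype.card F = 4) : orderOf (phiG (frob2 : F ≃+* F) : MulAut (GG m F)) = 2 :=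
  orderOf_eq_prime (phi_sq hF) (phi_ne hm hF)

theorem order_mul_conj {m : ℕ} (τ : MulAut (GG m F)) (g : GG m F) (h : τ g = g) (hc : Nat.Coprime (orderOf τ) (orderOf g)) :
    orderOf (τ * MulAut.conj g) = orderOf τ * orderOf g := by
  have ho : orderOf (MulAut.conj g) = orderOf g := orderOf_injective _ conj_injective g
  rw [← ho]
  rw [← ho] at hc
  refine Commute.orderOf_mul_eq_mul_orderOf_of_coprime ?_ hc
  apply MulEquiv.ext
  intro x
  simp [MulAut.mul_apply, MulAut.conj_apply, h]

theorem exist_14 (hF : Fintype.card F = 4) : ∃ σ : MulAut (GG 1 F), orderOf σ = 6 := by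
  have h3 : orderOf (bc F 1 s3) = 3 := by rw [orderOf_injective _ bc_inj, s3_order]
  have h2 := phi_order (F := F) (m := 1) le_rfl hF
  refine ⟨phiG frob2 * MulAut.conj (bc F 1 s3), ?_⟩
  rw [order_mul_conj _ _ (phiG_bc _ _) (by rw [h2, h3]; norm_num), h2, h3]

theorem gamma_bc (g : GG 2 (ZMod 2)) : (gamma (bc F 2 g)).1 = (gm g.1).map (ZMod.castHom (dvd_refl 2) F) := by
  rw [gamma_coe, bc_coe]
  ext i j
  simp only [gm_apply, Matrix.map_apply, pmin, map_add, map_mul]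

theorem gamma_s5 : gamma (bc F 2 s5) = bc F 2 s5 := by
  apply Subtype.ext
  rw [gamma_bc, bc_coe]
  congr 1
  decide +kernel

theorem gamma_ne : (gamma : MulAut (GG 2 F)) ≠ 1 := by
  intro h
  have h1 := congrArg (fun σ : MulAut (GG 2 F) => (σ (bc F 2 u2)).1) h
  simp only [gamma_bc, MulAut.one_apply, bc_coe] at h1
  have h2 := Matrix.map_injective (ZMod.castHom (dvd_refl 2) F).injective h1
  revert h2
  decide +kernel

theorem gamma_sq : (gamma : MulAut (GG 2 F)) ^ 2 = phiG frob2 :=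
  MulEquiv.ext fun g => by rw [pow_two, MulAut.mul_apply, gamma_gamma]

theorem s5_order' : orderOf (bc F 2 s5) = 5 := by rw [orderOf_injective _ bc_inj, s5_order]

theorem exist_22 (hF : Fintype.card F = 2) : ∃ σ : MulAut (GG 2 F), orderOf σ = 10 := by
  have h2 : orderOf (gamma : MulAut (GG 2 F)) = 2 := by
    refine orderOf_eq_prime ?_ gamma_ne
    rw [gamma_sq]
    apply MulEquiv.ext
    intro g
    apply Subtype.ext
    rw [phiG_coe]
    ext i j
    have := FiniteField.pow_card (g.1 i j)
    rw [hF, pow_two] at this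
    simpa [frob2_apply] using this
  refine ⟨gamma * MulAut.conj (bc F 2 s5), ?_⟩
  rw [order_mul_conj _ _ gamma_s5 (by rw [h2, s5_order']; norm_num), h2, s5_order']

theorem exist_24 (hF : Fintype.card F = 4) : ∃ σ : MulAut (GG 2 F), orderOf σ = 20 := by
  have h2 : orderOf (gamma : MulAut (GG 2 F)) = 2 ^ (1 + 1) := by
    refine orderOf_eq_prime_pow ?_ ?_
    · rw [pow_one, gamma_sq]; exact phi_ne (by norm_num) hF
    · rw [pow_succ, pow_one, pow_mul, gamma_sq, phi_sq hF]
  refine ⟨gamma * MulAut.conj (bc F 2 s5), ?_⟩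
  rw [order_mul_conj _ _ gamma_s5 (by rw [h2, s5_order']; norm_num), h2, s5_order']
  norm_num

theorem exist_all (f m : ℕ) (hf : 1 ≤ f) (hm : 1 ≤ m) (hF : Fintype.card F = 2 ^ f) :
    ∃ σ : MulAut (GG m F), orderOf σ = NN m (2 ^ f) := by
  unfold NN
  rw [← hF]
  split_ifs with h1 h2 h3
  · obtain ⟨rfl, h⟩ := h1; exact exist_14 h
  · obtain ⟨rfl, h⟩ := h2; exact exist_22 h
  · obtain ⟨rfl, h⟩ := h3; exact exist_24 h
  · have : EE F m (Mm m (Fintype.card F)) := by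
      rcases pow_cases hf hF with h | h
      · rw [h]; exact EE_two m hm h
      · exact EE_big m hm h.1
    obtain ⟨h, hh⟩ := this
    exact ⟨MulAut.conj h, by rw [orderOf_injective _ conj_injective, hh]⟩

end special
end SpAut
end PartE5

/-- The maximum order of an element of Aut(Sp_2m(q)), q even, is 6 if (m,q) = (1,4),
10 if (m,q) = (2,2), 20 if (m,q) = (2,4), and M_m(q) otherwise. -/
theorem max_order_aut_symplectic (f q m : ℕ) (hf : 1 ≤ f) (hq : q = 2 ^ f) (hm : 1 ≤ m)
    (F : Type) [Field F] [Fintype F] (hF : Fintype.card F = q) :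
    letI N : ℕ :=
      if m = 1 ∧ q = 4 then 6
      else if m = 2 ∧ q = 2 then 10
      else if m = 2 ∧ q = 4 then 20
      else Mm m q
    (∃ g : MulAut ↥(Matrix.symplecticGroup (Fin m) F), orderOf g = N) ∧
      ∀ g : MulAut ↥(Matrix.symplecticGroup (Fin m) F), orderOf g ≤ N := by
  subst hq
  haveI : Fact (Nat.Prime 2) := ⟨Nat.prime_two⟩
  haveI : CharP F 2 := charP_of_card_eq_prime_pow hF
  exact ⟨SpAut.exist_all f m hf hm hF, SpAut.upper_bound f hf hm hF⟩
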